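/- Assume the nondegeneracy and curvature conditions and the auxiliary hypothesis, and fix γ ∈ (1/2, 1). Then for any ρ > 0 there exist c, C ∈ (0,∞) with the following property: for every ε > 0, every triple f = (f₁,f₂,f₃) of Lebesgue measurable functions with ‖f_j‖_{L∞} ≤ 1 for each j, and every measurable 𝒮 ⊆ S(f,ε), either |𝒮| ≤ C·ε^c, or there exist a measurable set S ⊆ 𝒮 and, for each j ∈ {1,2,3}, a function f_j* : ℝ → ℝ that is affine on intervals of length ε^γ, such that |S| ≥ c·|𝒮|^C, |f_j*(φ_j(x)) − f_j(φ_j(x))| ≤ C·ε^{1−ρ} for every x ∈ S and every j, and the slopes satisfy |(f_j*)'| ≤ C·ε^{−ρ} on every interval of the partition. -/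

import Mathlib

open MeasureTheory Set
open scoped ENNReal

noncomputable section

/-- `g` is affine, with slope bounded by `M` in absolute value, on the intervals of a
partition of `ℝ` into intervals of length `δ`. -/
def AffineOnIntervals (g : ℝ → ℝ) (δ M : ℝ) : Prop :=
  ∃ b : ℝ, ∀ n : ℤ, ∃ m q : ℝ, |m| ≤ M ∧
    ∀ y ∈ Set.Ico (b + (n : ℝ) * δ) (b + ((n : ℝ) + 1) * δ), g y = m * y + q

open scoped Topology

/-- one-dimensional sublevel estimate -/
lemma sublevel_one (k : ℕ) : ∃ C : ℝ, 0 ≤ C ∧ ∀ (T : Set ℝ), T.OrdConnected → ∀ (g : ℕ → ℝ → ℝ) (l : ℝ), 0 < l →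
    (∀ i < k, ∀ t ∈ T, HasDerivAt (g i) (g (i+1) t) t) → (∀ t ∈ T, l ≤ |g k t|) → ∀ s : ℝ, 0 < s →
    volume {t ∈ T | |g 0 t| < l * s ^ k} ≤ ENNReal.ofReal (C * s) := by
  induction k with
  | zero =>
    refine ⟨0, le_rfl, fun T hT g l hl hd hg s hs => ?_⟩
    have : {t ∈ T | |g 0 t| < l * s ^ 0} = ∅ := by
      ext t; simp only [pow_zero, mul_one, mem_setOf_eq, mem_empty_iff_false, iff_false, not_and, not_lt]
      exact hg t
    rw [this]; simp
  | succ k ih =>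
    obtain ⟨C, hC, ih⟩ := ih
    refine ⟨2 + 2 * C, by positivity, fun T hT g l hl hd hg s hs => ?_⟩
    have hTc : Convex ℝ T := hT.convex
    have hsgn : (∀ t ∈ T, g (k+1) t < 0) ∨ (∀ t ∈ T, 0 < g (k+1) t) := by
      refine hasDerivWithinAt_forall_lt_or_forall_gt_of_forall_ne (f := g k) hTc
        (fun t ht => (hd k (by omega) t ht).hasDerivWithinAt) (fun t ht h0 => ?_)
      have := hg t ht; rw [h0, abs_zero] at this; linarith
    have hcont : ContinuousOn (g k) T := fun t ht => (hd k (by omega) t ht).continuousAt.continuousWithinAt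
    have hmono : MonotoneOn (g k) T ∨ AntitoneOn (g k) T := by
      rcases hsgn with h | h
      · right
        refine (antitoneOn_of_hasDerivWithinAt_nonpos (f' := g (k+1)) hTc hcont (fun t ht => (hd k (by omega) t (interior_subset ht)).hasDerivWithinAt) (fun t ht => (h t (interior_subset ht)).le))
      · left
        refine (monotoneOn_of_hasDerivWithinAt_nonneg (f' := g (k+1)) hTc hcont (fun t ht => (hd k (by omega) t (interior_subset ht)).hasDerivWithinAt) (fun t ht => (h t (interior_subset ht)).le))
    set σ := l * s with hσ
    have hσ0 : 0 < σ := by positivity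
    have hP : OrdConnected {t ∈ T | σ ≤ g k t} := by
      constructor
      rintro x ⟨hx, hx'⟩ y ⟨hy, hy'⟩ z hz
      have hzT := hT.out hx hy hz
      refine ⟨hzT, ?_⟩
      rcases hmono with h | h
      · exact hx'.trans (h hx hzT hz.1)
      · exact hy'.trans (h hzT hy hz.2)
    have hN : OrdConnected {t ∈ T | g k t ≤ -σ} := by
      constructor
      rintro x ⟨hx, hx'⟩ y ⟨hy, hy'⟩ z hz
      have hzT := hT.out hx hy hz
      refine ⟨hzT, ?_⟩
      rcases hmono with h | h
      · exact (h hzT hy hz.2).trans hy'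
      · exact (h hx hzT hz.1).trans hx'
    have hM : volume {t ∈ T | |g k t| < σ} ≤ ENNReal.ofReal (2 * s) := by
      refine (Real.volume_le_diam _).trans ?_
      refine Metric.ediam_le ?_
      rintro x ⟨hx, hx'⟩ y ⟨hy, hy'⟩
      rw [edist_dist]
      refine ENNReal.ofReal_le_ofReal ?_
      have key : ∀ x ∈ T, ∀ y ∈ T, |g k x| < σ → |g k y| < σ → x < y → y - x ≤ 2 * s := by
        intro x hx y hy hx' hy' hxy
        have hsub : Icc x y ⊆ T := hT.out hx hy
        obtain ⟨c, hc, hc'⟩ := exists_hasDerivAt_eq_slope (g k) (g (k+1)) hxy (hcont.mono hsub)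
          (fun t ht => hd k (by omega) t (hsub (Ioo_subset_Icc_self ht)))
        have h1 := hg c (hsub (Ioo_subset_Icc_self hc))
        rw [hc', abs_div, abs_of_pos (by linarith : 0 < y - x), le_div_iff₀ (by linarith)] at h1
        have h2 : |g k y - g k x| ≤ 2 * σ := by
          rw [abs_lt] at hx' hy'; rw [abs_le]; constructor <;> linarith
        have h3 : l * (y - x) ≤ l * (2 * s) := by rw [hσ] at h2; linarith
        exact le_of_mul_le_mul_left h3 hl
      rw [Real.dist_eq]
      rcases lt_trichotomy x y with h | h | h
      · rw [abs_of_neg (by linarith)]; linarith [key x hx y hy hx' hy' h]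
      · rw [h]; simp; positivity
      · rw [abs_of_pos (by linarith)]; linarith [key y hy x hx hy' hx' h]
    have e1 := ih _ hP g σ hσ0 (fun i hi t ht => hd i (by omega) t ht.1) (fun t ht => ht.2.trans (le_abs_self _)) s hs
    have e2 := ih _ hN g σ hσ0 (fun i hi t ht => hd i (by omega) t ht.1) (fun t ht => by
      have := ht.2; rw [le_abs]; right; linarith) s hs
    have hss : σ * s ^ k = l * s ^ (k+1) := by rw [hσ]; ring
    rw [hss] at e1 e2
    have hsub : {t ∈ T | |g 0 t| < l * s ^ (k+1)} ⊆ {t ∈ T | |g k t| < σ} ∪ ({t ∈ {t ∈ T | σ ≤ g k t} | |g 0 t| < l * s ^ (k+1)} ∪ {t ∈ {t ∈ T | g k t ≤ -σ} | |g 0 t| < l * s ^ (k+1)}) := by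
      rintro t ⟨ht, ht'⟩
      by_cases h : |g k t| < σ
      · left; exact ⟨ht, h⟩
      · right
        rw [not_lt, le_abs] at h
        rcases h with h | h
        · left; exact ⟨⟨ht, h⟩, ht'⟩
        · right; exact ⟨⟨ht, by linarith⟩, ht'⟩
    calc _ ≤ _ := measure_mono hsub
      _ ≤ _ := (measure_union_le _ _).trans (add_le_add hM ((measure_union_le _ _).trans (add_le_add e1 e2)))
      _ = _ := by
        rw [← ENNReal.ofReal_add (by positivity) (by positivity), ← ENNReal.ofReal_add (by positivity) (by positivity)]
        congr 1; ring

lemma sublevel_local {E : Type*} [NormedAddCommGroup E] [NormedSpace ℝ E] [FiniteDimensional ℝ E]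
    [MeasurableSpace E] [BorelSpace E] (μ : Measure E) [μ.IsAddHaarMeasure]
    (Ω : Set E) (hΩ : IsOpen Ω) (hconn : IsPreconnected Ω) (F : E → ℝ) (hF : AnalyticOnNhd ℝ F Ω)
    (hne : ∃ y ∈ Ω, F y ≠ 0) (p : E) (hp : p ∈ Ω) :
    ∃ N ∈ 𝓝 p, ∃ C c : ℝ, 0 < C ∧ 0 < c ∧ c ≤ 1 ∧ ∀ θ : ℝ, 0 < θ → θ ≤ 1 →
      μ {x ∈ N | |F x| < θ} ≤ ENNReal.ofReal (C * θ ^ c) := by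
  obtain ⟨R0, hR0, hball⟩ := Metric.isOpen_iff.1 hΩ p hp
  obtain ⟨y, hy, hFy⟩ : ∃ y ∈ Metric.ball p R0, F y ≠ 0 := by
    by_contra! h
    obtain ⟨y, hy, hFy⟩ := hne
    refine hFy (hF.eqOn_zero_of_preconnected_of_eventuallyEq_zero hconn hp ?_ hy)
    filter_upwards [Metric.ball_mem_nhds p hR0] with x hx using h x hx
  set e := y - p with he
  let G : ℕ → E → ℝ := fun k => Nat.rec F (fun _ H x => fderiv ℝ H x e) k
  have hG0 : G 0 = F := rfl
  have hGs : ∀ k, G (k+1) = fun x => fderiv ℝ (G k) x e := fun k => rfl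
  have hGa : ∀ k, AnalyticOnNhd ℝ (G k) Ω := by
    intro k; induction k with
    | zero => exact hF
    | succ k ih =>
      rw [hGs]; intro x hx
      exact ((ContinuousLinearMap.apply ℝ ℝ e).analyticAt _).comp (ih.fderiv x hx)
  have hline : ∀ x : E, ∀ t : ℝ, HasDerivAt (fun t : ℝ => x + t • e) e t := by
    intro x t
    simpa using ((hasDerivAt_id t).smul_const e).const_add x
  have hGd : ∀ k, ∀ x : E, ∀ t : ℝ, x + t • e ∈ Ω → HasDerivAt (fun t : ℝ => G k (x + t • e)) (G (k+1) (x + t • e)) t := by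
    intro k x t ht
    have h1 := ((hGa k) _ ht).differentiableAt.hasFDerivAt
    exact h1.comp_hasDerivAt t (hline x t)
  have hcontl : Continuous (fun t : ℝ => p + t • e) := by fun_prop
  obtain ⟨k, hk⟩ : ∃ k, G k p ≠ 0 := by
    by_contra! hall
    let h : ℝ → ℝ := fun t => F (p + t • e)
    have hT : IsOpen ((fun t : ℝ => p + t • e) ⁻¹' Ω) := hΩ.preimage hcontl
    have hTc : Convex ℝ ((fun t : ℝ => p + t • e) ⁻¹' Metric.ball p R0) := by
      intro a ha b hb s t hs ht hst
      have := convex_ball p R0 ha hb hs ht hst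
      simp only [mem_preimage]
      convert this using 1
      have : p = s • p + t • p := by rw [← add_smul, hst, one_smul]
      nth_rewrite 1 [this]
      simp only [smul_add, smul_smul, add_smul, smul_eq_mul]; abel
    have hha : AnalyticOnNhd ℝ h ((fun t : ℝ => p + t • e) ⁻¹' Metric.ball p R0) := by
      intro t ht
      have h1 : AnalyticAt ℝ (fun t : ℝ => p + t • e) t := by fun_prop
      exact AnalyticAt.comp (g := F) (hF _ (hball ht)) h1
    have h0mem : (0:ℝ) ∈ ((fun t : ℝ => p + t • e) ⁻¹' Metric.ball p R0) := by simp [hR0]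
    have hit : ∀ k, iteratedDeriv k h =ᶠ[𝓝 0] fun t => G k (p + t • e) := by
      intro k; induction k with
      | zero => simp [iteratedDeriv_zero, h, hG0]
      | succ k ih =>
        rw [iteratedDeriv_succ]
        refine ih.deriv.trans ?_
        have : ∀ᶠ t in 𝓝 (0:ℝ), p + t • e ∈ Ω := hT.mem_nhds (by simpa using hp)
        filter_upwards [this] with t ht using (hGd k p t ht).deriv
    have htop : analyticOrderAt h 0 = ⊤ := by
      rw [ENat.eq_top_iff_forall_ge]
      intro n
      rw [natCast_le_analyticOrderAt_iff_iteratedDeriv_eq_zero (hha 0 h0mem)]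
      intro i _
      rw [(hit i).eq_of_nhds]; simpa using hall i
    rw [analyticOrderAt_eq_top] at htop
    have := hha.eqOn_zero_of_preconnected_of_eventuallyEq_zero hTc.isPreconnected h0mem htop
      (show (1:ℝ) ∈ _ by simpa [he] using hy)
    apply hFy; simpa [h, he] using this
  set l := |G k p| / 2 with hl
  have hlpos : 0 < l := by have := abs_pos.2 hk; positivity
  obtain ⟨R, hR, hRsub⟩ : ∃ R > 0, Metric.ball p R ⊆ Ω ∩ {x | l ≤ |G k x|} := by
    have : ∀ᶠ x in 𝓝 p, x ∈ Ω ∩ {x | l ≤ |G k x|} := by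
      have h1 : ∀ᶠ x in 𝓝 p, l < |G k x| :=
        ((hGa k p hp).continuousAt.abs).eventually (lt_mem_nhds (by rw [hl]; have := abs_pos.2 hk; linarith))
      filter_upwards [h1, hΩ.mem_nhds hp] with x h1 h2 using ⟨h2, h1.le⟩
    exact Metric.eventually_nhds_iff_ball.1 this
  obtain ⟨C, hC, hsub⟩ := sublevel_one k
  set N := Metric.ball p R
  set B := Metric.ball p (R + ‖e‖)
  have hBfin : μ B ≠ ⊤ := measure_ball_lt_top.ne
  have main : ∀ s : ℝ, 0 < s → μ {x ∈ N | |F x| < l * s ^ k} ≤ ENNReal.ofReal (C * s) * μ B := by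
    intro s hs
    set A := {x ∈ N | |F x| < l * s ^ k} with hA
    have hAo : IsOpen A := by
      have hc : ContinuousOn (fun x => |F x|) N := fun x hx => (hF x (hRsub hx).1).continuousAt.continuousWithinAt.abs
      exact hc.isOpen_inter_preimage Metric.isOpen_ball isOpen_Iio
    have hAm := hAo.measurableSet
    have hfib : ∀ x : E, volume {t : ℝ | x + t • e ∈ A} ≤ ENNReal.ofReal (C * s) := by
      intro x
      have hT : OrdConnected {t : ℝ | x + t • e ∈ N} := by
        apply Convex.ordConnected
        intro a ha b hb s t hs ht hst
        have := convex_ball p R ha hb hs ht hst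
        show x + (s • a + t • b) • e ∈ N
        convert this using 1
        have : x = s • x + t • x := by rw [← add_smul, hst, one_smul]
        nth_rewrite 1 [this]
        simp only [smul_add, smul_smul, add_smul, smul_eq_mul]; abel
      have := hsub _ hT (fun i t => G i (x + t • e)) l hlpos (fun i _ t ht => hGd i x t (hRsub ht).1)
        (fun t ht => (hRsub ht).2) s hs
      exact this
    -- averaging
    have hmeas : MeasurableSet {q : E × ℝ | q.2 ∈ Icc (0:ℝ) 1 ∧ q.1 + q.2 • e ∈ A} := by
      refine MeasurableSet.inter (measurable_snd measurableSet_Icc) ?_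
      exact (by fun_prop : Continuous (fun q : E × ℝ => q.1 + q.2 • e)).measurable hAm
    have e1 : (μ.prod volume) {q : E × ℝ | q.2 ∈ Icc (0:ℝ) 1 ∧ q.1 + q.2 • e ∈ A} = μ A := by
      rw [Measure.prod_apply_symm hmeas]
      have : ∀ t : ℝ, μ ((fun x => (x, t)) ⁻¹' {q : E × ℝ | q.2 ∈ Icc (0:ℝ) 1 ∧ q.1 + q.2 • e ∈ A}) = (Icc (0:ℝ) 1).indicator (fun _ => μ A) t := by
        intro t
        by_cases ht : t ∈ Icc (0:ℝ) 1
        · rw [indicator_of_mem ht, ← measure_preimage_add_right μ (t • e) A]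
          congr 1; ext x; simp only [mem_preimage, mem_setOf_eq, ht, true_and]
        · rw [indicator_of_notMem ht]
          convert measure_empty (μ := μ); ext x; simp only [mem_preimage, mem_setOf_eq, ht, false_and, mem_empty_iff_false]
      simp_rw [this]
      rw [lintegral_indicator measurableSet_Icc]; simp
    rw [← e1, Measure.prod_apply hmeas]
    calc _ ≤ ∫⁻ x, B.indicator (fun _ => ENNReal.ofReal (C * s)) x ∂μ := by
          refine lintegral_mono fun x => ?_
          by_cases hx : x ∈ B
          · rw [indicator_of_mem hx]
            refine le_trans (measure_mono ?_) (hfib x)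
            intro t ht; exact ht.2
          · rw [indicator_of_notMem hx, nonpos_iff_eq_zero]
            convert measure_empty (μ := (volume : Measure ℝ)); ext t
            simp only [mem_preimage, mem_setOf_eq, mem_empty_iff_false, iff_false]
            rintro ⟨ht, ht'⟩
            apply hx
            have h1 : ‖x + t • e - p‖ < R := mem_ball_iff_norm.1 ht'.1
            have h2 : ‖t • e‖ ≤ ‖e‖ := by
              rw [norm_smul, Real.norm_of_nonneg ht.1]; exact mul_le_of_le_one_left (norm_nonneg _) ht.2
            rw [mem_ball_iff_norm]
            have : x - p = (x + t • e - p) - t • e := by abel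
            rw [this]; exact (norm_sub_le _ _).trans_lt (by linarith)
      _ = _ := by rw [lintegral_indicator Metric.isOpen_ball.measurableSet]; simp [B]
  set b := (μ B).toReal with hb
  have hB : μ B = ENNReal.ofReal b := (ENNReal.ofReal_toReal hBfin).symm
  have hb0 : 0 ≤ b := ENNReal.toReal_nonneg
  refine ⟨N, Metric.ball_mem_nhds p hR, C * b + b / l + 1, 1 / ((k:ℝ)+1), by positivity, by positivity, ?_, ?_⟩
  · rw [div_le_one (by positivity)]; linarith [(Nat.cast_nonneg k : (0:ℝ) ≤ k)]
  intro θ hθ hθ1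
  set s := θ ^ (1 / ((k:ℝ)+1)) with hs
  have hspos : 0 < s := by positivity
  have hsk : s ^ k * s = θ := by
    rw [← pow_succ, hs, ← Real.rpow_natCast, ← Real.rpow_mul hθ.le]
    push_cast; rw [one_div_mul_cancel (by positivity), Real.rpow_one]
  by_cases hsl : s ≤ l
  · have hle : θ ≤ l * s ^ k := by rw [← hsk, mul_comm]; gcongr
    calc _ ≤ μ {x ∈ N | |F x| < l * s ^ k} := measure_mono fun x hx => ⟨hx.1, hx.2.trans_le hle⟩
      _ ≤ _ := main s hspos
      _ = ENNReal.ofReal (C * s * b) := by rw [hB, ← ENNReal.ofReal_mul (by positivity)]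
      _ ≤ _ := ENNReal.ofReal_le_ofReal (by
        have : 0 ≤ (b / l + 1) * s := by positivity
        nlinarith)
  · push Not at hsl
    calc _ ≤ μ B := measure_mono fun x hx => Metric.ball_subset_ball (by linarith [norm_nonneg e]) hx.1
      _ ≤ _ := by
        rw [hB]; refine ENNReal.ofReal_le_ofReal ?_
        have h1 : b ≤ b / l * s := by rw [div_mul_eq_mul_div, le_div_iff₀ hlpos]; gcongr
        have : 0 ≤ (C * b + 1) * s := by positivity
        nlinarith

/-- multi-dimensional sublevel estimate -/
lemma sublevel_multi {E : Type*} [NormedAddCommGroup E] [NormedSpace ℝ E] [FiniteDimensional ℝ E]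
    [MeasurableSpace E] [BorelSpace E] (μ : Measure E) [μ.IsAddHaarMeasure]
    (Ω : Set E) (hΩ : IsOpen Ω) (hconn : IsPreconnected Ω) (F : E → ℝ) (hF : AnalyticOnNhd ℝ F Ω)
    (hne : ∃ y ∈ Ω, F y ≠ 0) (K : Set E) (hK : IsCompact K) (hKΩ : K ⊆ Ω) :
    ∃ C c : ℝ, 0 < C ∧ 0 < c ∧ c ≤ 1 ∧ ∀ θ : ℝ, 0 < θ → θ ≤ 1 →
      μ {x ∈ K | |F x| < θ} ≤ ENNReal.ofReal (C * θ ^ c) := by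
  refine hK.induction_on (p := fun K => ∃ C c : ℝ, 0 < C ∧ 0 < c ∧ c ≤ 1 ∧ ∀ θ : ℝ, 0 < θ → θ ≤ 1 →
      μ {x ∈ K | |F x| < θ} ≤ ENNReal.ofReal (C * θ ^ c)) ?_ ?_ ?_ ?_
  · exact ⟨1, 1, one_pos, one_pos, le_rfl, fun θ _ _ => by simp⟩
  · rintro s t hst ⟨C, c, h1, h2, h3, h⟩
    exact ⟨C, c, h1, h2, h3, fun θ a b => le_trans (measure_mono (fun x hx => (⟨hst hx.1, hx.2⟩ : x ∈ {x ∈ t | |F x| < θ}))) (h θ a b)⟩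
  · rintro s t ⟨C, c, h1, h2, h3, h⟩ ⟨C', c', h1', h2', h3', h'⟩
    refine ⟨C + C', min c c', by positivity, by positivity, (min_le_left _ _).trans h3, fun θ a b => ?_⟩
    have hsub : {x ∈ s ∪ t | |F x| < θ} ⊆ {x ∈ s | |F x| < θ} ∪ {x ∈ t | |F x| < θ} := by
      rintro x ⟨hx | hx, hx'⟩
      · left; exact ⟨hx, hx'⟩
      · right; exact ⟨hx, hx'⟩
    refine (measure_mono hsub).trans ((measure_union_le _ _).trans ((add_le_add (h θ a b) (h' θ a b)).trans ?_))
    rw [← ENNReal.ofReal_add (by positivity) (by positivity)]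
    refine ENNReal.ofReal_le_ofReal ?_
    have e1 : θ ^ c ≤ θ ^ min c c' := Real.rpow_le_rpow_of_exponent_ge a b (min_le_left _ _)
    have e2 : θ ^ c' ≤ θ ^ min c c' := Real.rpow_le_rpow_of_exponent_ge a b (min_le_right _ _)
    rw [add_mul]; gcongr
  · intro x hx
    obtain ⟨N, hN, C, c, h⟩ := sublevel_local μ Ω hΩ hconn F hF hne x (hKΩ hx)
    exact ⟨N, mem_nhdsWithin_of_mem_nhds hN, C, c, h⟩

instance isAddHaar_vol_four : (volume : Measure ((ℝ × ℝ) × (ℝ × ℝ))).IsAddHaarMeasure := by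
  have : (volume : Measure (ℝ × ℝ)).IsAddHaarMeasure := by
    rw [Measure.volume_eq_prod]; infer_instance
  rw [Measure.volume_eq_prod]; infer_instance

lemma antilip_hausdorff {X Y : Type*} [MetricSpace X] [MetricSpace Y] [MeasurableSpace X] [BorelSpace X]
    [MeasurableSpace Y] [BorelSpace Y] (d : ℝ) (hd : 0 ≤ d) (f : X → Y) (s : Set X) (A : Set Y) (c : ℝ) (hc : 0 < c)
    (h : ∀ x ∈ s, ∀ y ∈ s, c * dist x y ≤ dist (f x) (f y)) :
    Measure.hausdorffMeasure d (s ∩ f ⁻¹' A) ≤ ENNReal.ofReal (c⁻¹) ^ d * Measure.hausdorffMeasure d A := by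
  rcases isEmpty_or_nonempty X with hX | hX
  · have : s ∩ f ⁻¹' A = ∅ := Set.eq_empty_of_isEmpty _
    rw [this]; simp
  have hinj : InjOn f s := by
    intro x hx y hy hxy
    have := h x hx y hy
    rw [hxy, dist_self] at this
    have h2 : dist x y ≤ 0 := by
      by_contra h3; push Not at h3; nlinarith
    exact dist_le_zero.1 h2
  set g := Function.invFunOn f s with hg
  have hgl : ∀ x ∈ s, g (f x) = x := fun x hx => hinj.leftInvOn_invFunOn hx
  have hL : LipschitzOnWith (Real.toNNReal c⁻¹) g (f '' (s ∩ f ⁻¹' A)) := by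
    refine LipschitzOnWith.of_dist_le_mul ?_
    rintro _ ⟨x, hx, rfl⟩ _ ⟨y, hy, rfl⟩
    rw [hgl x hx.1, hgl y hy.1, Real.coe_toNNReal _ (by positivity)]
    rw [inv_mul_eq_div, le_div_iff₀ hc, mul_comm]
    exact h x hx.1 y hy.1
  have him : g '' (f '' (s ∩ f ⁻¹' A)) = s ∩ f ⁻¹' A := by
    rw [image_image]
    ext x; constructor
    · rintro ⟨y, hy, rfl⟩; simp only []; rw [hgl y hy.1]; exact hy
    · intro hx; exact ⟨x, hx, hgl x hx.1⟩
  calc _ = Measure.hausdorffMeasure d (g '' (f '' (s ∩ f ⁻¹' A))) := by rw [him]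
    _ ≤ _ := hL.hausdorffMeasure_image_le hd
    _ ≤ _ := by
      gcongr
      · exact le_rfl
      · rintro _ ⟨x, hx, rfl⟩; exact hx.2

lemma antilip_one (f : ℝ → ℝ) (s A : Set ℝ) (c : ℝ) (hc : 0 < c)
    (h : ∀ x ∈ s, ∀ y ∈ s, c * |x - y| ≤ |f x - f y|) :
    volume (s ∩ f ⁻¹' A) ≤ ENNReal.ofReal c⁻¹ * volume A := by
  have := antilip_hausdorff 1 zero_le_one f s A c hc (by simpa [Real.dist_eq] using h)
  simpa [hausdorffMeasure_real] using this

lemma antilip_two (f : ℝ × ℝ → ℝ × ℝ) (s A : Set (ℝ × ℝ)) (c : ℝ) (hc : 0 < c)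
    (h : ∀ x ∈ s, ∀ y ∈ s, c * dist x y ≤ dist (f x) (f y)) :
    volume (s ∩ f ⁻¹' A) ≤ ENNReal.ofReal (c⁻¹ ^ 2) * volume A := by
  have := antilip_hausdorff 2 zero_le_two f s A c hc h
  rw [hausdorffMeasure_prod_real] at this
  convert this using 2
  rw [ENNReal.ofReal_pow (by positivity)]; norm_cast

set_option linter.unusedSectionVars false
section fubini
variable {A B D : Type*} [MeasureSpace A] [MeasureSpace B] [MeasureSpace D]
  [SFinite (volume : Measure A)] [SFinite (volume : Measure B)] [SFinite (volume : Measure D)]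

lemma mp_132 : MeasurePreserving (fun p : (A × B) × D => ((p.1.1, p.2), p.1.2)) volume volume := by
  have h1 : MeasurePreserving (MeasurableEquiv.prodAssoc : (A × B) × D ≃ᵐ A × (B × D)) volume volume := by
    exact measurePreserving_prodAssoc _ _ _
  have h2 : MeasurePreserving (Prod.map id Prod.swap : A × (B × D) → A × (D × B)) volume volume :=
    (MeasurePreserving.id volume).prod Measure.measurePreserving_swap
  have h3 : MeasurePreserving (MeasurableEquiv.prodAssoc.symm : A × (D × B) ≃ᵐ (A × D) × B) volume volume := by
    exact (measurePreserving_prodAssoc _ _ _).symm _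
  exact h3.comp (h2.comp h1)

lemma mp_231 : MeasurePreserving (fun p : (A × B) × D => ((p.1.2, p.2), p.1.1)) volume volume := by
  have h1 : MeasurePreserving (Prod.map Prod.swap id : (A × B) × D → (B × A) × D) volume volume :=
    Measure.measurePreserving_swap.prod (MeasurePreserving.id volume)
  exact mp_132.comp h1

lemma prod_fiber_le (E₁ E₂ : Set (A × B)) (h₁ : MeasurableSet E₁) (h₂ : MeasurableSet E₂) (k : ℝ≥0∞)
    (h : ∀ a, volume (Prod.mk a ⁻¹' E₁) ≤ k * volume (Prod.mk a ⁻¹' E₂)) : volume E₁ ≤ k * volume E₂ := by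
  rw [Measure.volume_eq_prod, Measure.prod_apply h₁, Measure.prod_apply h₂,
    ← lintegral_const_mul _ (measurable_measure_prodMk_left h₂)]
  exact lintegral_mono h

lemma prod_fiber_le_const (E : Set (A × B)) (h₁ : MeasurableSet E) (A₀ : Set A) (h₂ : MeasurableSet A₀)
    (hE : ∀ p ∈ E, p.1 ∈ A₀) (k : ℝ≥0∞)
    (h : ∀ a ∈ A₀, volume (Prod.mk a ⁻¹' E) ≤ k) : volume E ≤ k * volume A₀ := by
  rw [Measure.volume_eq_prod, Measure.prod_apply h₁]
  calc _ ≤ ∫⁻ a, A₀.indicator (fun _ => k) a := by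
        refine lintegral_mono fun a => ?_
        by_cases ha : a ∈ A₀
        · rw [indicator_of_mem ha]; exact h a ha
        · rw [indicator_of_notMem ha, nonpos_iff_eq_zero]
          have : Prod.mk a ⁻¹' E = ∅ := by
            ext b; simp only [mem_preimage, mem_empty_iff_false, iff_false]
            exact fun hb => ha (hE _ hb)
          rw [this]; simp
    _ = _ := by rw [lintegral_indicator h₂]; simp

lemma prod_fiber_ge (T : Set (A × B)) (h₁ : MeasurableSet T) (E' : Set A) (h₂ : MeasurableSet E') (k : ℝ≥0∞)
    (h : ∀ a ∈ E', k ≤ volume (Prod.mk a ⁻¹' T)) : k * volume E' ≤ volume T := by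
  rw [Measure.volume_eq_prod, Measure.prod_apply h₁]
  calc _ = ∫⁻ a, E'.indicator (fun _ => k) a := by rw [lintegral_indicator h₂]; simp
    _ ≤ _ := by
        refine lintegral_mono fun a => ?_
        by_cases ha : a ∈ E'
        · rw [indicator_of_mem ha]; exact h a ha
        · rw [indicator_of_notMem ha]; exact zero_le

lemma measurable_deg (E : Set (A × B)) (hE : MeasurableSet E) (l : ℝ≥0∞) :
    MeasurableSet {a : A | volume (Prod.mk a ⁻¹' E) < l} :=
  measurableSet_lt (measurable_measure_prodMk_left hE) measurable_const

lemma prune (E : Set (A × B)) (hE : MeasurableSet E) (A₀ : Set A) (h₂ : MeasurableSet A₀)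
    (hEA : ∀ p ∈ E, p.1 ∈ A₀) (l : ℝ≥0∞) :
    volume {p ∈ E | volume (Prod.mk p.1 ⁻¹' E) < l} ≤ l * volume A₀ := by
  have hm : MeasurableSet {p ∈ E | volume (Prod.mk p.1 ⁻¹' E) < l} := hE.inter (measurable_fst (measurable_deg E hE l))
  refine prod_fiber_le_const _ hm A₀ h₂ (fun p hp => hEA p hp.1) l ?_
  intro a _
  by_cases h : volume (Prod.mk a ⁻¹' E) < l
  · exact (measure_mono (fun b hb => hb.1)).trans h.le
  · have : Prod.mk a ⁻¹' {p ∈ E | volume (Prod.mk p.1 ⁻¹' E) < l} = ∅ := by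
      ext b; simp only [mem_preimage, mem_ofPred_eq, mem_empty_iff_false, iff_false]
      exact fun hb => h hb.2
    rw [this]; simp

end fubini

/-- the measure of the set of `(u,(y,y'))` with `y, y'` within `d` of `u`. -/
lemma vol_near (I : Set ℝ) (hI : MeasurableSet I) (d : ℝ) (hd : 0 ≤ d) :
    volume {q : ℝ × (ℝ × ℝ) | q.1 ∈ I ∧ |q.2.1 - q.1| ≤ d ∧ |q.2.2 - q.1| ≤ d} ≤ ENNReal.ofReal (4 * d ^ 2) * volume I := by
  refine prod_fiber_le_const _ ?_ I hI (fun p hp => hp.1) _ ?_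
  · refine (measurable_fst hI).inter (MeasurableSet.inter ?_ ?_)
    · exact measurableSet_le (f := fun q : ℝ × (ℝ × ℝ) => |q.2.1 - q.1|) (by fun_prop) measurable_const
    · exact measurableSet_le (f := fun q : ℝ × (ℝ × ℝ) => |q.2.2 - q.1|) (by fun_prop) measurable_const
  · intro u hu
    have : Prod.mk u ⁻¹' {q : ℝ × (ℝ × ℝ) | q.1 ∈ I ∧ |q.2.1 - q.1| ≤ d ∧ |q.2.2 - q.1| ≤ d} ⊆ Icc (u - d) (u + d) ×ˢ Icc (u - d) (u + d) := by
      rintro ⟨y, y'⟩ ⟨_, h1, h2⟩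
      simp only [abs_le] at h1 h2
      exact ⟨⟨by linarith, by linarith⟩, ⟨by linarith, by linarith⟩⟩
    refine (measure_mono this).trans ?_
    rw [Measure.volume_eq_prod, Measure.prod_prod, Real.volume_Icc, ← ENNReal.ofReal_mul (by linarith)]
    refine ENNReal.ofReal_le_ofReal (by nlinarith)

def Theta (w V U : ℝ × ℝ → ℝ) (α β : ℝ × ℝ) (y : ℝ) : ℝ :=
  V (U (V (y, w (α.1, β.2)), w β), w (β.1, α.2))

def MM (r : ℝ × ℝ → ℝ) (α β : ℝ × ℝ) : ℝ := r (α.1, β.2) * r (β.1, α.2) / r β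

/-- Quantitative geometric facts on a coordinate box. -/
structure Geo (I J : Set ℝ) (w V U r : ℝ × ℝ → ℝ) (Jd : (ℝ × ℝ) × (ℝ × ℝ) → ℝ) (K c : ℝ) : Prop where
  hK : 1 ≤ K
  hc : 0 < c
  hc1 : c ≤ 1
  mI : MeasurableSet I
  mJ : MeasurableSet J
  bI : ∃ p, I ⊆ Icc p (p + 1)
  bJ : ∃ p, J ⊆ Icc p (p + 1)
  mw : Measurable w
  mV : Measurable V
  mU : Measurable U
  mr : Measurable r
  mJd : Measurable Jd
  VU : ∀ u ∈ I, ∀ v ∈ J, ∀ z ∈ J, V (U (z, w (u, v)), w (u, v)) = z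
  UV : ∀ u ∈ I, ∀ v ∈ J, ∀ y ∈ I, U (V (y, w (u, v)), w (u, v)) = y
  Vw : ∀ u ∈ I, ∀ v ∈ J, V (u, w (u, v)) = v
  Vlip : ∀ u ∈ I, ∀ v ∈ J, ∀ y ∈ I, ∀ y' ∈ I, |V (y, w (u, v)) - V (y', w (u, v))| ≤ K * |y - y'|
  Vanti : ∀ u ∈ I, ∀ v ∈ J, ∀ y ∈ I, ∀ y' ∈ I, |y - y'| ≤ K * |V (y, w (u, v)) - V (y', w (u, v))|
  rub : ∀ u ∈ I, ∀ v ∈ J, |r (u, v)| ≤ K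
  rlb : ∀ u ∈ I, ∀ v ∈ J, 1 ≤ K * |r (u, v)|
  h5 : ∀ α ∈ I ×ˢ J, ∀ β ∈ I ×ˢ J, ∀ β' ∈ I ×ˢ J, ∀ β₀ ∈ I ×ˢ J, ∀ y ∈ I, y ≠ α.1 → ∀ j : ℝ, 0 < j → j ≤ 1 →
    K * |y - α.1| ≤ j → K * dist β β₀ ≤ j → K * dist β' β₀ ≤ j → j ≤ |Jd (α, β₀)| →
    j * dist β β' ≤ K * max |(Theta w V U α β y - Theta w V U α β' y) / (y - α.1)| |MM r α β - MM r α β'|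
  h6a : ∀ α ∈ I ×ˢ J, ∀ β ∈ I ×ˢ J, ∀ y ∈ I, |Theta w V U α β y - α.2| ≤ K * |y - α.1|
  h6b : ∀ α ∈ I ×ˢ J, ∀ β ∈ I ×ˢ J, ∀ y ∈ I, ∀ y' ∈ I, y ≠ α.1 → ∀ d : ℝ, |y - α.1| ≤ d → |y' - α.1| ≤ d →
    |Theta w V U α β y' - (α.2 + (y' - α.1) * ((Theta w V U α β y - α.2) / (y - α.1)))| ≤ K * d ^ 2
  h7 : ∀ j : ℝ, 0 < j → j ≤ 1 → volume {p : (ℝ × ℝ) × (ℝ × ℝ) | p.1 ∈ I ×ˢ J ∧ p.2 ∈ I ×ˢ J ∧ |Jd p| < j} ≤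
    ENNReal.ofReal (K * j ^ c)

lemma strip_area (q : ℝ → ℝ) (hq : Measurable q) (x η t K : ℝ) (hη : 0 < η) (hx : 1 / η < |x|) (ht : 0 ≤ t) (_hK : 0 ≤ K) :
    volume {p : ℝ × ℝ | |p.1| ≤ K ∧ |p.2 * x + q p.1| ≤ t} ≤ ENNReal.ofReal (4 * K * t * η) := by
  have hx0 : 0 < |x| := lt_trans (by positivity) hx
  have : volume {p : ℝ × ℝ | |p.1| ≤ K ∧ |p.2 * x + q p.1| ≤ t} ≤ ENNReal.ofReal (2 * t * η) * volume (Icc (-K) K) := by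
    refine prod_fiber_le_const _ ?_ _ measurableSet_Icc ?_ _ ?_
    · refine MeasurableSet.inter (measurableSet_le (f := fun p : ℝ × ℝ => |p.1|) (by fun_prop) measurable_const) ?_
      exact measurableSet_le (f := fun p : ℝ × ℝ => |p.2 * x + q p.1|) (by fun_prop) measurable_const
    · rintro p ⟨hp, _⟩; exact abs_le.1 hp
    · intro m _
      have h1 := antilip_one (fun M => M * x + q m) univ (Icc (-t) t) |x| hx0 (by
        intro a _ b _
        rw [← abs_mul]; apply le_of_eq; congr 1; ring)
      refine (measure_mono ?_).trans (h1.trans ?_)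
      · rintro M ⟨_, hM⟩; exact ⟨mem_univ _, abs_le.1 hM⟩
      · rw [Real.volume_Icc, ← ENNReal.ofReal_mul (by positivity)]
        refine ENNReal.ofReal_le_ofReal ?_
        have : |x|⁻¹ ≤ η := by
          rw [inv_le_comm₀ hx0 hη]; rw [one_div] at hx; exact hx.le
        calc |x|⁻¹ * (t - -t) = 2 * t * |x|⁻¹ := by ring
          _ ≤ _ := by gcongr
  refine this.trans ?_
  rw [Real.volume_Icc, ← ENNReal.ofReal_mul (by positivity)]
  exact ENNReal.ofReal_le_ofReal (by nlinarith)

lemma card_cells (p s : ℝ) (hs : 0 < s) (hs1 : s ≤ 1) : ((Finset.Icc ⌊p / s⌋ ⌊(p + 1) / s⌋).card : ℝ) ≤ 3 / s := by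
  rw [Int.card_Icc]
  have h1 : ⌊p / s⌋ ≤ ⌊(p+1)/s⌋ := Int.floor_le_floor (by gcongr; linarith)
  have h2 : ((⌊(p + 1) / s⌋ + 1 - ⌊p / s⌋).toNat : ℝ) = ((⌊(p + 1) / s⌋ + 1 - ⌊p / s⌋ : ℤ) : ℝ) := by
    rw [← Int.cast_natCast, Int.toNat_of_nonneg (by omega)]
  rw [h2]; push_cast
  have h3 := Int.floor_le ((p+1)/s)
  have h4 := Int.lt_floor_add_one (p/s)
  have h5 : (p+1)/s = p/s + 1/s := by rw [add_div]
  have h6 : 1 ≤ 1/s := by rw [le_div_iff₀ hs]; linarith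
  have h7 : 3/s = 3*(1/s) := by ring
  linarith

lemma floor_mem_cells {p s x : ℝ} (hs : 0 < s) (hx : x ∈ Icc p (p+1)) : ⌊x / s⌋ ∈ Finset.Icc ⌊p / s⌋ ⌊(p + 1) / s⌋ := by
  rw [Finset.mem_Icc]
  exact ⟨Int.floor_le_floor (by gcongr; exact hx.1), Int.floor_le_floor (by gcongr; exact hx.2)⟩

lemma dist_of_floor_eq {x y s : ℝ} (hs : 0 < s) (h : ⌊x / s⌋ = ⌊y / s⌋) : |x - y| ≤ s := by
  have h1 := Int.abs_sub_lt_one_of_floor_eq_floor h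
  rw [← sub_div, abs_div, abs_of_pos hs, div_lt_one hs] at h1
  exact h1.le

lemma core_fiber {I J : Set ℝ} {w V U r : ℝ × ℝ → ℝ} {Jd : (ℝ × ℝ) × (ℝ × ℝ) → ℝ} {K c : ℝ}
    (G : Geo I J w V U r Jd K c) (α : ℝ × ℝ) (hα : α ∈ I ×ˢ J) (y y' : ℝ) (hy : y ∈ I) (hy' : y' ∈ I)
    (hne : y ≠ α.1) (δ : ℝ) (hδ : 0 < δ) (h1 : |y - α.1| ≤ δ) (h2 : |y' - α.1| ≤ δ)
    (j : ℝ) (hj : 0 < j) (hj1 : j ≤ 1) (hδj : K * δ ≤ j) (x η t : ℝ) (hη : 0 < η) (hx : 1 / η < |x|) (ht : 0 ≤ t)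
    (Y : ℝ × ℤ → ℝ) (hY : Measurable Y) :
    volume {β : ℝ × ℝ | β ∈ I ×ˢ J ∧ j ≤ |Jd (α, β)| ∧
      |MM r α β * x + Y (Theta w V U α β y, ⌊Theta w V U α β y' / δ ^ 2⌋)| ≤ t} ≤
      ENNReal.ofReal (252 * K ^ 6 * t * η / j ^ 4) := by
  have hK := G.hK
  have hK0 : 0 < K := by linarith
  obtain ⟨p, hp⟩ := G.bI
  obtain ⟨p', hp'⟩ := G.bJ
  set s := j / K with hs
  have hs0 : 0 < s := by positivity
  have hs1 : s ≤ 1 := by rw [hs, div_le_one hK0]; linarith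
  set P : ℤ := ⌈K⌉ + 1 with hP
  set S := {β : ℝ × ℝ | β ∈ I ×ˢ J ∧ j ≤ |Jd (α, β)| ∧
      |MM r α β * x + Y (Theta w V U α β y, ⌊Theta w V U α β y' / δ ^ 2⌋)| ≤ t} with hS
  let fm : ℝ × ℝ → ℝ := fun β => (Theta w V U α β y - α.2) / (y - α.1)
  let q : ℤ → ℝ → ℝ := fun k m => Y (α.2 + (y - α.1) * m, ⌊(α.2 + (y' - α.1) * m) / δ ^ 2⌋ + k)
  have hqm : ∀ k, Measurable (q k) := by
    intro k
    refine hY.comp (Measurable.prodMk (by fun_prop) ?_)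
    exact (Measurable.floor (by fun_prop)).add_const k
  let A : ℤ → Set (ℝ × ℝ) := fun k => {p : ℝ × ℝ | |p.1| ≤ K ∧ |p.2 * x + q k p.1| ≤ t}
  have hA : ∀ k, volume (A k) ≤ ENNReal.ofReal (4 * K * t * η) := fun k => strip_area (q k) (hqm k) x η t K hη hx ht hK0.le
  let f : ℝ × ℝ → ℝ × ℝ := fun β => (fm β, MM r α β)
  let F := Finset.Icc (-P) P ×ˢ (Finset.Icc ⌊p / s⌋ ⌊(p + 1) / s⌋ ×ˢ Finset.Icc ⌊p' / s⌋ ⌊(p' + 1) / s⌋)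
  let Q : ℤ × (ℤ × ℤ) → Set (ℝ × ℝ) := fun i => {β | β ∈ S ∧ ⌊β.1 / s⌋ = i.2.1 ∧ ⌊β.2 / s⌋ = i.2.2}
  have hdne : y - α.1 ≠ 0 := sub_ne_zero.2 hne
  have hcover : S ⊆ ⋃ i ∈ F, (Q i ∩ f ⁻¹' (A i.1)) := by
    intro β hβ
    have hm6 := G.h6b α hα β hβ.1 y hy y' hy' hne δ h1 h2
    have e1 : α.2 + (y - α.1) * fm β = Theta w V U α β y := by
      simp only [fm]; field_simp; ring
    set k : ℤ := ⌊Theta w V U α β y' / δ ^ 2⌋ - ⌊(α.2 + (y' - α.1) * fm β) / δ ^ 2⌋ with hk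
    have hkP : |(k:ℝ)| ≤ K + 1 := by
      have hd2 : 0 < δ ^ 2 := by positivity
      have e2 : |Theta w V U α β y' / δ ^ 2 - (α.2 + (y' - α.1) * fm β) / δ ^ 2| ≤ K := by
        rw [← sub_div, abs_div, abs_of_pos hd2, div_le_iff₀ hd2]; exact hm6
      have e3 := Int.floor_le (Theta w V U α β y' / δ ^ 2)
      have e4 := Int.lt_floor_add_one (Theta w V U α β y' / δ ^ 2)
      have e5 := Int.floor_le ((α.2 + (y' - α.1) * fm β) / δ ^ 2)
      have e6 := Int.lt_floor_add_one ((α.2 + (y' - α.1) * fm β) / δ ^ 2)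
      rw [hk]; push_cast; rw [abs_le] at e2 ⊢
      constructor <;> linarith
    have hkmem : k ∈ Finset.Icc (-P) P := by
      rw [abs_le] at hkP
      have e7 := Int.le_ceil K
      rw [Finset.mem_Icc, hP]
      constructor
      · have : ((-(⌈K⌉ + 1) : ℤ) : ℝ) ≤ k := by push_cast; linarith
        exact_mod_cast this
      · have : (k:ℝ) ≤ ((⌈K⌉ + 1 : ℤ) : ℝ) := by push_cast; linarith
        exact_mod_cast this
    simp only [mem_iUnion]
    refine ⟨(k, (⌊β.1 / s⌋, ⌊β.2 / s⌋)), ?_, ⟨hβ, rfl, rfl⟩, ?_⟩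
    · simp only [F, Finset.mem_product]
      exact ⟨hkmem, floor_mem_cells hs0 (hp hβ.1.1), floor_mem_cells hs0 (hp' hβ.1.2)⟩
    · refine ⟨?_, ?_⟩
      · have := G.h6a α hα β hβ.1 y hy
        show |(Theta w V U α β y - α.2) / (y - α.1)| ≤ K
        rw [abs_div, div_le_iff₀ (abs_pos.2 hdne)]; exact this
      · show |MM r α β * x + Y (α.2 + (y - α.1) * fm β, ⌊(α.2 + (y' - α.1) * fm β) / δ ^ 2⌋ + k)| ≤ t
        rw [e1, hk, add_sub_cancel]
        exact hβ.2.2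
  have hpiece : ∀ i ∈ F, volume (Q i ∩ f ⁻¹' (A i.1)) ≤ ENNReal.ofReal ((K / j) ^ 2 * (4 * K * t * η)) := by
    intro i _
    rcases (Q i).eq_empty_or_nonempty with he | ⟨β₀, hβ₀⟩
    · rw [he]; simp
    have hdist : ∀ β ∈ Q i, K * dist β β₀ ≤ j := by
      intro β hβ
      have : dist β β₀ ≤ s := by
        rw [Prod.dist_eq, max_le_iff, Real.dist_eq, Real.dist_eq]
        exact ⟨dist_of_floor_eq hs0 (hβ.2.1.trans hβ₀.2.1.symm), dist_of_floor_eq hs0 (hβ.2.2.trans hβ₀.2.2.symm)⟩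
      calc K * dist β β₀ ≤ K * s := by gcongr
        _ = j := by rw [hs]; field_simp
    have := antilip_two f (Q i) (A i.1) (j / K) hs0 (by
      intro β hβ β' hβ'
      have h := G.h5 α hα β hβ.1.1 β' hβ'.1.1 β₀ hβ₀.1.1 y hy hne j hj hj1 ((by gcongr : K * |y - α.1| ≤ K * δ).trans hδj) (hdist β hβ) (hdist β' hβ') hβ₀.1.2.1
      rw [div_mul_eq_mul_div, div_le_iff₀ hK0, mul_comm (dist _ _)]
      refine h.trans (le_of_eq ?_)
      rw [Prod.dist_eq, Real.dist_eq, Real.dist_eq]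
      congr 3
      simp only [f, fm]; rw [← sub_div]; congr 1; ring)
    refine this.trans ?_
    rw [inv_div, ENNReal.ofReal_mul (by positivity)]
    gcongr
    exact hA _
  have hcard : (F.card : ℝ) ≤ 7 * K * (3 / s) ^ 2 := by
    simp only [F, Finset.card_product]; push_cast
    have c1 : ((Finset.Icc (-P) P).card : ℝ) ≤ 7 * K := by
      have hP0 : 0 ≤ P := by
        have : (0:ℤ) ≤ ⌈K⌉ := Int.ceil_nonneg hK0.le
        omega
      rw [Int.card_Icc]
      have : ((P + 1 - -P).toNat : ℝ) = ((P + 1 - -P : ℤ) : ℝ) := by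
        rw [← Int.cast_natCast, Int.toNat_of_nonneg (by omega)]
      rw [this, hP]; push_cast
      linarith [Int.ceil_lt_add_one K]
    have c2 := card_cells p s hs0 hs1
    have c3 := card_cells p' s hs0 hs1
    calc _ ≤ 7 * K * ((3 / s) * (3 / s)) := by gcongr
      _ = _ := by ring
  calc volume S ≤ _ := measure_mono hcover
    _ ≤ ∑ i ∈ F, volume (Q i ∩ f ⁻¹' (A i.1)) := measure_biUnion_finset_le _ _
    _ ≤ ∑ i ∈ F, ENNReal.ofReal ((K / j) ^ 2 * (4 * K * t * η)) := Finset.sum_le_sum hpiece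
    _ = ENNReal.ofReal (F.card * ((K / j) ^ 2 * (4 * K * t * η))) := by
      rw [Finset.sum_const, nsmul_eq_mul, ENNReal.ofReal_mul (p := (F.card : ℝ)) (by positivity), ENNReal.ofReal_natCast]
    _ ≤ _ := by
      refine ENNReal.ofReal_le_ofReal ?_
      calc _ ≤ 7 * K * (3 / s) ^ 2 * ((K / j) ^ 2 * (4 * K * t * η)) := by gcongr
        _ = _ := by rw [hs]; field_simp; ring

lemma vol_near' {A : Type*} [MeasureSpace A] [SFinite (volume : Measure A)] (g : A → ℝ) (hg : Measurable g)
    (B : Set A) (hB : MeasurableSet B) (d : ℝ) (hd : 0 ≤ d) :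
    volume {q : A × (ℝ × ℝ) | q.1 ∈ B ∧ |q.2.1 - g q.1| ≤ d ∧ |q.2.2 - g q.1| ≤ d} ≤ ENNReal.ofReal (4 * d ^ 2) * volume B := by
  refine prod_fiber_le_const _ ?_ B hB (fun p hp => hp.1) _ ?_
  · refine (measurable_fst hB).inter (MeasurableSet.inter ?_ ?_)
    · exact measurableSet_le (f := fun q : A × (ℝ × ℝ) => |q.2.1 - g q.1|) (by fun_prop) measurable_const
    · exact measurableSet_le (f := fun q : A × (ℝ × ℝ) => |q.2.2 - g q.1|) (by fun_prop) measurable_const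
  · intro a hu
    set u := g a with hu'
    have : Prod.mk a ⁻¹' {q : A × (ℝ × ℝ) | q.1 ∈ B ∧ |q.2.1 - g q.1| ≤ d ∧ |q.2.2 - g q.1| ≤ d} ⊆ Icc (u - d) (u + d) ×ˢ Icc (u - d) (u + d) := by
      rintro ⟨y, y'⟩ ⟨_, h1, h2⟩
      simp only [abs_le, ← hu'] at h1 h2
      exact ⟨⟨by linarith, by linarith⟩, ⟨by linarith, by linarith⟩⟩
    refine (measure_mono this).trans ?_
    rw [Measure.volume_eq_prod, Measure.prod_prod, Real.volume_Icc, ← ENNReal.ofReal_mul (by linarith)]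
    refine ENNReal.ofReal_le_ofReal (by nlinarith)

lemma vol_le_one {I : Set ℝ} (h : ∃ p, I ⊆ Icc p (p + 1)) : volume I ≤ 1 := by
  obtain ⟨p, hp⟩ := h
  refine (measure_mono hp).trans ?_
  rw [Real.volume_Icc]; simp

section
variable {I J : Set ℝ} {w V U r : ℝ × ℝ → ℝ} {Jd : (ℝ × ℝ) × (ℝ × ℝ) → ℝ} {K c : ℝ}

lemma Geo.vol_box (G : Geo I J w V U r Jd K c) : volume (I ×ˢ J) ≤ 1 := by
  rw [Measure.volume_eq_prod, Measure.prod_prod]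
  exact mul_le_one' (vol_le_one G.bI) (vol_le_one G.bJ)

def That (I J : Set ℝ) (w V U r : ℝ × ℝ → ℝ) (X : ℝ × (ℝ × ℝ) → ℝ) (Y : (ℝ × ℝ) × ℤ → ℝ) (δ η t : ℝ) :
    Set (((ℝ × ℝ) × (ℝ × ℝ)) × (ℝ × ℝ)) :=
  {p | (p.1.1 ∈ I ×ˢ J ∧ p.1.2 ∈ I ×ˢ J ∧ p.2.1 ∈ I ∧ p.2.2 ∈ I ∧ p.2.1 ≠ p.1.1.1) ∧
    (|p.2.1 - p.1.1.1| ≤ δ ∧ |p.2.2 - p.1.1.1| ≤ δ) ∧ 1 / η < |X (p.1.1.1, p.2)| ∧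
    |MM r p.1.1 p.1.2 * X (p.1.1.1, p.2) +
      Y ((p.1.1.2, Theta w V U p.1.1 p.1.2 p.2.1), ⌊Theta w V U p.1.1 p.1.2 p.2.2 / δ ^ 2⌋)| ≤ t}

lemma Theta_meas (G : Geo I J w V U r Jd K c) {A : Type*} [MeasurableSpace A] (a b : A → ℝ × ℝ) (y : A → ℝ)
    (ha : Measurable a) (hb : Measurable b) (hy : Measurable y) : Measurable (fun p => Theta w V U (a p) (b p) (y p)) := by
  have h1 := G.mw; have h2 := G.mV; have h3 := G.mU
  unfold Theta; fun_prop

lemma MM_meas (G : Geo I J w V U r Jd K c) {A : Type*} [MeasurableSpace A] (a b : A → ℝ × ℝ)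
    (ha : Measurable a) (hb : Measurable b) : Measurable (fun p => MM r (a p) (b p)) := by
  have h1 := G.mr
  unfold MM; fun_prop

lemma That_meas (G : Geo I J w V U r Jd K c) (X : ℝ × (ℝ × ℝ) → ℝ) (hX : Measurable X)
    (Y : (ℝ × ℝ) × ℤ → ℝ) (hY : Measurable Y) (δ η t : ℝ) : MeasurableSet (That I J w V U r X Y δ η t) := by
  have hIJ : MeasurableSet (I ×ˢ J) := G.mI.prod G.mJ
  have t1 : Measurable fun p : ((ℝ × ℝ) × (ℝ × ℝ)) × (ℝ × ℝ) => Theta w V U p.1.1 p.1.2 p.2.1 :=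
    Theta_meas G _ _ _ (by fun_prop) (by fun_prop) (by fun_prop)
  have t2 : Measurable fun p : ((ℝ × ℝ) × (ℝ × ℝ)) × (ℝ × ℝ) => ⌊Theta w V U p.1.1 p.1.2 p.2.2 / δ ^ 2⌋ :=
    ((Theta_meas G _ _ _ (by fun_prop) (by fun_prop) (by fun_prop)).div_const _).floor
  have t3 : Measurable fun p : ((ℝ × ℝ) × (ℝ × ℝ)) × (ℝ × ℝ) => MM r p.1.1 p.1.2 :=
    MM_meas G _ _ (by fun_prop) (by fun_prop)
  have t4 : Measurable fun p : ((ℝ × ℝ) × (ℝ × ℝ)) × (ℝ × ℝ) => X (p.1.1.1, p.2) := by fun_prop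
  refine MeasurableSet.inter ?_ (MeasurableSet.inter ?_ (MeasurableSet.inter ?_ ?_))
  · refine MeasurableSet.inter ?_ (MeasurableSet.inter ?_ (MeasurableSet.inter ?_ (MeasurableSet.inter ?_ ?_)))
    · exact (by fun_prop : Measurable fun p : ((ℝ × ℝ) × (ℝ × ℝ)) × (ℝ × ℝ) => p.1.1) hIJ
    · exact (by fun_prop : Measurable fun p : ((ℝ × ℝ) × (ℝ × ℝ)) × (ℝ × ℝ) => p.1.2) hIJ
    · exact (by fun_prop : Measurable fun p : ((ℝ × ℝ) × (ℝ × ℝ)) × (ℝ × ℝ) => p.2.1) G.mI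
    · exact (by fun_prop : Measurable fun p : ((ℝ × ℝ) × (ℝ × ℝ)) × (ℝ × ℝ) => p.2.2) G.mI
    · exact (measurableSet_eq_fun (f := fun p : ((ℝ × ℝ) × (ℝ × ℝ)) × (ℝ × ℝ) => p.2.1) (g := fun p => p.1.1.1) (by fun_prop) (by fun_prop)).compl
  · refine MeasurableSet.inter ?_ ?_
    · exact measurableSet_le (f := fun p : ((ℝ × ℝ) × (ℝ × ℝ)) × (ℝ × ℝ) => |p.2.1 - p.1.1.1|) (by fun_prop) measurable_const
    · exact measurableSet_le (f := fun p : ((ℝ × ℝ) × (ℝ × ℝ)) × (ℝ × ℝ) => |p.2.2 - p.1.1.1|) (by fun_prop) measurable_const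
  · exact measurableSet_lt measurable_const t4.abs
  · refine measurableSet_le (Measurable.abs ((t3.mul t4).add (hY.comp ?_))) measurable_const
    exact Measurable.prodMk (Measurable.prodMk (by fun_prop) t1) t2

lemma That_vol (G : Geo I J w V U r Jd K c) (X : ℝ × (ℝ × ℝ) → ℝ) (hX : Measurable X)
    (Y : (ℝ × ℝ) × ℤ → ℝ) (hY : Measurable Y) (δ η t j : ℝ) (hδ : 0 < δ) (hη : 0 < η) (ht : 0 ≤ t)
    (hj : 0 < j) (hj1 : j ≤ 1) (hδj : K * δ ≤ j) :
    volume (That I J w V U r X Y δ η t) ≤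
      ENNReal.ofReal ((1008 * K ^ 6 * t * η / j ^ 4 + 4 * K * j ^ c) * δ ^ 2) := by
  have hK := G.hK
  have hK0 : 0 < K := by linarith
  have hm := That_meas G X hX Y hY δ η t
  have hIJ : MeasurableSet (I ×ˢ J) := G.mI.prod G.mJ
  have hJdm : MeasurableSet {p : ((ℝ × ℝ) × (ℝ × ℝ)) × (ℝ × ℝ) | |Jd p.1| < j} := by
    have := G.mJd
    exact measurableSet_lt (f := fun p : ((ℝ × ℝ) × (ℝ × ℝ)) × (ℝ × ℝ) => |Jd p.1|) (by fun_prop) measurable_const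
  set T := That I J w V U r X Y δ η t with hT
  have part1 : volume (T ∩ {p | |Jd p.1| < j}) ≤ ENNReal.ofReal (4 * δ ^ 2) * ENNReal.ofReal (K * j ^ c) := by
    have hB : MeasurableSet {p : (ℝ × ℝ) × (ℝ × ℝ) | p.1 ∈ I ×ˢ J ∧ p.2 ∈ I ×ˢ J ∧ |Jd p| < j} := by
      have := G.mJd
      refine (measurable_fst hIJ).inter ((measurable_snd hIJ).inter ?_)
      exact measurableSet_lt (f := fun p : (ℝ × ℝ) × (ℝ × ℝ) => |Jd p|) (by fun_prop) measurable_const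
    refine le_trans (measure_mono ?_) ((vol_near' (fun p : (ℝ × ℝ) × (ℝ × ℝ) => p.1.1) (by fun_prop) _ hB δ hδ.le).trans ?_)
    · rintro p ⟨hp, hp'⟩
      exact ⟨⟨hp.1.1, hp.1.2.1, hp'⟩, hp.2.1.1, hp.2.1.2⟩
    · gcongr; exact G.h7 j hj hj1
  have part2 : volume (T ∩ {p | |Jd p.1| < j}ᶜ) ≤ ENNReal.ofReal (252 * K ^ 6 * t * η / j ^ 4) * (ENNReal.ofReal (4 * δ ^ 2) * 1) := by
    let T2 : Set (((ℝ × ℝ) × (ℝ × ℝ)) × (ℝ × ℝ)) := {q | ((q.1.1, q.2), q.1.2) ∈ T ∩ {p | |Jd p.1| < j}ᶜ}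
    have hT2m : MeasurableSet T2 := (by fun_prop : Measurable fun q : ((ℝ × ℝ) × (ℝ × ℝ)) × (ℝ × ℝ) => ((q.1.1, q.2), q.1.2)) (hm.inter hJdm.compl)
    have hpre : (fun p : ((ℝ × ℝ) × (ℝ × ℝ)) × (ℝ × ℝ) => ((p.1.1, p.2), p.1.2)) ⁻¹' T2 = T ∩ {p | |Jd p.1| < j}ᶜ := rfl
    rw [← hpre, mp_132.measure_preimage hT2m.nullMeasurableSet]
    have hnear := vol_near' (fun p : ℝ × ℝ => p.1) (by fun_prop) _ hIJ δ hδ.le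
    have hA0 : MeasurableSet {q : (ℝ × ℝ) × (ℝ × ℝ) | (q.1 ∈ I ×ˢ J ∧ q.2.1 ∈ I ∧ q.2.2 ∈ I ∧ q.2.1 ≠ q.1.1) ∧
        (|q.2.1 - q.1.1| ≤ δ ∧ |q.2.2 - q.1.1| ≤ δ) ∧ 1 / η < |X (q.1.1, q.2)|} := by
      refine MeasurableSet.inter (MeasurableSet.inter (measurable_fst hIJ) (MeasurableSet.inter ?_ (MeasurableSet.inter ?_ ?_))) (MeasurableSet.inter (MeasurableSet.inter ?_ ?_) ?_)
      · exact (by fun_prop : Measurable fun p : (ℝ × ℝ) × (ℝ × ℝ) => p.2.1) G.mI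
      · exact (by fun_prop : Measurable fun p : (ℝ × ℝ) × (ℝ × ℝ) => p.2.2) G.mI
      · exact (measurableSet_eq_fun (f := fun p : (ℝ × ℝ) × (ℝ × ℝ) => p.2.1) (g := fun p => p.1.1) (by fun_prop) (by fun_prop)).compl
      · exact measurableSet_le (f := fun p : (ℝ × ℝ) × (ℝ × ℝ) => |p.2.1 - p.1.1|) (by fun_prop) measurable_const
      · exact measurableSet_le (f := fun p : (ℝ × ℝ) × (ℝ × ℝ) => |p.2.2 - p.1.1|) (by fun_prop) measurable_const
      · exact measurableSet_lt (g := fun p : (ℝ × ℝ) × (ℝ × ℝ) => |X (p.1.1, p.2)|) measurable_const (by fun_prop)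
    refine (prod_fiber_le_const T2 hT2m _ hA0 ?_ (ENNReal.ofReal (252 * K ^ 6 * t * η / j ^ 4)) ?_).trans ?_
    · rintro q ⟨hq, _⟩
      exact ⟨⟨hq.1.1, hq.1.2.2⟩, hq.2.1, hq.2.2.1⟩
    · rintro ⟨α, γ⟩ ⟨⟨h1, h2, h3, h4⟩, ⟨h5, h6⟩, h7⟩
      refine le_trans (measure_mono ?_) (core_fiber G α h1 γ.1 γ.2 h2 h3 h4 δ hδ h5 h6 j hj hj1 hδj (X (α.1, γ)) η t hη h7 ht
        (fun q => Y ((α.2, q.1), q.2)) (by fun_prop))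
      rintro β ⟨hβ, hβ'⟩
      exact ⟨hβ.1.2.1, not_lt.1 hβ', hβ.2.2.2⟩
    · gcongr
      refine le_trans (measure_mono ?_) (hnear.trans (by gcongr; exact G.vol_box))
      rintro q ⟨⟨h1, h2, h3, h4⟩, ⟨h5, h6⟩, h7⟩
      exact ⟨h1, h5, h6⟩
  rw [← measure_inter_add_sdiff T hJdm]
  refine (add_le_add part1 part2).trans (le_of_eq ?_)
  rw [mul_one, ← ENNReal.ofReal_mul (by positivity), ← ENNReal.ofReal_mul (by positivity), ← ENNReal.ofReal_add (by positivity) (by positivity)]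
  congr 1; ring

end

section
variable {I J : Set ℝ} {w V U r : ℝ × ℝ → ℝ} {Jd : (ℝ × ℝ) × (ℝ × ℝ) → ℝ} {K c : ℝ}

/-- geometric constraints on an edge -/
def EdgeOK (I J : Set ℝ) (w V : ℝ × ℝ → ℝ) (δ : ℝ) (p : (ℝ × ℝ) × (ℝ × ℝ)) : Prop :=
  p.1 ∈ I ×ˢ J ∧ p.2.1 ∈ I ∧ p.2.2 ∈ I ∧ V (p.2.1, w p.1) ∈ J ∧ V (p.2.2, w p.1) ∈ J ∧
    |p.2.1 - p.1.1| ≤ δ ∧ |p.2.2 - p.1.1| ≤ δ ∧ p.2.1 ≠ p.1.1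

def EX (E : Set ((ℝ × ℝ) × (ℝ × ℝ))) : Set ((ℝ × (ℝ × ℝ)) × ℝ) := {p | ((p.1.1, p.2), p.1.2) ∈ E}

def EY (J : Set ℝ) (w U : ℝ × ℝ → ℝ) (E : Set ((ℝ × ℝ) × (ℝ × ℝ))) : Set ((ℝ × (ℝ × ℝ)) × ℝ) :=
  {p | (p.1.2.1 ∈ J ∧ p.1.2.2 ∈ J) ∧
    ((p.2, p.1.1), (U (p.1.2.1, w (p.2, p.1.1)), U (p.1.2.2, w (p.2, p.1.1)))) ∈ E}

/-- the `Y`-vertex of an edge -/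
def yv (w V : ℝ × ℝ → ℝ) (p : (ℝ × ℝ) × (ℝ × ℝ)) : ℝ × (ℝ × ℝ) := (p.1.2, (V (p.2.1, w p.1), V (p.2.2, w p.1)))

def Epr (J : Set ℝ) (w V U : ℝ × ℝ → ℝ) (E : Set ((ℝ × ℝ) × (ℝ × ℝ))) (l : ℝ≥0∞) : Set ((ℝ × ℝ) × (ℝ × ℝ)) :=
  {p ∈ E | l ≤ volume (Prod.mk (p.1.1, p.2) ⁻¹' EX E) ∧ l ≤ volume (Prod.mk (yv w V p) ⁻¹' EY J w U E)}

lemma EX_meas (E : Set ((ℝ × ℝ) × (ℝ × ℝ))) (hE : MeasurableSet E) : MeasurableSet (EX E) :=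
  (by fun_prop : Measurable fun p : (ℝ × (ℝ × ℝ)) × ℝ => ((p.1.1, p.2), p.1.2)) hE

lemma EY_meas (G : Geo I J w V U r Jd K c) (E : Set ((ℝ × ℝ) × (ℝ × ℝ))) (hE : MeasurableSet E) : MeasurableSet (EY J w U E) := by
  have h1 := G.mw; have h3 := G.mU
  refine MeasurableSet.inter (MeasurableSet.inter ?_ ?_) ?_
  · exact (by fun_prop : Measurable fun p : (ℝ × (ℝ × ℝ)) × ℝ => p.1.2.1) G.mJ
  · exact (by fun_prop : Measurable fun p : (ℝ × (ℝ × ℝ)) × ℝ => p.1.2.2) G.mJ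
  · exact (by fun_prop : Measurable fun p : (ℝ × (ℝ × ℝ)) × ℝ => ((p.2, p.1.1), (U (p.1.2.1, w (p.2, p.1.1)), U (p.1.2.2, w (p.2, p.1.1))))) hE

lemma yv_meas (G : Geo I J w V U r Jd K c) : Measurable (yv w V) := by
  have h1 := G.mw; have h3 := G.mV
  unfold yv; fun_prop

lemma prune_edges (G : Geo I J w V U r Jd K c) (δ : ℝ) (hδ : 0 < δ) (E : Set ((ℝ × ℝ) × (ℝ × ℝ))) (hE : MeasurableSet E)
    (hOK : ∀ p ∈ E, EdgeOK I J w V δ p) (l : ℝ) (hl : 0 ≤ l) :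
    volume E ≤ ENNReal.ofReal (8 * K ^ 4 * l * δ ^ 2) + volume (Epr J w V U E (ENNReal.ofReal l)) := by
  have hK := G.hK
  have hK0 : 0 < K := by linarith
  set L := ENNReal.ofReal l with hL
  have mX := EX_meas E hE
  have mY := EY_meas G E hE
  have bX : volume {p ∈ E | volume (Prod.mk (p.1.1, p.2) ⁻¹' EX E) < L} ≤ ENNReal.ofReal (4 * l * δ ^ 2) := by
    have hm : MeasurableSet {q ∈ EX E | volume (Prod.mk q.1 ⁻¹' EX E) < L} := mX.inter (measurable_fst (measurable_deg _ mX L))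
    have hpre : (fun p : (ℝ × ℝ) × (ℝ × ℝ) => ((p.1.1, p.2), p.1.2)) ⁻¹' {q ∈ EX E | volume (Prod.mk q.1 ⁻¹' EX E) < L} = {p ∈ E | volume (Prod.mk (p.1.1, p.2) ⁻¹' EX E) < L} := rfl
    rw [← hpre, mp_132.measure_preimage hm.nullMeasurableSet]
    have hA : MeasurableSet {q : ℝ × (ℝ × ℝ) | q.1 ∈ I ∧ |q.2.1 - q.1| ≤ δ ∧ |q.2.2 - q.1| ≤ δ} := by
      refine (measurable_fst G.mI).inter (MeasurableSet.inter ?_ ?_)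
      · exact measurableSet_le (f := fun q : ℝ × (ℝ × ℝ) => |q.2.1 - q.1|) (by fun_prop) measurable_const
      · exact measurableSet_le (f := fun q : ℝ × (ℝ × ℝ) => |q.2.2 - q.1|) (by fun_prop) measurable_const
    refine (prune (EX E) mX _ hA ?_ L).trans ?_
    · intro p hp
      obtain ⟨h1, h2, h3, h4, h5, h6, h7, h8⟩ := hOK _ hp
      exact ⟨h1.1, h6, h7⟩
    · refine (mul_le_mul_right ((vol_near' (fun u : ℝ => u) measurable_id I G.mI δ hδ.le).trans (mul_le_mul_right (vol_le_one G.bI) _)) L).trans (le_of_eq ?_)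
      rw [mul_one, hL, ← ENNReal.ofReal_mul hl]; congr 1; ring
  have mYb : MeasurableSet {q ∈ EY J w U E | volume (Prod.mk q.1 ⁻¹' EY J w U E) < L} := mY.inter (measurable_fst (measurable_deg _ mY L))
  have bY : volume {p ∈ E | volume (Prod.mk (yv w V p) ⁻¹' EY J w U E) < L} ≤ ENNReal.ofReal (4 * K ^ 4 * l * δ ^ 2) := by
    have hm2 : MeasurableSet {p : (ℝ × ℝ) × (ℝ × ℝ) | ((p.1.2, p.2), p.1.1) ∈ {q ∈ EY J w U E | volume (Prod.mk q.1 ⁻¹' EY J w U E) < L}} :=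
      (by fun_prop : Measurable fun p : (ℝ × ℝ) × (ℝ × ℝ) => ((p.1.2, p.2), p.1.1)) mYb
    have hm1 : MeasurableSet {p ∈ E | volume (Prod.mk (yv w V p) ⁻¹' EY J w U E) < L} :=
      hE.inter ((yv_meas G) (measurable_deg _ mY L))
    have s1 := prod_fiber_le _ _ hm1 hm2 (ENNReal.ofReal (K ^ 2)) (by
      intro a
      have := antilip_two (fun γ => (V (γ.1, w a), V (γ.2, w a))) (Prod.mk a ⁻¹' E)
        (Prod.mk a ⁻¹' {p : (ℝ × ℝ) × (ℝ × ℝ) | ((p.1.2, p.2), p.1.1) ∈ {q ∈ EY J w U E | volume (Prod.mk q.1 ⁻¹' EY J w U E) < L}}) K⁻¹ (by positivity) (by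
          intro γ hγ γ' hγ'
          obtain ⟨h1, h2, h3, -⟩ := hOK _ hγ
          obtain ⟨-, h2', h3', -⟩ := hOK _ hγ'
          rw [inv_mul_le_iff₀ hK0, Prod.dist_eq, Prod.dist_eq, Real.dist_eq, Real.dist_eq, Real.dist_eq, Real.dist_eq, mul_max_of_nonneg _ _ hK0.le]
          exact max_le_max (G.Vanti a.1 h1.1 a.2 h1.2 _ h2 _ h2') (G.Vanti a.1 h1.1 a.2 h1.2 _ h3 _ h3'))
      rw [inv_inv] at this
      refine le_trans (measure_mono ?_) this
      rintro γ ⟨hγ, hγ'⟩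
      obtain ⟨h1, h2, h3, h4, h5, h6, h7, h8⟩ := hOK _ hγ
      refine ⟨hγ, ⟨⟨h4, h5⟩, ?_⟩, hγ'⟩
      have e1 := G.UV a.1 h1.1 a.2 h1.2 _ h2
      have e2 := G.UV a.1 h1.1 a.2 h1.2 _ h3
      simp only at e1 e2 ⊢
      rw [Prod.mk.eta] at *
      rw [e1, e2]; exact hγ)
    have hpre : {p : (ℝ × ℝ) × (ℝ × ℝ) | ((p.1.2, p.2), p.1.1) ∈ {q ∈ EY J w U E | volume (Prod.mk q.1 ⁻¹' EY J w U E) < L}} =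
      (fun p : (ℝ × ℝ) × (ℝ × ℝ) => ((p.1.2, p.2), p.1.1)) ⁻¹' {q ∈ EY J w U E | volume (Prod.mk q.1 ⁻¹' EY J w U E) < L} := rfl
    rw [hpre, mp_231.measure_preimage mYb.nullMeasurableSet] at s1
    have hA : MeasurableSet {q : ℝ × (ℝ × ℝ) | q.1 ∈ J ∧ |q.2.1 - q.1| ≤ K * δ ∧ |q.2.2 - q.1| ≤ K * δ} := by
      refine (measurable_fst G.mJ).inter (MeasurableSet.inter ?_ ?_)
      · exact measurableSet_le (f := fun q : ℝ × (ℝ × ℝ) => |q.2.1 - q.1|) (by fun_prop) measurable_const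
      · exact measurableSet_le (f := fun q : ℝ × (ℝ × ℝ) => |q.2.2 - q.1|) (by fun_prop) measurable_const
    have s2 := prune (EY J w U E) mY _ hA (by
      rintro ⟨⟨v, z, z'⟩, u⟩ ⟨⟨hz, hz'⟩, hp⟩
      simp only at hz hz' hp
      obtain ⟨h1, h2, h3, h4, h5, h6, h7, h8⟩ := hOK _ hp
      simp only at h1 h2 h3 h4 h5 h6 h7 h8
      have e1 := G.VU u h1.1 v h1.2 z hz
      have e2 := G.VU u h1.1 v h1.2 z' hz'
      have e3 := G.Vw u h1.1 v h1.2
      have l1 := G.Vlip u h1.1 v h1.2 _ h2 u h1.1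
      have l2 := G.Vlip u h1.1 v h1.2 _ h3 u h1.1
      rw [e1, e3] at l1; rw [e2, e3] at l2
      exact ⟨h1.2, l1.trans (by gcongr), l2.trans (by gcongr)⟩) L
    refine s1.trans ((mul_le_mul_right (s2.trans (mul_le_mul_right ((vol_near' (fun u : ℝ => u) measurable_id J G.mJ (K * δ) (by positivity)).trans (mul_le_mul_right (vol_le_one G.bJ) _)) L)) _).trans (le_of_eq ?_))
    rw [mul_one, hL, ← ENNReal.ofReal_mul hl, ← ENNReal.ofReal_mul (by positivity)]; congr 1; ring
  have hcov : E ⊆ ({p ∈ E | volume (Prod.mk (p.1.1, p.2) ⁻¹' EX E) < L} ∪ {p ∈ E | volume (Prod.mk (yv w V p) ⁻¹' EY J w U E) < L}) ∪ Epr J w V U E L := by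
    intro p hp
    by_cases h1 : volume (Prod.mk (p.1.1, p.2) ⁻¹' EX E) < L
    · left; left; exact ⟨hp, h1⟩
    by_cases h2 : volume (Prod.mk (yv w V p) ⁻¹' EY J w U E) < L
    · left; right; exact ⟨hp, h2⟩
    · right; exact ⟨hp, not_lt.1 h1, not_lt.1 h2⟩
  refine (measure_mono hcov).trans ((measure_union_le _ _).trans ?_)
  gcongr
  refine (measure_union_le _ _).trans ((add_le_add bX bY).trans ?_)
  rw [← ENNReal.ofReal_add (by positivity) (by positivity)]
  refine ENNReal.ofReal_le_ofReal ?_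
  have : 1 ≤ K ^ 4 := one_le_pow₀ hK
  have h0 : 0 ≤ l * δ ^ 2 := by positivity
  nlinarith

/-- three-paths -/
def TT (J : Set ℝ) (w V U : ℝ × ℝ → ℝ) (E : Set ((ℝ × ℝ) × (ℝ × ℝ))) (l : ℝ≥0∞) : Set (((ℝ × ℝ) × (ℝ × ℝ)) × (ℝ × ℝ)) :=
  {p | (p.1.2, p.2) ∈ Epr J w V U E l ∧ ((p.1.2.1, p.1.1.2), p.2) ∈ E ∧
    ((p.1.1.1, p.1.2.2), (U (V (p.2.1, w p.1.2), w (p.1.1.1, p.1.2.2)), U (V (p.2.2, w p.1.2), w (p.1.1.1, p.1.2.2)))) ∈ E}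

lemma Epr_meas (G : Geo I J w V U r Jd K c) (E : Set ((ℝ × ℝ) × (ℝ × ℝ))) (hE : MeasurableSet E) (l : ℝ≥0∞) :
    MeasurableSet (Epr J w V U E l) := by
  have m1 := measurable_deg _ (EX_meas E hE) l
  have m2 := measurable_deg _ (EY_meas G E hE) l
  have : Epr J w V U E l = E ∩ ((fun p : (ℝ × ℝ) × (ℝ × ℝ) => (p.1.1, p.2)) ⁻¹' {a | volume (Prod.mk a ⁻¹' EX E) < l}ᶜ ∩ (yv w V) ⁻¹' {a | volume (Prod.mk a ⁻¹' EY J w U E) < l}ᶜ) := by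
    ext p; simp only [Epr, mem_inter_iff, mem_preimage, mem_compl_iff, mem_ofPred_eq, not_lt]
  rw [this]
  exact hE.inter (((by fun_prop : Measurable fun p : (ℝ × ℝ) × (ℝ × ℝ) => (p.1.1, p.2)) m1.compl).inter ((yv_meas G) m2.compl))

lemma TT_meas (G : Geo I J w V U r Jd K c) (E : Set ((ℝ × ℝ) × (ℝ × ℝ))) (hE : MeasurableSet E) (l : ℝ≥0∞) :
    MeasurableSet (TT J w V U E l) := by
  have h1 := G.mw; have h3 := G.mU; have h4 := G.mV
  refine MeasurableSet.inter ?_ (MeasurableSet.inter ?_ ?_)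
  · exact (by fun_prop : Measurable fun p : ((ℝ × ℝ) × (ℝ × ℝ)) × (ℝ × ℝ) => (p.1.2, p.2)) (Epr_meas G E hE l)
  · exact (by fun_prop : Measurable fun p : ((ℝ × ℝ) × (ℝ × ℝ)) × (ℝ × ℝ) => ((p.1.2.1, p.1.1.2), p.2)) hE
  · exact (by fun_prop : Measurable fun p : ((ℝ × ℝ) × (ℝ × ℝ)) × (ℝ × ℝ) => ((p.1.1.1, p.1.2.2), (U (V (p.2.1, w p.1.2), w (p.1.1.1, p.1.2.2)), U (V (p.2.2, w p.1.2), w (p.1.1.1, p.1.2.2))))) hE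

lemma TT_lower (G : Geo I J w V U r Jd K c) (E : Set ((ℝ × ℝ) × (ℝ × ℝ))) (hE : MeasurableSet E)
    (l : ℝ≥0∞) : l ^ 2 * volume (Epr J w V U E l) ≤ volume (TT J w V U E l) := by
  have hm := TT_meas G E hE l
  let T2 : Set (((ℝ × ℝ) × (ℝ × ℝ)) × (ℝ × ℝ)) := {q | ((q.2, q.1.1), q.1.2) ∈ TT J w V U E l}
  have hT2 : MeasurableSet T2 := (by fun_prop : Measurable fun q : ((ℝ × ℝ) × (ℝ × ℝ)) × (ℝ × ℝ) => ((q.2, q.1.1), q.1.2)) hm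
  have hpre : TT J w V U E l = (fun p : ((ℝ × ℝ) × (ℝ × ℝ)) × (ℝ × ℝ) => ((p.1.2, p.2), p.1.1)) ⁻¹' T2 := rfl
  rw [hpre, mp_231.measure_preimage hT2.nullMeasurableSet]
  refine prod_fiber_ge T2 hT2 _ (Epr_meas G E hE l) (l ^ 2) ?_
  rintro ⟨β, γ⟩ ha
  have hsub : (Prod.mk (yv w V (β, γ)) ⁻¹' EY J w U E) ×ˢ (Prod.mk (β.1, γ) ⁻¹' EX E) ⊆ Prod.mk (β, γ) ⁻¹' T2 := by
    rintro ⟨u, v⟩ ⟨hu, hv⟩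
    exact ⟨ha, hv, hu.2⟩
  refine le_trans ?_ (measure_mono hsub)
  rw [Measure.volume_eq_prod, Measure.prod_prod, sq]
  exact mul_le_mul' ha.2.2 ha.2.1

lemma TT_upper (G : Geo I J w V U r Jd K c) (δ η : ℝ) (E : Set ((ℝ × ℝ) × (ℝ × ℝ))) (hE : MeasurableSet E)
    (hOK : ∀ p ∈ E, EdgeOK I J w V δ p) (X : ℝ × (ℝ × ℝ) → ℝ) (hX : Measurable X)
    (Y : (ℝ × ℝ) × ℤ → ℝ) (hY : Measurable Y)
    (hEq : ∀ p ∈ E, |r p.1 * X (p.1.1, p.2) + Y ((p.1.2, V (p.2.1, w p.1)), ⌊V (p.2.2, w p.1) / δ ^ 2⌋)| ≤ 1)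
    (hbig : ∀ p ∈ E, 1 / η < |X (p.1.1, p.2)|)
    (l : ℝ≥0∞) : volume (TT J w V U E l) ≤ ENNReal.ofReal (K ^ 4) * volume (That I J w V U r X Y δ η (3 * K ^ 2)) := by
  have hK := G.hK
  have hK0 : 0 < K := by linarith
  have key : ∀ (α β γ : ℝ × ℝ), ((α, β), γ) ∈ TT J w V U E l → 
      V (U (V (γ.1, w β), w (α.1, β.2)), w (α.1, β.2)) = V (γ.1, w β) ∧ V (U (V (γ.2, w β), w (α.1, β.2)), w (α.1, β.2)) = V (γ.2, w β) := by
    rintro α β γ ⟨h2, h3, h1⟩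
    have o1 := hOK _ h1
    have o2 := hOK _ h2.1
    exact ⟨G.VU α.1 o1.1.1 β.2 o1.1.2 _ o2.2.2.2.1, G.VU α.1 o1.1.1 β.2 o1.1.2 _ o2.2.2.2.2.1⟩
  refine prod_fiber_le _ _ (TT_meas G E hE l) (That_meas G X hX Y hY _ _ _) _ ?_
  rintro ⟨α, β⟩
  have := antilip_two (fun γ => (U (V (γ.1, w β), w (α.1, β.2)), U (V (γ.2, w β), w (α.1, β.2))))
    (Prod.mk (α, β) ⁻¹' TT J w V U E l) (Prod.mk (α, β) ⁻¹' That I J w V U r X Y δ η (3 * K ^ 2)) (K ^ 2)⁻¹ (by positivity) (by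
      intro γ hγ γ' hγ'
      obtain ⟨k1, k2⟩ := key α β γ hγ
      obtain ⟨k1', k2'⟩ := key α β γ' hγ'
      have o1 := hOK _ hγ.2.2
      have o2 := hOK _ hγ.1.1
      have o1' := hOK _ hγ'.2.2
      have o2' := hOK _ hγ'.1.1
      simp only at o1 o2 o1' o2'
      have a1 := G.Vlip α.1 o1.1.1 β.2 o1.1.2 _ o1.2.1 _ o1'.2.1
      have a2 := G.Vlip α.1 o1.1.1 β.2 o1.1.2 _ o1.2.2.1 _ o1'.2.2.1
      simp only at k1 k2 k1' k2' a1 a2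
      rw [k1, k1'] at a1; rw [k2, k2'] at a2
      have b1 := G.Vanti β.1 o2.1.1 β.2 o2.1.2 _ o2.2.1 _ o2'.2.1
      have b2 := G.Vanti β.1 o2.1.1 β.2 o2.1.2 _ o2.2.2.1 _ o2'.2.2.1
      rw [inv_mul_le_iff₀ (by positivity), Prod.dist_eq, Prod.dist_eq, Real.dist_eq, Real.dist_eq, Real.dist_eq, Real.dist_eq, mul_max_of_nonneg _ _ (by positivity), sq, mul_assoc, mul_assoc]
      exact max_le_max (b1.trans (by gcongr)) (b2.trans (by gcongr)))
  rw [inv_inv, ← pow_mul] at this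
  refine le_trans (measure_mono ?_) this
  intro γ hγ
  refine ⟨hγ, ?_⟩
  obtain ⟨k1, k2⟩ := key α β γ hγ
  have o1 := hOK _ hγ.2.2
  have o2 := hOK _ hγ.1.1
  have o3 := hOK _ hγ.2.1
  have q1 := hEq _ hγ.2.2
  have q2 := hEq _ hγ.1.1
  have q3 := hEq _ hγ.2.1
  have g1 := hbig _ hγ.2.2
  simp only at o1 o2 o3 q1 q2 q3 g1 k1 k2
  rw [k1, k2] at q1
  have t1 : Theta w V U α β (U (V (γ.1, w β), w (α.1, β.2))) = V (γ.1, w (β.1, α.2)) := by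
    unfold Theta; rw [k1]
    have := G.UV β.1 o2.1.1 β.2 o2.1.2 _ o2.2.1
    simp only [Prod.mk.eta] at this; rw [this]
  have t2 : Theta w V U α β (U (V (γ.2, w β), w (α.1, β.2))) = V (γ.2, w (β.1, α.2)) := by
    unfold Theta; rw [k2]
    have := G.UV β.1 o2.1.1 β.2 o2.1.2 _ o2.2.2.1
    simp only [Prod.mk.eta] at this; rw [this]
  refine ⟨⟨⟨o1.1.1, o3.1.2⟩, o2.1, o1.2.1, o1.2.2.1, o1.2.2.2.2.2.2.2⟩, ⟨o1.2.2.2.2.2.1, o1.2.2.2.2.2.2.1⟩, g1, ?_⟩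
  simp only
  rw [t1, t2]
  set X1 := X (α.1, (U (V (γ.1, w β), w (α.1, β.2)), U (V (γ.2, w β), w (α.1, β.2))))
  set Y1 := Y ((β.2, V (γ.1, w β)), ⌊V (γ.2, w β) / δ ^ 2⌋)
  set Y2 := Y ((α.2, V (γ.1, w (β.1, α.2))), ⌊V (γ.2, w (β.1, α.2)) / δ ^ 2⌋)
  set X2 := X (β.1, γ)
  have r21l := G.rlb β.1 o2.1.1 β.2 o2.1.2
  have r22u := G.rub β.1 o2.1.1 α.2 o3.1.2
  simp only [Prod.mk.eta] at r21l
  have hr0 : r β ≠ 0 := by intro h; rw [h] at r21l; simp at r21l; linarith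
  unfold MM
  have e : r (α.1, β.2) * r (β.1, α.2) / r β * X1 + Y2 = (r (β.1, α.2) * X2 + Y2) + r (β.1, α.2) * (r β)⁻¹ * ((r (α.1, β.2) * X1 + Y1) - (r β * X2 + Y1)) := by
    field_simp; ring
  rw [e]
  have hinv : |(r β)⁻¹| ≤ K := by
    rw [abs_inv, inv_le_iff_one_le_mul₀ (abs_pos.2 hr0)]; exact r21l
  calc _ ≤ |r (β.1, α.2) * X2 + Y2| + |r (β.1, α.2)| * |(r β)⁻¹| * (|r (α.1, β.2) * X1 + Y1| + |r β * X2 + Y1|) := by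
        refine (abs_add_le _ _).trans ?_
        rw [abs_mul, abs_mul]
        gcongr
        exact abs_sub _ _
    _ ≤ 1 + K * K * (1 + 1) := by gcongr
    _ ≤ _ := by nlinarith

theorem bad_edges (G : Geo I J w V U r Jd K c) (δ η : ℝ) (hδ : 0 < δ) (hη : 0 < η) (hη1 : η ≤ 1) (hδη : K * δ ≤ η)
    (E : Set ((ℝ × ℝ) × (ℝ × ℝ))) (hE : MeasurableSet E)
    (hOK : ∀ p ∈ E, EdgeOK I J w V δ p) (X : ℝ × (ℝ × ℝ) → ℝ) (hX : Measurable X)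
    (Y : (ℝ × ℝ) × ℤ → ℝ) (hY : Measurable Y)
    (hEq : ∀ p ∈ E, |r p.1 * X (p.1.1, p.2) + Y ((p.1.2, V (p.2.1, w p.1)), ⌊V (p.2.2, w p.1) / δ ^ 2⌋)| ≤ 1)
    (hbig : ∀ p ∈ E, 1 / η < |X (p.1.1, p.2)|) :
    volume E ≤ ENNReal.ofReal (3036 * K ^ 12 * η ^ (c / 24) * δ ^ 2) := by
  have hK := G.hK
  have hK0 : 0 < K := by linarith
  have hc := G.hc; have hc1 := G.hc1
  set j := η ^ (1 / 8 : ℝ) with hj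
  set l := η ^ (c / 24) with hl
  have hj0 : 0 < j := by positivity
  have hl0 : 0 < l := by positivity
  have hj1 : j ≤ 1 := Real.rpow_le_one hη.le hη1 (by norm_num)
  have hηj : η ≤ j := by
    calc η = η ^ (1:ℝ) := (Real.rpow_one _).symm
      _ ≤ _ := Real.rpow_le_rpow_of_exponent_ge hη hη1 (by norm_num)
  have u1 := prune_edges G δ hδ E hE hOK l hl0.le
  have u2 := TT_lower G E hE (ENNReal.ofReal l)
  have u3 := TT_upper G δ η E hE hOK X hX Y hY hEq hbig (ENNReal.ofReal l)
  have u4 := That_vol G X hX Y hY δ η (3 * K ^ 2) j hδ hη (by positivity) hj0 hj1 (hδη.trans hηj)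
  have hj4 : η / j ^ 4 = η ^ (1/2:ℝ) := by
    rw [hj, ← Real.rpow_natCast, ← Real.rpow_mul hη.le]
    nth_rewrite 1 [← Real.rpow_one η]
    rw [← Real.rpow_sub hη]; norm_num
  have hjc : j ^ c = η ^ (c / 8) := by
    rw [hj, ← Real.rpow_mul hη.le]; congr 1; ring
  have hl3 : η ^ (c / 8) = l ^ 3 := by
    rw [hl, ← Real.rpow_natCast, ← Real.rpow_mul hη.le]; congr 1; push_cast; ring
  have h12 : η ^ (1/2:ℝ) ≤ l ^ 3 := by
    rw [← hl3]; exact Real.rpow_le_rpow_of_exponent_ge hη hη1 (by linarith)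
  have u5 : ENNReal.ofReal (l ^ 2) * volume (Epr J w V U E (ENNReal.ofReal l)) ≤ ENNReal.ofReal (3028 * K ^ 12 * l ^ 3 * δ ^ 2) := by
    rw [ENNReal.ofReal_pow hl0.le]
    refine u2.trans (u3.trans ((mul_le_mul_right u4 _).trans ?_))
    rw [← ENNReal.ofReal_mul (by positivity)]
    refine ENNReal.ofReal_le_ofReal ?_
    have e1 : 1008 * K ^ 6 * (3 * K ^ 2) * η / j ^ 4 = 3024 * K ^ 8 * (η / j ^ 4) := by ring
    rw [e1, hj4, hjc, hl3]
    have hK8 : K ≤ K ^ 8 := le_self_pow₀ hK (by norm_num)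
    calc K ^ 4 * ((3024 * K ^ 8 * η ^ (1/2:ℝ) + 4 * K * l ^ 3) * δ ^ 2) ≤ K ^ 4 * ((3024 * K ^ 8 * l ^ 3 + 4 * K ^ 8 * l ^ 3) * δ ^ 2) := by gcongr
      _ = _ := by ring
  have u6 : volume (Epr J w V U E (ENNReal.ofReal l)) ≤ ENNReal.ofReal (3028 * K ^ 12 * l * δ ^ 2) := by
    have e : 3028 * K ^ 12 * l * δ ^ 2 = (3028 * K ^ 12 * l ^ 3 * δ ^ 2) / l ^ 2 := by field_simp
    rw [e, ENNReal.ofReal_div_of_pos (by positivity), ENNReal.le_div_iff_mul_le, mul_comm]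
    · exact u5
    · left; simp; positivity
    · left; simp
  refine u1.trans ((add_le_add le_rfl u6).trans ?_)
  rw [← ENNReal.ofReal_add (by positivity) (by positivity)]
  refine ENNReal.ofReal_le_ofReal ?_
  have h412 : K ^ 4 ≤ K ^ 12 := pow_le_pow_right₀ hK (by norm_num)
  calc _ ≤ 8 * K ^ 12 * l * δ ^ 2 + 3028 * K ^ 12 * l * δ ^ 2 := by gcongr
    _ = _ := by ring
end

/-- additional facts relating `(u,v)` and `(u,w)` coordinates -/
structure GeoW (I J : Set ℝ) (w V : ℝ × ℝ → ℝ) (K : ℝ) : Prop where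
  wanti : ∀ u ∈ I, ∀ v ∈ J, ∀ v' ∈ J, |v - v'| ≤ K * |w (u, v) - w (u, v')|
  wrange : ∃ p, ∀ u ∈ I, ∀ v ∈ J, w (u, v) ∈ Icc p (p + 1)
  wV : ∀ u ∈ I, ∀ v ∈ J, ∀ y ∈ I, w (y, V (y, w (u, v))) = w (u, v)

def Etot (w V : ℝ × ℝ → ℝ) (Sp : Set (ℝ × ℝ)) (δ l : ℝ) : Set ((ℝ × ℝ) × (ℝ × ℝ)) :=
  {p | p.1 ∈ Sp ∧ (p.2.1, V (p.2.1, w p.1)) ∈ Sp ∧ (p.2.2, V (p.2.2, w p.1)) ∈ Sp ∧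
    ⌊p.2.1 / δ⌋ = ⌊p.1.1 / δ⌋ ∧ ⌊p.2.2 / δ⌋ = ⌊p.1.1 / δ⌋ ∧ l * δ ≤ |p.2.1 - p.2.2| ∧ p.2.1 ≠ p.1.1}

lemma pair_lower (F : Set ℝ) (hF : MeasurableSet F) (u l : ℝ) (hl : 0 ≤ l) (h : ENNReal.ofReal l ≤ volume F) :
    ENNReal.ofReal (l ^ 2 / 2) ≤ volume {γ : ℝ × ℝ | γ.1 ∈ F ∧ γ.2 ∈ F ∧ l / 4 ≤ |γ.1 - γ.2| ∧ γ.1 ≠ u} := by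
  have hm : MeasurableSet {γ : ℝ × ℝ | γ.1 ∈ F ∧ γ.2 ∈ F ∧ l / 4 ≤ |γ.1 - γ.2| ∧ γ.1 ≠ u} := by
    refine (measurable_fst hF).inter ((measurable_snd hF).inter (MeasurableSet.inter ?_ ?_))
    · exact measurableSet_le (g := fun γ : ℝ × ℝ => |γ.1 - γ.2|) measurable_const (by fun_prop)
    · exact (measurableSet_eq_fun (f := fun γ : ℝ × ℝ => γ.1) (by fun_prop) measurable_const).compl
  have := prod_fiber_ge _ hm (F \ {u}) (hF.diff (measurableSet_singleton u)) (ENNReal.ofReal (l / 2)) (by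
    rintro y ⟨hy, hyu⟩
    have h1 : volume F - volume (Ioo (y - l / 4) (y + l / 4)) ≤ volume (F \ Ioo (y - l / 4) (y + l / 4)) := le_measure_sdiff
    refine le_trans ?_ (h1.trans (measure_mono ?_))
    · rw [Real.volume_Ioo]
      refine le_trans ?_ (tsub_le_tsub_right h _)
      rw [← ENNReal.ofReal_sub _ (by linarith)]
      exact ENNReal.ofReal_le_ofReal (by linarith)
    · rintro y' ⟨hy', hn⟩
      refine ⟨hy, hy', ?_, hyu⟩
      by_contra hlt
      push Not at hlt
      rw [abs_lt] at hlt
      exact hn ⟨by simp only at hlt; linarith, by simp only at hlt; linarith⟩)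
  rw [measure_sdiff_null (by simp)] at this
  refine le_trans ?_ this
  calc _ = ENNReal.ofReal (l / 2) * ENNReal.ofReal l := by rw [← ENNReal.ofReal_mul (by positivity)]; congr 1; ring
    _ ≤ _ := by gcongr

section
variable {I J : Set ℝ} {w V U r : ℝ × ℝ → ℝ} {Jd : (ℝ × ℝ) × (ℝ × ℝ) → ℝ} {K c : ℝ}

lemma Etot_meas (G : Geo I J w V U r Jd K c) (Sp : Set (ℝ × ℝ)) (hS : MeasurableSet Sp) (δ l : ℝ) :
    MeasurableSet (Etot w V Sp δ l) := by
  have h1 := G.mw; have h2 := G.mV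
  have m1 : Measurable fun p : (ℝ × ℝ) × (ℝ × ℝ) => ⌊p.2.1 / δ⌋ := Measurable.floor (by fun_prop)
  have m2 : Measurable fun p : (ℝ × ℝ) × (ℝ × ℝ) => ⌊p.1.1 / δ⌋ := Measurable.floor (by fun_prop)
  have m3 : Measurable fun p : (ℝ × ℝ) × (ℝ × ℝ) => ⌊p.2.2 / δ⌋ := Measurable.floor (by fun_prop)
  refine (measurable_fst hS).inter (MeasurableSet.inter ?_ (MeasurableSet.inter ?_ (MeasurableSet.inter ?_ (MeasurableSet.inter ?_ (MeasurableSet.inter ?_ ?_)))))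
  · exact (by fun_prop : Measurable fun p : (ℝ × ℝ) × (ℝ × ℝ) => (p.2.1, V (p.2.1, w p.1))) hS
  · exact (by fun_prop : Measurable fun p : (ℝ × ℝ) × (ℝ × ℝ) => (p.2.2, V (p.2.2, w p.1))) hS
  · exact measurableSet_eq_fun m1 m2
  · exact measurableSet_eq_fun m3 m2
  · exact measurableSet_le (g := fun p : (ℝ × ℝ) × (ℝ × ℝ) => |p.2.1 - p.2.2|) measurable_const (by fun_prop)
  · exact (measurableSet_eq_fun (f := fun p : (ℝ × ℝ) × (ℝ × ℝ) => p.2.1) (g := fun p => p.1.1) (by fun_prop) (by fun_prop)).compl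

lemma Etot_lower (G : Geo I J w V U r Jd K c) (GW : GeoW I J w V K) (Sp : Set (ℝ × ℝ)) (hS : MeasurableSet Sp)
    (hSp : Sp ⊆ I ×ˢ J) (δ μ : ℝ) (hδ : 0 < δ) (hδ1 : δ ≤ 1) (hμ : 0 < μ) (hμS : ENNReal.ofReal μ ≤ volume Sp) :
    ENNReal.ofReal (μ ^ 3 * δ ^ 2 / (144 * K ^ 2)) ≤ volume (Etot w V Sp δ (μ / (24 * K))) := by
  have hK := G.hK
  have hK0 : 0 < K := by linarith
  have h1 := G.mw; have h2 := G.mV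
  obtain ⟨p₀, hp₀⟩ := GW.wrange
  obtain ⟨q₀, hq₀⟩ := G.bI
  set l := μ / (6 * K) with hl
  have hl0 : 0 < l := by positivity
  -- fibres
  let H : Set ((ℝ × ℝ) × ℝ) := {p | ⌊p.2 / δ⌋ = ⌊p.1.1 / δ⌋ ∧ (p.2, V (p.2, p.1.2)) ∈ Sp}
  have hH : MeasurableSet H := by
    have m1 : Measurable fun p : (ℝ × ℝ) × ℝ => ⌊p.2 / δ⌋ := Measurable.floor (by fun_prop)
    have m2 : Measurable fun p : (ℝ × ℝ) × ℝ => ⌊p.1.1 / δ⌋ := Measurable.floor (by fun_prop)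
    refine (measurableSet_eq_fun m1 m2).inter ?_
    exact (by fun_prop : Measurable fun p : (ℝ × ℝ) × ℝ => (p.2, V (p.2, p.1.2))) hS
  let D : Set (ℝ × ℝ) := {a | volume (Prod.mk a ⁻¹' H) < ENNReal.ofReal (l * δ)}
  have hD : MeasurableSet D := measurable_deg H hH _
  let cw : ℝ × ℝ → ℝ × ℝ := fun a => (a.1, w a)
  have hcw : Measurable cw := by fun_prop
  have bad : volume (Sp ∩ cw ⁻¹' D) ≤ ENNReal.ofReal (μ / 2) := by
    let E2 : Set (ℝ × ℝ) := {a | a.2 ∈ Icc p₀ (p₀ + 1) ∧ (a.1, V a) ∈ Sp ∧ a ∈ D}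
    have hE2 : MeasurableSet E2 := by
      refine (measurable_snd measurableSet_Icc).inter (MeasurableSet.inter ?_ hD)
      exact (by fun_prop : Measurable fun a : ℝ × ℝ => (a.1, V a)) hS
    have s1 : volume (Sp ∩ cw ⁻¹' D) ≤ ENNReal.ofReal K * volume E2 := by
      refine prod_fiber_le _ _ (hS.inter (hcw hD)) hE2 _ ?_
      intro u
      by_cases hu : u ∈ I
      · have := antilip_one (fun v => w (u, v)) J (Prod.mk u ⁻¹' E2) K⁻¹ (by positivity) (by
          intro v hv v' hv'
          rw [inv_mul_le_iff₀ hK0]; exact GW.wanti u hu v hv v' hv')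
        rw [inv_inv] at this
        refine le_trans (measure_mono ?_) this
        rintro v ⟨hv, hv'⟩
        refine ⟨(hSp hv).2, hp₀ u hu v (hSp hv).2, ?_, hv'⟩
        simp only
        rw [G.Vw u hu v (hSp hv).2]; exact hv
      · have : Prod.mk u ⁻¹' (Sp ∩ cw ⁻¹' D) = ∅ := by
          ext v; simp only [mem_preimage, mem_empty_iff_false, iff_false]
          rintro ⟨hv, _⟩; exact hu (hSp hv).1
        rw [this]; simp
    have s2 : volume E2 ≤ ENNReal.ofReal (3 * l) := by
      let E3 : Set (ℝ × ℝ) := Prod.swap ⁻¹' E2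
      have hE3 : MeasurableSet E3 := measurable_swap hE2
      have e : volume E2 = volume E3 := by
        rw [Measure.volume_eq_prod]; exact (Measure.measurePreserving_swap.measure_preimage hE2.nullMeasurableSet).symm
      rw [e]
      refine (prod_fiber_le_const E3 hE3 (Icc p₀ (p₀ + 1)) measurableSet_Icc (fun p hp => hp.1) (ENNReal.ofReal (3 * l)) ?_).trans ?_
      · intro ω _
        have hcov : Prod.mk ω ⁻¹' E3 ⊆ ⋃ n ∈ Finset.Icc ⌊q₀ / δ⌋ ⌊(q₀ + 1) / δ⌋, {u | (u, ω) ∈ E2 ∧ ⌊u / δ⌋ = n} := by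
          intro u hu
          have hu' : (u, ω) ∈ E2 := hu
          simp only [mem_iUnion]
          exact ⟨⌊u / δ⌋, floor_mem_cells hδ (hq₀ (hSp hu'.2.1).1), hu', rfl⟩
        have hpc : ∀ n ∈ Finset.Icc ⌊q₀ / δ⌋ ⌊(q₀ + 1) / δ⌋, volume {u | (u, ω) ∈ E2 ∧ ⌊u / δ⌋ = n} ≤ ENNReal.ofReal (l * δ) := by
          intro n _
          rcases {u | (u, ω) ∈ E2 ∧ ⌊u / δ⌋ = n}.eq_empty_or_nonempty with he | ⟨u₀, hu₀⟩
          · rw [he]; simp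
          · refine le_trans (measure_mono ?_) (le_of_lt hu₀.1.2.2)
            intro u hu
            exact ⟨hu.2.trans hu₀.2.symm, hu.1.2.1⟩
        refine (measure_mono hcov).trans ((measure_biUnion_finset_le _ _).trans ((Finset.sum_le_sum hpc).trans ?_))
        have hcc := card_cells q₀ δ hδ hδ1
        rw [Finset.sum_const, nsmul_eq_mul, ← ENNReal.ofReal_natCast, ← ENNReal.ofReal_mul (by positivity)]
        refine ENNReal.ofReal_le_ofReal ?_
        calc _ ≤ 3 / δ * (l * δ) := by gcongr
          _ = _ := by field_simp
      · rw [Real.volume_Icc]; simp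
    refine s1.trans ((mul_le_mul_right s2 _).trans ?_)
    rw [← ENNReal.ofReal_mul (by positivity)]
    refine ENNReal.ofReal_le_ofReal (le_of_eq ?_)
    rw [hl]; field_simp; ring
  have good : ENNReal.ofReal (μ / 2) ≤ volume (Sp \ cw ⁻¹' D) := by
    have h3 : volume Sp ≤ volume (Sp ∩ cw ⁻¹' D) + volume (Sp \ cw ⁻¹' D) := by
      rw [measure_inter_add_sdiff Sp (hcw hD)]
    have h4 : ENNReal.ofReal (μ / 2) + ENNReal.ofReal (μ / 2) ≤ ENNReal.ofReal (μ / 2) + volume (Sp \ cw ⁻¹' D) := by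
      rw [← ENNReal.ofReal_add (by positivity) (by positivity), add_halves]
      exact hμS.trans (h3.trans (by gcongr))
    exact (ENNReal.add_le_add_iff_left ENNReal.ofReal_ne_top).1 h4
  have := prod_fiber_ge _ (Etot_meas G Sp hS δ (μ / (24 * K))) (Sp \ cw ⁻¹' D) (hS.diff (hcw hD)) (ENNReal.ofReal ((l * δ) ^ 2 / 2)) (by
    rintro a ⟨ha, hbad⟩
    have hdeg : ENNReal.ofReal (l * δ) ≤ volume (Prod.mk (cw a) ⁻¹' H) := not_lt.1 hbad
    refine (pair_lower _ (measurable_prodMk_left hH) a.1 (l * δ) (by positivity) hdeg).trans (measure_mono ?_)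
    rintro γ ⟨g1, g2, g3, g4⟩
    refine ⟨ha, g1.2, g2.2, g1.1, g2.1, ?_, g4⟩
    refine le_trans (le_of_eq ?_) g3
    rw [hl]; field_simp; ring)
  refine le_trans ?_ ((mul_le_mul_right good _).trans this)
  rw [← ENNReal.ofReal_mul (by positivity)]
  refine ENNReal.ofReal_le_ofReal (le_of_eq ?_)
  rw [hl]; field_simp; ring

end

lemma cell_eq (δ : ℝ) (hδ : 0 < δ) (n : ℤ) : {y : ℝ | ⌊y / δ⌋ = n} = Ico (n * δ) ((n + 1) * δ) := by
  ext y; simp only [mem_ofPred_eq, mem_Ico, Int.floor_eq_iff, le_div_iff₀ hδ, div_lt_iff₀ hδ]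

/-- choose one pair of base points per cell -/
lemma select_pair (I : Set ℝ) (hI : ∃ p, I ⊆ Icc p (p + 1)) (δ m : ℝ) (hδ : 0 < δ)
    (E : Set ((ℝ × ℝ) × (ℝ × ℝ))) (hE : MeasurableSet E) 
    (h : ∀ p ∈ E, p.1.1 ∈ I ∧ ⌊p.2.1 / δ⌋ = ⌊p.1.1 / δ⌋ ∧ ⌊p.2.2 / δ⌋ = ⌊p.1.1 / δ⌋)
    (hv : ENNReal.ofReal (m * δ ^ 2) ≤ volume E) (hfin : volume E ≠ ⊤) :
    ∃ g : ℤ → ℝ × ℝ, MeasurableSet {a : ℝ × ℝ | (a, g ⌊a.1 / δ⌋) ∈ E} ∧ ENNReal.ofReal m ≤ volume {a : ℝ × ℝ | (a, g ⌊a.1 / δ⌋) ∈ E} := by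
  obtain ⟨p, hp⟩ := hI
  let Q : ℤ → Set ℝ := fun n => {y : ℝ | ⌊y / δ⌋ = n}
  have hQ : ∀ n, Q n = Ico (n * δ) ((n + 1) * δ) := cell_eq δ hδ
  have hQm : ∀ n, MeasurableSet (Q n) := fun n => by rw [hQ]; exact measurableSet_Ico
  have hQQm : ∀ n, MeasurableSet (Q n ×ˢ Q n) := fun n => (hQm n).prod (hQm n)
  have hQQ : ∀ n, volume (Q n ×ˢ Q n) = ENNReal.ofReal (δ ^ 2) := by
    intro n
    rw [Measure.volume_eq_prod, Measure.prod_prod, hQ, Real.volume_Ico, ← ENNReal.ofReal_mul (by nlinarith)]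
    congr 1; ring
  have hvol : volume E = ∫⁻ γ, volume ((fun a => (a, γ)) ⁻¹' E) := by
    rw [Measure.volume_eq_prod, Measure.prod_apply_symm hE]
  set f : ℝ × ℝ → ℝ≥0∞ := fun γ => volume ((fun a => (a, γ)) ⁻¹' E) with hf
  have hfm : Measurable f := measurable_measure_prodMk_right hE
  have hIntg : ∀ n, ∫⁻ γ in Q n ×ˢ Q n, f γ ≠ ⊤ := by
    intro n
    refine ne_top_of_le_ne_top hfin ?_
    rw [hvol]; exact setLIntegral_le_lintegral _ _
  have hch : ∀ n, ∃ γ ∈ Q n ×ˢ Q n, (∫⁻ γ in Q n ×ˢ Q n, f γ) / ENNReal.ofReal (δ ^ 2) ≤ f γ := by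
    intro n
    obtain ⟨γ, hγ, hγ'⟩ := exists_setLAverage_le (μ := volume) (s := Q n ×ˢ Q n) (f := f) (by rw [hQQ]; simp; positivity) (hQQm n).nullMeasurableSet (hIntg n)
    refine ⟨γ, hγ, ?_⟩
    rw [setLAverage_eq, hQQ] at hγ'; exact hγ'
  choose g hg hg' using hch
  have hgm : Measurable fun a : ℝ × ℝ => (a, g ⌊a.1 / δ⌋) := by
    refine measurable_id.prodMk ((measurable_of_countable g).comp ?_)
    exact Measurable.floor (by fun_prop)
  refine ⟨g, hgm hE, ?_⟩
  set S := {a : ℝ × ℝ | (a, g ⌊a.1 / δ⌋) ∈ E} with hS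
  have hSm : MeasurableSet S := hgm hE
  let T : ℤ → Set (ℝ × ℝ) := fun n => {a | ⌊a.1 / δ⌋ = n ∧ (a, g n) ∈ E}
  have hTm : ∀ n, MeasurableSet (T n) := by
    intro n
    have : T n = (fun a : ℝ × ℝ => ⌊a.1 / δ⌋) ⁻¹' {n} ∩ (fun a => (a, g n)) ⁻¹' E := rfl
    rw [this]
    exact ((Measurable.floor (by fun_prop) : Measurable fun a : ℝ × ℝ => ⌊a.1 / δ⌋) (measurableSet_singleton n)).inter ((by fun_prop : Measurable fun a : ℝ × ℝ => (a, g n)) hE)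
  have hSU : S = ⋃ n, T n := by
    ext a; simp only [mem_iUnion]
    constructor
    · intro ha; exact ⟨_, rfl, ha⟩
    · rintro ⟨n, hn, ha⟩; show (a, g ⌊a.1 / δ⌋) ∈ E; rw [hn]; exact ha
  have hTf : ∀ n, volume (T n) = f (g n) := by
    intro n
    congr 1; ext a
    constructor
    · exact fun ha => ha.2
    · intro ha
      refine ⟨?_, ha⟩
      have := h _ ha
      exact this.2.1.symm.trans (hg n).1
  have hvol2 : volume E ≤ ∑' n, ∫⁻ γ in Q n ×ˢ Q n, f γ := by
    rw [hvol, ← lintegral_iUnion hQQm]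
    · rw [← lintegral_indicator (MeasurableSet.iUnion hQQm)]
      refine lintegral_mono fun γ => ?_
      by_cases hγ : γ ∈ ⋃ n, Q n ×ˢ Q n
      · rw [indicator_of_mem hγ]
      · rw [indicator_of_notMem hγ, nonpos_iff_eq_zero]
        have : (fun a => (a, γ)) ⁻¹' E = ∅ := by
          ext a; simp only [mem_preimage, mem_empty_iff_false, iff_false]
          intro ha
          apply hγ
          have := h _ ha
          simp only [mem_iUnion]
          exact ⟨⌊a.1 / δ⌋, this.2.1, this.2.2⟩
        simp only [hf]; rw [this]; simp
    · intro n n' hnn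
      rw [Function.onFun, Set.disjoint_left]
      rintro γ h1 h2
      exact hnn (h1.1.symm.trans h2.1)
  rw [hSU, measure_iUnion _ hTm]
  · have hδ2 : ENNReal.ofReal (δ ^ 2) ≠ 0 := by simp; positivity
    calc ENNReal.ofReal m = ENNReal.ofReal (m * δ ^ 2) / ENNReal.ofReal (δ ^ 2) := by
          rw [← ENNReal.ofReal_div_of_pos (by positivity)]; congr 1; field_simp
      _ ≤ (∑' n, ∫⁻ γ in Q n ×ˢ Q n, f γ) / ENNReal.ofReal (δ ^ 2) := by gcongr; exact hv.trans hvol2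
      _ = ∑' n, (∫⁻ γ in Q n ×ˢ Q n, f γ) / ENNReal.ofReal (δ ^ 2) := by
          simp_rw [div_eq_mul_inv]; rw [ENNReal.tsum_mul_right]
      _ ≤ _ := by
          refine ENNReal.tsum_le_tsum fun n => ?_
          rw [hTf]; exact hg' n
  · intro n n' hnn
    rw [Function.onFun, Set.disjoint_left]
    rintro a h1 h2
    exact hnn (h1.1.symm.trans h2.1)

/-- Selection of a good pair of base points in every cell. -/
lemma combine {I J : Set ℝ} {w V U r : ℝ × ℝ → ℝ} {Jd : (ℝ × ℝ) × (ℝ × ℝ) → ℝ} {K c : ℝ}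
    (G : Geo I J w V U r Jd K c) (GW : GeoW I J w V K)
    (Sp : Set (ℝ × ℝ)) (hS : MeasurableSet Sp) (hSp : Sp ⊆ I ×ˢ J)
    (δ μ η e : ℝ) (hδ : 0 < δ) (hδ1 : δ ≤ 1) (hμ : 0 < μ) (hμS : ENNReal.ofReal μ ≤ volume Sp)
    (hη : 0 < η) (hη1 : η ≤ 1) (hδη : K * δ ≤ η)
    (hηc : 3036 * K ^ 12 * η ^ (c / 24) ≤ μ ^ 3 / (288 * K ^ 2)) (he : 0 < e)
    (X : ℝ × (ℝ × ℝ) → ℝ) (hX : Measurable X) (Y : (ℝ × ℝ) × ℤ → ℝ) (hY : Measurable Y)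
    (hEq : ∀ p ∈ Etot w V Sp δ (μ / (24 * K)), |r p.1 * X (p.1.1, p.2)
      + Y ((p.1.2, V (p.2.1, w p.1)), ⌊V (p.2.2, w p.1) / δ ^ 2⌋)| ≤ e) :
    ∃ (g : ℤ → ℝ × ℝ) (S' : Set (ℝ × ℝ)), MeasurableSet S' ∧
      ENNReal.ofReal (μ ^ 3 / (288 * K ^ 2)) ≤ volume S' ∧
      ∀ a ∈ S', (a, g ⌊a.1 / δ⌋) ∈ Etot w V Sp δ (μ / (24 * K)) ∧
        |X (a.1, g ⌊a.1 / δ⌋)| ≤ e / η := by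
  have hK := G.hK
  have hOK : ∀ p ∈ Etot w V Sp δ (μ / (24 * K)), EdgeOK I J w V δ p := by
    rintro p ⟨h1, h2, h3, h4, h5, h6, h7⟩
    exact ⟨hSp h1, (hSp h2).1, (hSp h3).1, (hSp h2).2, (hSp h3).2,
      dist_of_floor_eq hδ h4, dist_of_floor_eq hδ h5, h7⟩
  have hEm := Etot_meas G Sp hS δ (μ / (24 * K))
  have hXm : Measurable fun p : (ℝ × ℝ) × (ℝ × ℝ) => |X (p.1.1, p.2)| :=
    (hX.comp (by fun_prop : Measurable fun p : (ℝ × ℝ) × (ℝ × ℝ) => (p.1.1, p.2))).abs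
  set E := Etot w V Sp δ (μ / (24 * K)) with hE
  set Bad := E ∩ {p | e / η < |X (p.1.1, p.2)|} with hBad
  set Good := E ∩ {p | |X (p.1.1, p.2)| ≤ e / η} with hGood
  have hBm : MeasurableSet Bad := hEm.inter (measurableSet_lt measurable_const hXm)
  have hGm : MeasurableSet Good := hEm.inter (measurableSet_le hXm measurable_const)
  have hbad : volume Bad ≤ ENNReal.ofReal (3036 * K ^ 12 * η ^ (c / 24) * δ ^ 2) := by
    refine bad_edges G δ η hδ hη hη1 hδη Bad hBm (fun p hp => hOK p hp.1)
      (fun q => X q / e) (hX.div_const e) (fun q => Y q / e) (hY.div_const e) ?_ ?_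
    · intro p hp
      have := hEq p hp.1
      have h2 : r p.1 * (X (p.1.1, p.2) / e)
        + Y ((p.1.2, V (p.2.1, w p.1)), ⌊V (p.2.2, w p.1) / δ ^ 2⌋) / e = (r p.1 * X (p.1.1, p.2)
      + Y ((p.1.2, V (p.2.1, w p.1)), ⌊V (p.2.2, w p.1) / δ ^ 2⌋)) / e := by ring
      rw [h2, abs_div, abs_of_pos he]
      exact (div_le_one he).2 this
    · intro p hp
      have h1 : e / η < |X (p.1.1, p.2)| := hp.2
      rw [abs_div, abs_of_pos he, lt_div_iff₀ he]
      calc 1 / η * e = e / η := by ring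
        _ < _ := h1
  have hlow := Etot_lower G GW Sp hS hSp δ μ hδ hδ1 hμ hμS
  have hEfin : volume Bad ≠ ∞ := (hbad.trans_lt ENNReal.ofReal_lt_top).ne
  have hU : E ⊆ Good ∪ Bad := by
    intro p hp
    rcases le_or_gt (|X (p.1.1, p.2)|) (e / η) with h | h
    · exact Or.inl ⟨hp, h⟩
    · exact Or.inr ⟨hp, h⟩
  have hgood : ENNReal.ofReal (μ ^ 3 / (288 * K ^ 2) * δ ^ 2) ≤ volume Good := by
    have h1 : ENNReal.ofReal (μ ^ 3 * δ ^ 2 / (144 * K ^ 2)) ≤ volume Good +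
        ENNReal.ofReal (μ ^ 3 / (288 * K ^ 2) * δ ^ 2) := by
      refine hlow.trans ((measure_mono hU).trans ((measure_union_le _ _).trans ?_))
      gcongr
      refine hbad.trans (ENNReal.ofReal_le_ofReal ?_)
      gcongr
    have h2 : μ ^ 3 * δ ^ 2 / (144 * K ^ 2) = μ ^ 3 / (288 * K ^ 2) * δ ^ 2 + μ ^ 3 / (288 * K ^ 2) * δ ^ 2 := by
      field_simp; norm_num
    rw [h2, ENNReal.ofReal_add (by positivity) (by positivity)] at h1
    exact (ENNReal.add_le_add_iff_right ENNReal.ofReal_ne_top).1 h1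
  have hGfin : volume Good ≠ ∞ := by
    have h1 : Good ⊆ (I ×ˢ J) ×ˢ (I ×ˢ I) := by
      intro p hp
      have := hOK p hp.1
      exact ⟨this.1, this.2.1, this.2.2.1⟩
    refine ((measure_mono h1).trans_lt ?_).ne
    rw [Measure.volume_eq_prod, Measure.prod_prod, Measure.volume_eq_prod ℝ ℝ, Measure.prod_prod,
      Measure.prod_prod]
    have hI1 := vol_le_one G.bI
    have hJ1 := vol_le_one G.bJ
    have : volume I * volume J * (volume I * volume I) ≤ 1 :=
      mul_le_one' (mul_le_one' hI1 hJ1) (mul_le_one' hI1 hI1)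
    exact this.trans_lt ENNReal.one_lt_top
  obtain ⟨g, hg1, hg2⟩ := select_pair I G.bI δ (μ ^ 3 / (288 * K ^ 2)) hδ Good hGm
    (fun p hp => ⟨(hSp hp.1.1).1, hp.1.2.2.2.1, hp.1.2.2.2.2.1⟩) hgood hGfin
  exact ⟨g, _, hg1, hg2, fun a ha => ⟨ha.1, ha.2⟩⟩

/-- Bounds on the coefficients. -/
structure GeoA (I J : Set ℝ) (w V A B : ℝ × ℝ → ℝ) (K : ℝ) : Prop where
  Aub : ∀ u ∈ I, ∀ v ∈ J, |A (u, v)| ≤ K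
  Bub : ∀ u ∈ I, ∀ v ∈ J, |B (u, v)| ≤ K
  Blb : ∀ u ∈ I, ∀ v ∈ J, 1 ≤ K * |B (u, v)|
  AL : ∀ u ∈ I, ∀ v ∈ J, ∀ y ∈ I, V (y, w (u, v)) ∈ J →
    |A (y, V (y, w (u, v))) - A (u, v)| ≤ K * |y - u|
  BL : ∀ u ∈ I, ∀ v ∈ J, ∀ y ∈ I, V (y, w (u, v)) ∈ J →
    |B (y, V (y, w (u, v))) - B (u, v)| ≤ K * |y - u|

lemma abs_mul_le' {a b x y : ℝ} (ha : |a| ≤ x) (hb : |b| ≤ y) : |a * b| ≤ x * y := by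
  rw [abs_mul]; exact mul_le_mul ha hb (abs_nonneg _) ((abs_nonneg _).trans ha)

/-- difference of the equation along an edge -/
lemma edge_diff {I J : Set ℝ} {w V U r A B : ℝ × ℝ → ℝ} {Jd : (ℝ × ℝ) × (ℝ × ℝ) → ℝ} {K c : ℝ}
    (G : Geo I J w V U r Jd K c) (GW : GeoW I J w V K)
    (Sp : Set (ℝ × ℝ)) (hSp : Sp ⊆ I ×ˢ J) (ε : ℝ)
    (f g h : ℝ → ℝ) (hEq : ∀ q ∈ Sp, |A q * f q.1 + B q * g q.2 + h (w q)| ≤ ε)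
    (q : ℝ × ℝ) (y : ℝ) (hq : q ∈ Sp) (hy : (y, V (y, w q)) ∈ Sp) :
    |A (y, V (y, w q)) * f y - A q * f q.1 + (B (y, V (y, w q)) * g (V (y, w q)) - B q * g q.2)| ≤ 2 * ε := by
  have h1 := hEq _ hq
  have h2 := hEq _ hy
  have h3 : w (y, V (y, w q)) = w q := GW.wV q.1 (hSp hq).1 q.2 (hSp hq).2 y (hSp hy).1
  rw [h3] at h2
  simp only at h2
  rw [abs_le] at *
  constructor <;> linarith [h1.1, h1.2, h2.1, h2.2]

lemma lemA {I J : Set ℝ} {w V U A B : ℝ × ℝ → ℝ} {Jd : (ℝ × ℝ) × (ℝ × ℝ) → ℝ} {K c : ℝ}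
    (G : Geo I J w V U (fun q => A q / B q) Jd K c) (GW : GeoW I J w V K) (GA : GeoA I J w V A B K)
    (Sp : Set (ℝ × ℝ)) (hS : MeasurableSet Sp) (hSp : Sp ⊆ I ×ˢ J)
    (δ μ η ε : ℝ) (hδ : 0 < δ) (hδ1 : δ ≤ 1) (hμ : 0 < μ) (hμS : ENNReal.ofReal μ ≤ volume Sp)
    (hη : 0 < η) (hη1 : η ≤ 1) (hδη : K * δ ≤ η)
    (hηc : 3036 * K ^ 12 * η ^ (c / 24) ≤ μ ^ 3 / (288 * K ^ 2)) (hε : 0 < ε)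
    (f g h : ℝ → ℝ) (hf : Measurable f) (hg : Measurable g)
    (hEq : ∀ q ∈ Sp, |A q * f q.1 + B q * g q.2 + h (w q)| ≤ ε)
    (hf1 : ∀ q ∈ Sp, |f q.1| ≤ 1) (hg1 : ∀ q ∈ Sp, |g q.2| ≤ 1) :
    ∃ (fb : ℤ → ℝ) (S' : Set (ℝ × ℝ)), MeasurableSet S' ∧ S' ⊆ Sp ∧
      ENNReal.ofReal (μ ^ 3 / (288 * K ^ 2)) ≤ volume S' ∧
      ∀ a ∈ S', |f a.1 - fb ⌊a.1 / δ⌋| ≤ 2 * K ^ 2 * (ε + δ) / η := by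
  have hK := G.hK
  obtain ⟨γ, S', hS'm, hS'v, hS'⟩ := combine G GW Sp hS hSp δ μ η (2 * K ^ 2 * (ε + δ)) hδ hδ1 hμ hμS hη hη1
    hδη hηc (by positivity) (fun q => f q.2.1 - f q.1) (by fun_prop)
    (fun q => g q.1.2 - g q.1.1) (by fun_prop) (by
      rintro ⟨⟨u, v⟩, ⟨y, y'⟩⟩ ⟨h1, h2, h3, h4, h5, h6, h7⟩
      have hd := edge_diff G GW Sp hSp ε f g h hEq (u, v) y h1 h2
      have hyu : |y - u| ≤ δ := dist_of_floor_eq hδ h4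
      have hu := (hSp h1).1
      have hv := (hSp h1).2
      have hy := (hSp h2).1
      have hz := (hSp h2).2
      have hA := GA.AL u hu v hv y hy hz
      have hB := GA.BL u hu v hv y hy hz
      have hfy := hf1 _ h2
      have hgz := hg1 _ h2
      have hBlb := GA.Blb u hu v hv
      simp only at hd hfy hgz ⊢
      set z := V (y, w (u, v)) with hzd
      have hB0 : B (u, v) ≠ 0 := by
        intro h0; rw [h0] at hBlb; simp at hBlb; linarith
      have e1 : A (u, v) / B (u, v) * (f y - f u) + (g z - g v) =
          (1 / B (u, v)) * ((A (y, z) * f y - A (u, v) * f u + (B (y, z) * g z - B (u, v) * g v))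
            - (A (y, z) - A (u, v)) * f y - (B (y, z) - B (u, v)) * g z) := by
        field_simp; ring
      rw [e1]
      have hBi : |1 / B (u, v)| ≤ K := by
        rw [abs_div, abs_one, div_le_iff₀ (abs_pos.2 hB0)]; exact hBlb
      have t1 := abs_mul_le' hA hfy
      have t2 := abs_mul_le' hB hgz
      have hKd : K * |y - u| ≤ K * δ := by gcongr
      have t3 : |(A (y, z) * f y - A (u, v) * f u + (B (y, z) * g z - B (u, v) * g v))
            - (A (y, z) - A (u, v)) * f y - (B (y, z) - B (u, v)) * g z| ≤ 2 * ε + 2 * K * δ := by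
        rw [abs_le] at *
        constructor <;> linarith [t1.1, t1.2, t2.1, t2.2, hd.1, hd.2]
      refine (abs_mul_le' hBi t3).trans ?_
      nlinarith [mul_le_mul_of_nonneg_right hK hε.le, mul_pos (lt_of_lt_of_le one_pos hK) hε])
  refine ⟨fun n => f (γ n).1, S', hS'm, fun a ha => (hS' a ha).1.1, hS'v, fun a ha => ?_⟩
  have := (hS' a ha).2
  rw [abs_sub_comm]
  exact this

structure GeoB (I J : Set ℝ) (w V A B κ : ℝ × ℝ → ℝ) (K : ℝ) : Prop where
  A2 : ∃ A' : ℝ × ℝ → ℝ, ∀ u ∈ I, ∀ v ∈ J, ∀ y ∈ I, V (y, w (u, v)) ∈ J →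
    |A (y, V (y, w (u, v))) - A (u, v) - (y - u) * A' (u, v)| ≤ K * |y - u| ^ 2
  B2 : ∃ B' : ℝ × ℝ → ℝ, ∀ u ∈ I, ∀ v ∈ J, ∀ y ∈ I, V (y, w (u, v)) ∈ J →
    |B (y, V (y, w (u, v))) - B (u, v) - (y - u) * B' (u, v)| ≤ K * |y - u| ^ 2
  V2 : ∀ u ∈ I, ∀ v ∈ J, ∀ y ∈ I, V (y, w (u, v)) ∈ J →
    |V (y, w (u, v)) - v - κ (u, v) * (y - u)| ≤ K * |y - u| ^ 2
  κub : ∀ u ∈ I, ∀ v ∈ J, |κ (u, v)| ≤ K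

lemma abs_le_of_eq {x y b : ℝ} (h : x = y) (hy : |y| ≤ b) : |x| ≤ b := h ▸ hy

/-- pure algebra: taylor along edges -/
lemma taylor_pair (A A1 A2 A' F F1 F2 d d' δ K M : ℝ) (hK : 1 ≤ K) (hδ : 0 < δ) (hM : 0 ≤ M)
    (hd : |d| ≤ δ) (hd' : |d'| ≤ δ) (hF : |F| ≤ 1) (h1 : |A1 - A| ≤ K * δ) (h2 : |A2 - A| ≤ K * δ)
    (h1' : |A1 - A - d * A'| ≤ K * δ ^ 2) (h2' : |A2 - A - d' * A'| ≤ K * δ ^ 2)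
    (hF1 : |F1 - F| ≤ M * δ) (hF2 : |F2 - F| ≤ M * δ) :
    |d' * (A1 * F1 - A * F) - d * (A2 * F2 - A * F) - A * (d' * (F1 - F) - d * (F2 - F))|
      ≤ 2 * K * (1 + M) * δ ^ 3 := by
  have e : d' * (A1 * F1 - A * F) - d * (A2 * F2 - A * F) - A * (d' * (F1 - F) - d * (F2 - F)) =
    d' * ((A1 - A - d * A') * F) + d' * ((A1 - A) * (F1 - F)) - d * ((A2 - A - d' * A') * F)
      - d * ((A2 - A) * (F2 - F)) := by ring
  rw [e]
  have t1 := abs_mul_le' hd' (abs_mul_le' h1' hF)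
  have t2 := abs_mul_le' hd' (abs_mul_le' h1 hF1)
  have t3 := abs_mul_le' hd (abs_mul_le' h2' hF)
  have t4 := abs_mul_le' hd (abs_mul_le' h2 hF2)
  have e2 : 2 * K * (1 + M) * δ ^ 3 = δ * (K * δ ^ 2 * 1) + δ * (K * δ * (M * δ)) + δ * (K * δ ^ 2 * 1) + δ * (K * δ * (M * δ)) := by ring
  rw [e2]
  rw [abs_le] at t1 t2 t3 t4 ⊢
  constructor <;> linarith [t1.1, t1.2, t2.1, t2.2, t3.1, t3.2, t4.1, t4.2]

lemma abs_sub_le_of_three {a b c d x y z t : ℝ} (ha : |a| ≤ x) (hb : |b| ≤ y) (hc : |c| ≤ z) (hd : |d| ≤ t) :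
    |a - b - c - d| ≤ x + y + z + t := by
  rw [abs_le] at *
  constructor <;> linarith [ha.1, ha.2, hb.1, hb.2, hc.1, hc.2, hd.1, hd.2]

lemma abs_sub_le_of_five {a b c d e x y z t s : ℝ} (ha : |a| ≤ x) (hb : |b| ≤ y) (hc : |c| ≤ z) (hd : |d| ≤ t)
    (he : |e| ≤ s) :
    |a - b + c - d + e| ≤ x + y + z + t + s := by
  rw [abs_le] at *
  constructor <;> linarith [ha.1, ha.2, hb.1, hb.2, hc.1, hc.2, hd.1, hd.2, he.1, he.2]

lemma lemB_alg (A0 A1 A2 Ap B0 B1 B2 Bp k f0 f1 f2 g0 g1 g2 gn n u v y y' z z' δ ε K L : ℝ)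
    (hK : 1 ≤ K) (hδ : 0 < δ) (hε : 0 < ε) (hεδ : ε ≤ δ) (hδε : δ ^ 2 ≤ ε) (hL : 1 ≤ L)
    (hd : |A1 * f1 - A0 * f0 + (B1 * g1 - B0 * g0)| ≤ 2 * ε)
    (hd' : |A2 * f2 - A0 * f0 + (B2 * g2 - B0 * g0)| ≤ 2 * ε)
    (hyu : |y - u| ≤ δ) (hyu' : |y' - u| ≤ δ)
    (hf0 : |f0| ≤ 1) (hg0 : |g0| ≤ 1)
    (hBlb : 1 ≤ K * |B0|) (hAub : |A0| ≤ K) (hκ : |k| ≤ K)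
    (hΔf : |f1 - f0| ≤ 2 * L * δ) (hΔf' : |f2 - f0| ≤ 2 * L * δ) (hgb : |g2 - gn| ≤ L * ε)
    (hzv : |z - v| ≤ K * δ)
    (hA : |A1 - A0| ≤ K * δ) (hB : |B1 - B0| ≤ K * δ)
    (hA' : |A2 - A0| ≤ K * δ) (hB' : |B2 - B0| ≤ K * δ)
    (hAA : |A1 - A0 - (y - u) * Ap| ≤ K * δ ^ 2) (hAA' : |A2 - A0 - (y' - u) * Ap| ≤ K * δ ^ 2)
    (hBB : |B1 - B0 - (y - u) * Bp| ≤ K * δ ^ 2) (hBB' : |B2 - B0 - (y' - u) * Bp| ≤ K * δ ^ 2)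
    (hVV : |z - v - k * (y - u)| ≤ K * δ ^ 2) (hVV' : |z' - v - k * (y' - u)| ≤ K * δ ^ 2)
    (hf1 : |f1| ≤ 1) (hf2 : |f2| ≤ 1) (hg1 : |g1| ≤ 1) (hg2 : |g2| ≤ 1)
    (hfl : |z' - n * δ ^ 2| ≤ δ ^ 2) :
    |A0 * k / B0 * ((y' - u) * (f1 - f0) - (y - u) * (f2 - f0)) +
      ((n * δ ^ 2 - v) * (g1 - g0) - (z - v) * (gn - g0))| ≤ 44 * K ^ 5 * L * δ * ε := by
  have hK0 : 0 < K := by linarith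
  have hL0 : 0 < L := by linarith
  have hB0 : B0 ≠ 0 := by
    intro h0; rw [h0] at hBlb; simp at hBlb; linarith
  have hBi : |1 / B0| ≤ K := by
    rw [abs_div, abs_one, div_le_iff₀ (abs_pos.2 hB0)]; exact hBlb
  have hKL : 1 ≤ K * L := one_le_mul_of_one_le_of_one_le hK hL
  have aux : ∀ F1 G1 A1' B1' : ℝ, |A1' * F1 - A0 * f0 + (B1' * G1 - B0 * g0)| ≤ 2 * ε →
      |F1 - f0| ≤ 2 * L * δ → |A1' - A0| ≤ K * δ → |B1' - B0| ≤ K * δ → |F1| ≤ 1 → |G1| ≤ 1 →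
      |G1 - g0| ≤ 6 * K ^ 2 * L * δ := by
    intro F1 G1 A1' B1' h1 h2 h3 h4 h6 h5
    have e1 : G1 - g0 = (1 / B0) * ((A1' * F1 - A0 * f0 + (B1' * G1 - B0 * g0)) - A0 * (F1 - f0)
      - (A1' - A0) * F1 - (B1' - B0) * G1) := by field_simp; ring
    rw [e1]
    have t1 := abs_mul_le' hAub h2
    have t2 := abs_mul_le' h3 h6
    have t3 := abs_mul_le' h4 h5
    have t4 : |(A1' * F1 - A0 * f0 + (B1' * G1 - B0 * g0)) - A0 * (F1 - f0)
      - (A1' - A0) * F1 - (B1' - B0) * G1| ≤ 6 * K * L * δ := by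
      have q1 : K * δ ≤ K * L * δ := by
        have := mul_le_mul_of_nonneg_left hL (mul_pos hK0 hδ).le
        linarith
      have q2 : ε ≤ K * L * δ := by
        have := mul_le_mul_of_nonneg_right hKL hδ.le
        linarith
      rw [abs_le] at t1 t2 t3 h1 ⊢
      constructor <;> linarith [t1.1, t1.2, t2.1, t2.2, t3.1, t3.2, h1.1, h1.2]
    refine (abs_mul_le' hBi t4).trans (le_of_eq (by ring))
  have hΔg := aux f1 g1 A1 B1 hd hΔf hA hB hf1 hg1
  have hΔg' := aux f2 g2 A2 B2 hd' hΔf' hA' hB' hf2 hg2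
  have TA := taylor_pair A0 A1 A2 Ap f0 f1 f2 (y - u) (y' - u) δ K (2 * L) hK hδ (by positivity)
    hyu hyu' hf0 hA hA' hAA hAA' hΔf hΔf'
  have TB := taylor_pair B0 B1 B2 Bp g0 g1 g2 (y - u) (y' - u) δ K (6 * K ^ 2 * L) hK hδ (by positivity)
    hyu hyu' hg0 hB hB' hBB hBB' hΔg hΔg'
  have D1 := abs_mul_le' hyu' hd
  have D2 := abs_mul_le' hyu hd'
  have hδ3 : δ ^ 3 ≤ δ * ε := by
    calc δ ^ 3 = δ * δ ^ 2 := by ring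
      _ ≤ δ * ε := by gcongr
  have hδε0 : 0 < δ * ε := by positivity
  have c1 : 1 ≤ K ^ 3 * L := one_le_mul_of_one_le_of_one_le (one_le_pow₀ hK) hL
  have c2 : K * L ≤ K ^ 3 * L := by
    have : K ≤ K ^ 3 := le_self_pow₀ hK (by norm_num)
    gcongr
  have c3 : K ≤ K ^ 3 * L := by nlinarith
  have TA' : 2 * K * (1 + 2 * L) * δ ^ 3 ≤ 6 * (K ^ 3 * L) * (δ * ε) := by
    refine mul_le_mul ?_ hδ3 (by positivity) (by positivity)
    linarith
  have TB' : 2 * K * (1 + 6 * K ^ 2 * L) * δ ^ 3 ≤ 14 * (K ^ 3 * L) * (δ * ε) := by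
    refine mul_le_mul ?_ hδ3 (by positivity) (by positivity)
    linarith
  have D3 : δ * (2 * ε) ≤ 2 * (K ^ 3 * L) * (δ * ε) := by
    have := mul_le_mul_of_nonneg_right c1 hδε0.le
    linarith
  have hkB := abs_mul_le' hκ hBi
  have P1 : |(y' - u) * (A1 * f1 - A0 * f0 + (B1 * g1 - B0 * g0)) - (y - u) * (A2 * f2 - A0 * f0 + (B2 * g2 - B0 * g0))
     - ((y' - u) * (A1 * f1 - A0 * f0) - (y - u) * (A2 * f2 - A0 * f0) - A0 * ((y' - u) * (f1 - f0) - (y - u) * (f2 - f0)))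
     - ((y' - u) * (B1 * g1 - B0 * g0) - (y - u) * (B2 * g2 - B0 * g0) - B0 * ((y' - u) * (g1 - g0) - (y - u) * (g2 - g0)))|
      ≤ 24 * (K ^ 3 * L) * (δ * ε) := by
    have := abs_sub_le_of_three D1 D2 TA TB
    linarith
  have P2 := abs_mul_le' hkB P1
  have R1 := abs_mul_le' hfl hΔg
  have R2 := abs_mul_le' hVV' hΔg
  have R3 := abs_mul_le' hVV hΔg'
  have R4 := abs_mul_le' hzv hgb
  have e : A0 * k / B0 * ((y' - u) * (f1 - f0) - (y - u) * (f2 - f0)) +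
      ((n * δ ^ 2 - v) * (g1 - g0) - (z - v) * (gn - g0)) =
    k * (1 / B0) * ((y' - u) * (A1 * f1 - A0 * f0 + (B1 * g1 - B0 * g0)) - (y - u) * (A2 * f2 - A0 * f0 + (B2 * g2 - B0 * g0))
     - ((y' - u) * (A1 * f1 - A0 * f0) - (y - u) * (A2 * f2 - A0 * f0) - A0 * ((y' - u) * (f1 - f0) - (y - u) * (f2 - f0)))
     - ((y' - u) * (B1 * g1 - B0 * g0) - (y - u) * (B2 * g2 - B0 * g0) - B0 * ((y' - u) * (g1 - g0) - (y - u) * (g2 - g0))))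
    - (z' - n * δ ^ 2) * (g1 - g0) + (z' - v - k * (y' - u)) * (g1 - g0) - (z - v - k * (y - u)) * (g2 - g0)
    + (z - v) * (g2 - gn) := by
    field_simp; ring
  rw [e]
  have c5 : K ^ 3 * L ≤ K ^ 5 * L := by
    have : K ^ 3 ≤ K ^ 5 := pow_le_pow_right₀ hK (by norm_num)
    gcongr
  have c6 : K ^ 2 * L ≤ K ^ 5 * L := by
    have : K ^ 2 ≤ K ^ 5 := pow_le_pow_right₀ hK (by norm_num)
    gcongr
  have c7 : K * L ≤ K ^ 5 * L := c2.trans c5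
  have Q1 : δ ^ 2 * (6 * K ^ 2 * L * δ) ≤ 6 * (K ^ 5 * L) * (δ * ε) := by
    calc _ = (6 * (K ^ 2 * L)) * δ ^ 3 := by ring
      _ ≤ _ := mul_le_mul (by linarith) hδ3 (by positivity) (by positivity)
  have Q2 : K * δ ^ 2 * (6 * K ^ 2 * L * δ) ≤ 6 * (K ^ 5 * L) * (δ * ε) := by
    calc _ = (6 * (K ^ 3 * L)) * δ ^ 3 := by ring
      _ ≤ _ := mul_le_mul (by linarith) hδ3 (by positivity) (by positivity)
  have Q4 : K * δ * (L * ε) ≤ (K ^ 5 * L) * (δ * ε) := by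
    calc _ = (K * L) * (δ * ε) := by ring
      _ ≤ _ := mul_le_mul c7 le_rfl (by positivity) (by positivity)
  have Q0 : K * K * (24 * (K ^ 3 * L) * (δ * ε)) = 24 * (K ^ 5 * L) * (δ * ε) := by ring
  rw [Q0] at P2
  have F : 44 * K ^ 5 * L * δ * ε = 44 * ((K ^ 5 * L) * (δ * ε)) := by ring
  have := abs_sub_le_of_five P2 R1 R2 R3 R4
  have hpos : 0 < K ^ 5 * L * (δ * ε) := by positivity
  linarith

lemma lemB {I J : Set ℝ} {w V U A B κ : ℝ × ℝ → ℝ} {Jd : (ℝ × ℝ) × (ℝ × ℝ) → ℝ} {K c : ℝ}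
    (G : Geo I J w V U (fun q => A q * κ q / B q) Jd K c) (GW : GeoW I J w V K) (GA : GeoA I J w V A B K)
    (GB : GeoB I J w V A B κ K)
    (Sp : Set (ℝ × ℝ)) (hS : MeasurableSet Sp) (hSp : Sp ⊆ I ×ˢ J)
    (δ μ η ε L : ℝ) (hδ : 0 < δ) (hδ1 : δ ≤ 1) (hμ : 0 < μ) (hμS : ENNReal.ofReal μ ≤ volume Sp)
    (hη : 0 < η) (hη1 : η ≤ 1) (hδη : K * δ ≤ η)
    (hηc : 3036 * K ^ 12 * η ^ (c / 24) ≤ μ ^ 3 / (288 * K ^ 2)) (hε : 0 < ε)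
    (hεδ : ε ≤ δ) (hδε : δ ^ 2 ≤ ε) (hL : 1 ≤ L)
    (f g h : ℝ → ℝ) (hf : Measurable f) (hg : Measurable g)
    (hEq : ∀ q ∈ Sp, |A q * f q.1 + B q * g q.2 + h (w q)| ≤ ε)
    (hf1 : ∀ q ∈ Sp, |f q.1| ≤ 1) (hg1 : ∀ q ∈ Sp, |g q.2| ≤ 1)
    (fb gb : ℤ → ℝ) (hfb : ∀ q ∈ Sp, |f q.1 - fb ⌊q.1 / δ⌋| ≤ L * δ)
    (hgb : ∀ q ∈ Sp, |g q.2 - gb ⌊q.2 / δ ^ 2⌋| ≤ L * ε) :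
    ∃ (m b : ℤ → ℝ) (S' : Set (ℝ × ℝ)), MeasurableSet S' ∧ S' ⊆ Sp ∧
      ENNReal.ofReal (μ ^ 3 / (288 * K ^ 2)) ≤ volume S' ∧ (∀ n, |m n| ≤ 48 * K * L / μ) ∧
      ∀ a ∈ S', |f a.1 - (m ⌊a.1 / δ⌋ * a.1 + b ⌊a.1 / δ⌋)| ≤ 1056 * K ^ 6 * L * ε / (η * μ) := by
  have hK := G.hK
  have hK0 : 0 < K := by linarith
  have hL0 : 0 < L := by linarith
  obtain ⟨A', hA2⟩ := GB.A2
  obtain ⟨B', hB2⟩ := GB.B2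
  -- same cell
  have hcell : ∀ q ∈ Sp, ∀ q' ∈ Sp, ⌊q.1 / δ⌋ = ⌊q'.1 / δ⌋ → |f q.1 - f q'.1| ≤ 2 * L * δ := by
    intro q hq q' hq' hqq
    have h1 := hfb q hq
    have h2 := hfb q' hq'
    rw [hqq] at h1
    rw [abs_le] at *
    constructor <;> linarith [h1.1, h1.2, h2.1, h2.2]
  have hEQ : ∀ p ∈ Etot w V Sp δ (μ / (24 * K)), |(A p.1 * κ p.1 / B p.1) * ((p.2.2 - p.1.1) * (f p.2.1 - f p.1.1) - (p.2.1 - p.1.1) * (f p.2.2 - f p.1.1))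
      + ((⌊V (p.2.2, w p.1) / δ ^ 2⌋ * δ ^ 2 - p.1.2) * (g (V (p.2.1, w p.1)) - g p.1.2) - (V (p.2.1, w p.1) - p.1.2) * (gb ⌊V (p.2.2, w p.1) / δ ^ 2⌋ - g p.1.2))|
      ≤ 44 * K ^ 5 * L * δ * ε := by
    rintro ⟨⟨u, v⟩, ⟨y, y'⟩⟩ ⟨h1, h2, h3, h4, h5, h6, h7⟩
    have hyu : |y - u| ≤ δ := dist_of_floor_eq hδ h4
    have hyu' : |y' - u| ≤ δ := dist_of_floor_eq hδ h5
    have hu := (hSp h1).1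
    have hv := (hSp h1).2
    have hy := (hSp h2).1
    have hz := (hSp h2).2
    have hy' := (hSp h3).1
    have hz' := (hSp h3).2
    have hzv : |V (y, w (u, v)) - v| ≤ K * δ := by
      have := G.Vlip u hu v hv y hy u hu
      rw [G.Vw u hu v hv] at this
      exact this.trans (by gcongr)
    have kd : K * |y - u| ≤ K * δ := by gcongr
    have kd' : K * |y' - u| ≤ K * δ := by gcongr
    have kdd : K * |y - u| ^ 2 ≤ K * δ ^ 2 := by gcongr
    have kdd' : K * |y' - u| ^ 2 ≤ K * δ ^ 2 := by gcongr
    have hfl : |V (y', w (u, v)) - ⌊V (y', w (u, v)) / δ ^ 2⌋ * δ ^ 2| ≤ δ ^ 2 := by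
      have p1 := Int.floor_le (V (y', w (u, v)) / δ ^ 2)
      have p2 := (Int.lt_floor_add_one (V (y', w (u, v)) / δ ^ 2)).le
      have hδ2 : 0 < δ ^ 2 := by positivity
      rw [le_div_iff₀ hδ2] at p1
      rw [div_le_iff₀ hδ2, add_mul, one_mul] at p2
      rw [abs_le]; constructor <;> linarith
    exact lemB_alg _ _ _ (A' (u, v)) _ _ _ (B' (u, v)) _ _ _ _ _ _ (g (V (y', w (u, v)))) _ _ _ _ _ _ _ (V (y', w (u, v))) δ ε K L hK hδ hε hεδ hδε hL
      (edge_diff G GW Sp hSp ε f g h hEq (u, v) y h1 h2)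
      (edge_diff G GW Sp hSp ε f g h hEq (u, v) y' h1 h3) hyu hyu' (hf1 _ h1) (hg1 _ h1)
      (GA.Blb u hu v hv) (GA.Aub u hu v hv) (GB.κub u hu v hv) (hcell _ h2 _ h1 h4) (hcell _ h3 _ h1 h5)
      (hgb _ h3) hzv ((GA.AL u hu v hv y hy hz).trans kd) ((GA.BL u hu v hv y hy hz).trans kd)
      ((GA.AL u hu v hv y' hy' hz').trans kd') ((GA.BL u hu v hv y' hy' hz').trans kd')
      ((hA2 u hu v hv y hy hz).trans kdd) ((hA2 u hu v hv y' hy' hz').trans kdd')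
      ((hB2 u hu v hv y hy hz).trans kdd) ((hB2 u hu v hv y' hy' hz').trans kdd')
      ((GB.V2 u hu v hv y hy hz).trans kdd) ((GB.V2 u hu v hv y' hy' hz').trans kdd')
      (hf1 (y, V (y, w (u, v))) h2) (hf1 (y', V (y', w (u, v))) h3) (hg1 (y, V (y, w (u, v))) h2) (hg1 (y', V (y', w (u, v))) h3) hfl
  obtain ⟨γ, S', hS'm, hS'v, hS'⟩ := combine G GW Sp hS hSp δ μ η (44 * K ^ 5 * L * δ * ε) hδ hδ1 hμ hμS hη hη1
    hδη hηc (by positivity) (fun q => (q.2.2 - q.1) * (f q.2.1 - f q.1) - (q.2.1 - q.1) * (f q.2.2 - f q.1)) (by fun_prop)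
    (fun q => (q.2 * δ ^ 2 - q.1.1) * (g q.1.2 - g q.1.1) - (q.1.2 - q.1.1) * (gb q.2 - g q.1.1)) (by
      have hgbm : Measurable gb := measurable_of_countable _
      have hcm : Measurable (fun n : ℤ => (n : ℝ)) := measurable_of_countable _
      have hc2 : Measurable fun q : (ℝ × ℝ) × ℤ => (q.2 : ℝ) := hcm.comp measurable_snd
      fun_prop) hEQ
  classical
  let m0 : ℤ → ℝ := fun n => (f (γ n).2 - f (γ n).1) / ((γ n).2 - (γ n).1)
  let m : ℤ → ℝ := fun n => if |m0 n| ≤ 48 * K * L / μ then m0 n else 0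
  refine ⟨m, fun n => f (γ n).1 - m n * (γ n).1, S', hS'm, fun a ha => (hS' a ha).1.1, hS'v, ?_, ?_⟩
  · intro n
    simp only [m]
    split_ifs with hh
    · exact hh
    · simp; positivity
  · intro a ha
    obtain ⟨⟨h1, h2, h3, h4, h5, h6, h7⟩, h8⟩ := hS' a ha
    simp only at h2 h3 h4 h5 h6 h7 h8
    have hf2 : |f (γ ⌊a.1 / δ⌋).2 - f (γ ⌊a.1 / δ⌋).1| ≤ 2 * L * δ :=
      hcell _ h3 ((γ ⌊a.1 / δ⌋).1, V ((γ ⌊a.1 / δ⌋).1, w a)) h2 (by simp only; rw [h4, h5])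
    have hm : m ⌊a.1 / δ⌋ = m0 ⌊a.1 / δ⌋ := by
      simp only [m]
      rw [if_pos]
      simp only [m0]
      rw [abs_div, abs_sub_comm (γ ⌊a.1 / δ⌋).2]
      rw [div_le_iff₀ (lt_of_lt_of_le (by positivity) h6)]
      refine hf2.trans ?_
      calc 2 * L * δ = 48 * K * L / μ * (μ / (24 * K) * δ) := by field_simp; norm_num
        _ ≤ _ := by gcongr
    simp only [hm]
    simp only [m0]
    generalize (γ ⌊a.1 / δ⌋).2 = y' at *
    generalize (γ ⌊a.1 / δ⌋).1 = y at *
    have hpos : 0 < |y - y'| := lt_of_lt_of_le (by positivity) h6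
    have hne : y' - y ≠ 0 := by
      intro h0
      have : y - y' = 0 := by linarith
      rw [this] at hpos; simp at hpos
    have e : f a.1 - ((f y' - f y) / (y' - y) * a.1 + (f y - (f y' - f y) / (y' - y) * y)) =
      - ((y' - a.1) * (f y - f a.1) - (y - a.1) * (f y' - f a.1)) / (y' - y) := by
      field_simp; ring
    rw [e, abs_div, abs_neg, abs_sub_comm y' y]
    calc _ ≤ (44 * K ^ 5 * L * δ * ε / η) / (μ / (24 * K) * δ) := by gcongr
      _ = _ := by field_simp; norm_num

lemma ev_closedBall {X : Type*} [PseudoMetricSpace X] {x0 : X} {P : X → Prop} (h : ∀ᶠ x in 𝓝 x0, P x) :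
    ∀ᶠ s in 𝓝[>] (0 : ℝ), ∀ x ∈ Metric.closedBall x0 s, P x := by
  obtain ⟨ρ, hρ, h1⟩ := Metric.nhds_basis_closedBall.eventually_iff.1 h
  have : Iic ρ ∈ 𝓝[>] (0 : ℝ) := mem_nhdsWithin_of_mem_nhds (Iic_mem_nhds hρ)
  filter_upwards [this] with s hs x hx
  exact h1 (Metric.closedBall_subset_closedBall hs hx)

lemma ev_pos : ∀ᶠ s in 𝓝[>] (0 : ℝ), 0 < s := self_mem_nhdsWithin

lemma ev_le {ρ : ℝ} (h : 0 < ρ) : ∀ᶠ s in 𝓝[>] (0 : ℝ), s ≤ ρ :=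
  mem_nhdsWithin_of_mem_nhds (Iic_mem_nhds h)

section
variable {X Y : Type*} [NormedAddCommGroup X] [NormedSpace ℝ X] [NormedAddCommGroup Y] [NormedSpace ℝ Y]

lemma ev_lip [CompleteSpace Y] {f : X → Y} {x0 : X} (hf : AnalyticAt ℝ f x0) :
    ∃ K : ℝ, 0 ≤ K ∧ ∀ᶠ s in 𝓝[>] (0 : ℝ), ∀ x ∈ Metric.closedBall x0 s, ∀ y ∈ Metric.closedBall x0 s,
      ‖f x - f y‖ ≤ K * ‖x - y‖ := by
  obtain ⟨K, t, ht, h⟩ := (hf.contDiffAt (n := 1)).exists_lipschitzOnWith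
  refine ⟨K, K.2, ?_⟩
  filter_upwards [ev_closedBall ht] with s hs x hx y hy
  have := h.dist_le_mul x (hs x hx) y (hs y hy)
  simpa [dist_eq_norm] using this

lemma ev_bdd {f : X → Y} {x0 : X} (hf : ContinuousAt f x0) :
    ∃ K : ℝ, 0 ≤ K ∧ ∀ᶠ s in 𝓝[>] (0 : ℝ), ∀ x ∈ Metric.closedBall x0 s, ‖f x‖ ≤ K := by
  refine ⟨‖f x0‖ + 1, by positivity, ev_closedBall ?_⟩
  have := hf.norm
  exact (this.eventually (gt_mem_nhds (by linarith : ‖f x0‖ < ‖f x0‖ + 1))).mono fun x hx => hx.le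

lemma ev_lb {f : X → Y} {x0 : X} (hf : ContinuousAt f x0) (h0 : f x0 ≠ 0) :
    ∃ K : ℝ, 0 ≤ K ∧ ∀ᶠ s in 𝓝[>] (0 : ℝ), ∀ x ∈ Metric.closedBall x0 s, 1 ≤ K * ‖f x‖ := by
  have hp : 0 < ‖f x0‖ := norm_pos_iff.2 h0
  refine ⟨2 / ‖f x0‖, by positivity, ev_closedBall ?_⟩
  have := hf.norm
  refine (this.eventually (lt_mem_nhds (by linarith : ‖f x0‖ / 2 < ‖f x0‖))).mono fun x hx => ?_
  rw [div_mul_eq_mul_div, le_div_iff₀ hp]; linarith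

/-- second order Taylor estimate -/
lemma ev_taylor [CompleteSpace Y] {f : X → Y} {x0 : X} (hf : AnalyticAt ℝ f x0) :
    ∃ K : ℝ, 0 ≤ K ∧ ∀ᶠ s in 𝓝[>] (0 : ℝ), ∀ x ∈ Metric.closedBall x0 s, ∀ y ∈ Metric.closedBall x0 s,
      ∀ z ∈ Metric.closedBall x0 s, ∀ m : ℝ, ‖x - z‖ ≤ m → ‖y - z‖ ≤ m →
      ‖f x - f y - fderiv ℝ f z (x - y)‖ ≤ K * m * ‖x - y‖ := by
  obtain ⟨K, hK, h⟩ := ev_lip hf.fderiv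
  refine ⟨K, hK, ?_⟩
  filter_upwards [h, ev_closedBall hf.eventually_analyticAt] with s hs hs' x hx y hy z hz m hm hm'
  have hconv : Convex ℝ (Metric.closedBall x0 s ∩ Metric.closedBall z m) :=
    (convex_closedBall _ _).inter (convex_closedBall _ _)
  have := hconv.norm_image_sub_le_of_norm_hasFDerivWithin_le' (f := f) (f' := fderiv ℝ f)
    (φ := fderiv ℝ f z) (C := K * m) (x := y) (y := x)
    (fun t ht => (hs' t ht.1).differentiableAt.hasFDerivAt.hasFDerivWithinAt) ?_ ⟨hy, ?_⟩ ⟨hx, ?_⟩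
  · exact this
  · intro t ht
    refine (hs t ht.1 z hz).trans ?_
    have := ht.2
    rw [mem_closedBall_iff_norm] at this
    gcongr
  · rwa [mem_closedBall_iff_norm]
  · rwa [mem_closedBall_iff_norm]

/-- a measurable version of a germ -/
lemma meas_version [MeasurableSpace X] [BorelSpace X] {f : X → ℝ} {x0 : X} (hf : AnalyticAt ℝ f x0) :
    ∃ g : X → ℝ, Measurable g ∧ g =ᶠ[𝓝 x0] f := by
  classical
  obtain ⟨ρ, hρ, h1⟩ := Metric.nhds_basis_closedBall.eventually_iff.1 hf.eventually_analyticAt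
  refine ⟨(Metric.closedBall x0 ρ).piecewise f (fun _ => 0), ?_, ?_⟩
  · have hc : ContinuousOn f (Metric.closedBall x0 ρ) := fun x hx => (h1 hx).continuousAt.continuousWithinAt
    exact ContinuousOn.measurable_piecewise hc continuousOn_const Metric.isClosed_closedBall.measurableSet
  · filter_upwards [Metric.closedBall_mem_nhds x0 hρ] with x hx
    simp [Set.piecewise, hx]

lemma analytic_inverse [CompleteSpace X] [CompleteSpace Y] {F : X → Y} {x0 : X} (hF : AnalyticAt ℝ F x0)
    (e : X ≃L[ℝ] Y) (he : fderiv ℝ F x0 = e) :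
    ∃ Ψ : Y → X, AnalyticAt ℝ Ψ (F x0) ∧ Ψ (F x0) = x0 ∧ (∀ᶠ x in 𝓝 x0, Ψ (F x) = x) ∧
      ∀ᶠ y in 𝓝 (F x0), F (Ψ y) = y := by
  have hst : HasStrictFDerivAt F (e : X →L[ℝ] Y) x0 := by rw [← he]; exact hF.hasStrictFDerivAt
  refine ⟨hst.localInverse F e x0, ?_, hst.localInverse_apply_image, hst.eventually_left_inverse, hst.eventually_right_inverse⟩
  have hh := (hF.contDiffAt (n := ⊤)).to_localInverse (f' := e) (by rw [← he]; exact hF.differentiableAt.hasFDerivAt) (by simp)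
  exact hh.analyticAt
end

structure LW (q0 : ℝ × ℝ) (w V U : ℝ × ℝ → ℝ) : Prop where
  aw : AnalyticAt ℝ w q0
  aV : AnalyticAt ℝ V (q0.1, w q0)
  aU : AnalyticAt ℝ U (q0.2, w q0)
  Vw : ∀ᶠ q in 𝓝 q0, V (q.1, w q) = q.2
  Uw : ∀ᶠ q in 𝓝 q0, U (q.2, w q) = q.1
  wV : ∀ᶠ t in 𝓝 (q0.1, w q0), w (t.1, V t) = t.2
  wU : ∀ᶠ t in 𝓝 (q0.2, w q0), w (U t, t.1) = t.2
  mw : Measurable w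
  mV : Measurable V
  mU : Measurable U

def kap (w V : ℝ × ℝ → ℝ) (q : ℝ × ℝ) : ℝ := fderiv ℝ V (q.1, w q) (1, 0)

def Dmm (r : ℝ × ℝ → ℝ) (p : (ℝ × ℝ) × (ℝ × ℝ)) : (ℝ × ℝ) × (ℝ × ℝ) →L[ℝ] ℝ :=
  fderiv ℝ (fun p : (ℝ × ℝ) × (ℝ × ℝ) => MM r p.1 p.2) p

def Jdet (κ r : ℝ × ℝ → ℝ) (p : (ℝ × ℝ) × (ℝ × ℝ)) : ℝ :=
  Dmm κ p (0, (1, 0)) * Dmm r p (0, (0, 1)) - Dmm κ p (0, (0, 1)) * Dmm r p (0, (1, 0))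

lemma an_of_cd {X Y : Type*} [NormedAddCommGroup X] [NormedSpace ℝ X] [NormedAddCommGroup Y] [NormedSpace ℝ Y]
    {f : X → Y} {x : X} (h : ContDiff ℝ ⊤ f) : AnalyticAt ℝ f x := h.contDiffAt.analyticAt

namespace LW
variable {q0 : ℝ × ℝ} {w V U : ℝ × ℝ → ℝ}

lemma V0 (h : LW q0 w V U) : V (q0.1, w q0) = q0.2 := h.Vw.self_of_nhds
lemma U0 (h : LW q0 w V U) : U (q0.2, w q0) = q0.1 := h.Uw.self_of_nhds

lemma VU (h : LW q0 w V U) : ∀ᶠ t in 𝓝 (q0.2, w q0), V (U t, t.2) = t.1 := by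
  have h1 : Filter.Tendsto (fun t : ℝ × ℝ => (U t, t.1)) (𝓝 (q0.2, w q0)) (𝓝 q0) := by
    have : ContinuousAt (fun t : ℝ × ℝ => (U t, t.1)) (q0.2, w q0) :=
      h.aU.continuousAt.prodMk continuous_fst.continuousAt
    have h2 := this.tendsto
    simp only [h.U0] at h2
    exact h2
  filter_upwards [h.wU, h1.eventually h.Vw] with t ht ht'
  simp only [ht] at ht'
  exact ht'

lemma UV (h : LW q0 w V U) : ∀ᶠ t in 𝓝 (q0.1, w q0), U (V t, t.2) = t.1 := by
  have h1 : Filter.Tendsto (fun t : ℝ × ℝ => (t.1, V t)) (𝓝 (q0.1, w q0)) (𝓝 q0) := by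
    have : ContinuousAt (fun t : ℝ × ℝ => (t.1, V t)) (q0.1, w q0) :=
      continuous_fst.continuousAt.prodMk h.aV.continuousAt
    have h2 := this.tendsto
    simp only [h.V0] at h2
    exact h2
  filter_upwards [h.wV, h1.eventually h.Uw] with t ht ht'
  simp only [ht] at ht'
  exact ht'

lemma tend1 (h : LW q0 w V U) : Filter.Tendsto (fun q : ℝ × ℝ => (q.1, w q)) (𝓝 q0) (𝓝 (q0.1, w q0)) :=
  (continuous_fst.continuousAt.prodMk h.aw.continuousAt : ContinuousAt (fun q : ℝ × ℝ => (q.1, w q)) q0)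

lemma tend2 (h : LW q0 w V U) : Filter.Tendsto (fun q : ℝ × ℝ => (q.2, w q)) (𝓝 q0) (𝓝 (q0.2, w q0)) :=
  (continuous_snd.continuousAt.prodMk h.aw.continuousAt : ContinuousAt (fun q : ℝ × ℝ => (q.2, w q)) q0)

lemma a1 (h : LW q0 w V U) : AnalyticAt ℝ (fun q : ℝ × ℝ => (q.1, w q)) q0 := analyticAt_fst.prod h.aw
lemma a2 (h : LW q0 w V U) : AnalyticAt ℝ (fun q : ℝ × ℝ => (q.2, w q)) q0 := analyticAt_snd.prod h.aw

lemma akap (h : LW q0 w V U) : AnalyticAt ℝ (kap w V) q0 := by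
  have h1 : AnalyticAt ℝ (fun q : ℝ × ℝ => fderiv ℝ V (q.1, w q)) q0 :=
    AnalyticAt.fun_comp (f := fun q : ℝ × ℝ => (q.1, w q)) (g := fderiv ℝ V) (h.aV.fderiv) h.a1
  exact (ContinuousLinearMap.analyticAt (ContinuousLinearMap.apply ℝ ℝ ((1, 0) : ℝ × ℝ)) _).fun_comp h1

lemma mkap (h : LW q0 w V U) : Measurable (kap w V) := by
  have h1 : Measurable (fun t : ℝ × ℝ => fderiv ℝ V t (1, 0)) := measurable_fderiv_apply_const ℝ V (1, 0)
  exact h1.comp (measurable_fst.prodMk h.mw)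

lemma derivs (h : LW q0 w V U) : ∀ᶠ q in 𝓝 q0,
    HasDerivAt (fun y => V (y, w q)) (kap w V q) q.1 ∧ kap w V q ≠ 0 ∧
    HasDerivAt (fun z => U (z, w q)) (kap w V q)⁻¹ q.2 := by
  filter_upwards [h.tend1.eventually h.aV.eventually_analyticAt, h.tend2.eventually h.aU.eventually_analyticAt,
    h.tend1.eventually h.UV.eventually_nhds, h.Vw] with q hV hU hUV hq
  have d1 : HasDerivAt (fun y => V (y, w q)) (kap w V q) q.1 := by
    have := hV.differentiableAt.hasFDerivAt
    exact HasFDerivAt.comp_hasDerivAt (f := fun y : ℝ => (y, w q)) q.1 this ((hasDerivAt_id _).prodMk (hasDerivAt_const _ _))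
  have d2 : HasDerivAt (fun z => U (z, w q)) (fderiv ℝ U (q.2, w q) (1, 0)) q.2 := by
    have := hU.differentiableAt.hasFDerivAt
    exact HasFDerivAt.comp_hasDerivAt (f := fun y : ℝ => (y, w q)) q.2 this ((hasDerivAt_id _).prodMk (hasDerivAt_const _ _))
  have d3 : HasDerivAt (fun y => U (V (y, w q), w q)) (fderiv ℝ U (q.2, w q) (1, 0) * kap w V q) q.1 := by
    have d2' := d2
    rw [← hq] at d2'
    have := HasDerivAt.comp q.1 d2' d1
    simp only [hq] at this
    exact this
  have d4 : HasDerivAt (fun y => U (V (y, w q), w q)) 1 q.1 := by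
    refine (hasDerivAt_id q.1).congr_of_eventuallyEq ?_
    have : Filter.Tendsto (fun y : ℝ => (y, w q)) (𝓝 q.1) (𝓝 (q.1, w q)) :=
      (by fun_prop : Continuous fun y : ℝ => (y, w q)).tendsto _
    exact this.eventually hUV
  have e := d3.unique d4
  have hk : kap w V q ≠ 0 := right_ne_zero_of_mul (e.trans_ne one_ne_zero)
  refine ⟨d1, hk, ?_⟩
  rw [← eq_inv_of_mul_eq_one_left e]; exact d2

lemma kap0 (h : LW q0 w V U) : kap w V q0 ≠ 0 := h.derivs.self_of_nhds.2.1

abbrev X3 := (ℝ × ℝ) × ((ℝ × ℝ) × ℝ)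

lemma aTheta (h : LW q0 w V U) :
    AnalyticAt ℝ (fun x : X3 => Theta w V U x.1 x.2.1 x.2.2) (q0, (q0, q0.1)) := by
  have hw1 : AnalyticAt ℝ (fun x : X3 => w (x.1.1, x.2.1.2)) (q0, (q0, q0.1)) :=
    AnalyticAt.fun_comp (g := w) (f := fun x : X3 => (x.1.1, x.2.1.2)) h.aw (an_of_cd (by fun_prop))
  have hw2 : AnalyticAt ℝ (fun x : X3 => w x.2.1) (q0, (q0, q0.1)) :=
    AnalyticAt.fun_comp (g := w) (f := fun x : X3 => x.2.1) h.aw (an_of_cd (by fun_prop))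
  have hw3 : AnalyticAt ℝ (fun x : X3 => w (x.2.1.1, x.1.2)) (q0, (q0, q0.1)) :=
    AnalyticAt.fun_comp (g := w) (f := fun x : X3 => (x.2.1.1, x.1.2)) h.aw (an_of_cd (by fun_prop))
  have hy : AnalyticAt ℝ (fun x : X3 => x.2.2) (q0, (q0, q0.1)) := an_of_cd (by fun_prop)
  have hV1 : AnalyticAt ℝ (fun x : X3 => V (x.2.2, w (x.1.1, x.2.1.2))) (q0, (q0, q0.1)) :=
    AnalyticAt.fun_comp (g := V) (f := fun x : X3 => (x.2.2, w (x.1.1, x.2.1.2))) h.aV (hy.prod hw1)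
  have hU1 : AnalyticAt ℝ (fun x : X3 => U (V (x.2.2, w (x.1.1, x.2.1.2)), w x.2.1)) (q0, (q0, q0.1)) := by
    refine AnalyticAt.fun_comp (g := U) (f := fun x : X3 => (V (x.2.2, w (x.1.1, x.2.1.2)), w x.2.1)) ?_ (hV1.prod hw2)
    simp only [Prod.mk.eta, h.V0]; exact h.aU
  refine AnalyticAt.fun_comp (g := V) (f := fun x : X3 => (U (V (x.2.2, w (x.1.1, x.2.1.2)), w x.2.1), w (x.2.1.1, x.1.2))) ?_ (hU1.prod hw3)
  simp only [Prod.mk.eta, h.V0, h.U0]; exact h.aV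

lemma ev_p {P : ℝ × ℝ → Prop} (h : ∀ᶠ q in 𝓝 q0, P q) :
    ∀ᶠ p : (ℝ × ℝ) × (ℝ × ℝ) in 𝓝 (q0, q0), P p.1 ∧ P p.2 ∧ P (p.1.1, p.2.2) ∧ P (p.2.1, p.1.2) := by
  have c1 : Filter.Tendsto (fun p : (ℝ × ℝ) × (ℝ × ℝ) => p.1) (𝓝 (q0, q0)) (𝓝 q0) := continuous_fst.tendsto _
  have c2 : Filter.Tendsto (fun p : (ℝ × ℝ) × (ℝ × ℝ) => p.2) (𝓝 (q0, q0)) (𝓝 q0) := continuous_snd.tendsto _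
  have c3 : Filter.Tendsto (fun p : (ℝ × ℝ) × (ℝ × ℝ) => (p.1.1, p.2.2)) (𝓝 (q0, q0)) (𝓝 q0) :=
    (by fun_prop : Continuous fun p : (ℝ × ℝ) × (ℝ × ℝ) => (p.1.1, p.2.2)).tendsto (q0, q0)
  have c4 : Filter.Tendsto (fun p : (ℝ × ℝ) × (ℝ × ℝ) => (p.2.1, p.1.2)) (𝓝 (q0, q0)) (𝓝 q0) :=
    (by fun_prop : Continuous fun p : (ℝ × ℝ) × (ℝ × ℝ) => (p.2.1, p.1.2)).tendsto (q0, q0)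
  filter_upwards [c1.eventually h, c2.eventually h, c3.eventually h, c4.eventually h] with p a b c d
  exact ⟨a, b, c, d⟩

lemma Theta0 (h : LW q0 w V U) : ∀ᶠ p : (ℝ × ℝ) × (ℝ × ℝ) in 𝓝 (q0, q0),
    Theta w V U p.1 p.2 p.1.1 = p.1.2 := by
  filter_upwards [ev_p h.Vw, ev_p h.Uw] with p h1 h2
  have e1 := h1.2.2.1
  have e2 := h2.2.1
  have e3 := h1.2.2.2
  simp only [Theta]
  rw [e1, e2, e3]

lemma dTheta (h : LW q0 w V U) : ∀ᶠ p : (ℝ × ℝ) × (ℝ × ℝ) in 𝓝 (q0, q0),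
    HasDerivAt (fun y => Theta w V U p.1 p.2 y) (MM (kap w V) p.1 p.2) p.1.1 := by
  filter_upwards [ev_p h.Vw, ev_p h.Uw, ev_p h.derivs] with p h1 h2 h3
  have e1 := h1.2.2.1
  have e2 := h2.2.1
  have e3 := h1.2.2.2
  have d1 := h3.2.2.1.1
  have d2 := h3.2.1.2.2
  have d3 := h3.2.2.2.1
  unfold Theta MM
  rw [← e1] at d2
  have d4 := HasDerivAt.comp p.1.1 d2 d1
  have d3' : HasDerivAt (fun y => V (y, w (p.2.1, p.1.2))) (kap w V (p.2.1, p.1.2))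
      (((fun z => U (z, w p.2)) ∘ fun y => V (y, w (p.1.1, p.2.2))) p.1.1) := by
    simp only [Function.comp, e1, e2]; exact d3
  have d5 := HasDerivAt.comp p.1.1 d3' d4
  have e : kap w V (p.1.1, p.2.2) * kap w V (p.2.1, p.1.2) / kap w V p.2 =
      kap w V (p.2.1, p.1.2) * ((kap w V p.2)⁻¹ * kap w V (p.1.1, p.2.2)) := by rw [div_eq_mul_inv]; ring
  rw [e]; exact d5
end LW

lemma aMM {q0 : ℝ × ℝ} {r : ℝ × ℝ → ℝ} (hr : AnalyticAt ℝ r q0) (h0 : r q0 ≠ 0) :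
    AnalyticAt ℝ (fun p : (ℝ × ℝ) × (ℝ × ℝ) => MM r p.1 p.2) (q0, q0) := by
  have h1 : AnalyticAt ℝ (fun p : (ℝ × ℝ) × (ℝ × ℝ) => r (p.1.1, p.2.2)) (q0, q0) :=
    AnalyticAt.fun_comp (g := r) (f := fun p : (ℝ × ℝ) × (ℝ × ℝ) => (p.1.1, p.2.2)) hr (an_of_cd (by fun_prop))
  have h2 : AnalyticAt ℝ (fun p : (ℝ × ℝ) × (ℝ × ℝ) => r (p.2.1, p.1.2)) (q0, q0) :=
    AnalyticAt.fun_comp (g := r) (f := fun p : (ℝ × ℝ) × (ℝ × ℝ) => (p.2.1, p.1.2)) hr (an_of_cd (by fun_prop))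
  have h3 : AnalyticAt ℝ (fun p : (ℝ × ℝ) × (ℝ × ℝ) => r p.2) (q0, q0) :=
    AnalyticAt.fun_comp (g := r) (f := fun p : (ℝ × ℝ) × (ℝ × ℝ) => p.2) hr (an_of_cd (by fun_prop))
  exact (h1.mul h2).div h3 h0

lemma aDmm {q0 : ℝ × ℝ} {r : ℝ × ℝ → ℝ} (hr : AnalyticAt ℝ r q0) (h0 : r q0 ≠ 0) (t : (ℝ × ℝ) × (ℝ × ℝ)) :
    AnalyticAt ℝ (fun p => Dmm r p t) (q0, q0) :=
  (ContinuousLinearMap.analyticAt (ContinuousLinearMap.apply ℝ ℝ t) _).fun_comp (aMM hr h0).fderiv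

lemma aJdet {q0 : ℝ × ℝ} {κ r : ℝ × ℝ → ℝ} (hr : AnalyticAt ℝ r q0) (h0 : r q0 ≠ 0)
    (hκ : AnalyticAt ℝ κ q0) (hκ0 : κ q0 ≠ 0) : AnalyticAt ℝ (Jdet κ r) (q0, q0) :=
  ((aDmm hκ hκ0 _).mul (aDmm hr h0 _)).sub ((aDmm hκ hκ0 _).mul (aDmm hr h0 _))

lemma mJdet (κ r : ℝ × ℝ → ℝ) : Measurable (Jdet κ r) := by
  have h1 : ∀ (s : ℝ × ℝ → ℝ) t, Measurable fun p => Dmm s p t := fun s t => measurable_fderiv_apply_const ℝ _ t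
  exact ((h1 _ _).mul (h1 _ _)).sub ((h1 _ _).mul (h1 _ _))

lemma ev_lipt {X Y : Type*} [NormedAddCommGroup X] [NormedSpace ℝ X] [NormedAddCommGroup Y] [NormedSpace ℝ Y]
    [CompleteSpace Y] {f : X → Y} {x0 : X} (hf : AnalyticAt ℝ f x0) :
    ∃ K : ℝ, 0 ≤ K ∧ ∃ t ∈ 𝓝 x0, ∀ x ∈ t, ∀ y ∈ t, ‖f x - f y‖ ≤ K * ‖x - y‖ := by
  obtain ⟨K, t, ht, h⟩ := (hf.contDiffAt (n := 1)).exists_lipschitzOnWith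
  refine ⟨K, K.2, t, ht, fun x hx y hy => ?_⟩
  have := h.dist_le_mul x hx y hy
  simpa [dist_eq_norm] using this

lemma mem_cb2 {X Y : Type*} [PseudoMetricSpace X] [PseudoMetricSpace Y] {x0 x : X} {y0 y : Y} {s : ℝ}
    (hx : x ∈ Metric.closedBall x0 s) (hy : y ∈ Metric.closedBall y0 s) :
    (x, y) ∈ Metric.closedBall (x0, y0) s := by
  rw [← closedBall_prod_same]; exact ⟨hx, hy⟩

lemma cb_prod (q0 : ℝ × ℝ) (s : ℝ) : Metric.closedBall q0.1 s ×ˢ Metric.closedBall q0.2 s = Metric.closedBall q0 s :=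
  closedBall_prod_same _ _ _

namespace LW
variable {q0 : ℝ × ℝ} {w V U : ℝ × ℝ → ℝ}

/-- the map (q,y) ↦ (y, w q) -/
lemma tq (h : LW q0 w V U) : Filter.Tendsto (fun x : (ℝ × ℝ) × ℝ => (x.2, w x.1)) (𝓝 (q0, q0.1)) (𝓝 (q0.1, w q0)) := by
  have : ContinuousAt (fun x : (ℝ × ℝ) × ℝ => (x.2, w x.1)) (q0, q0.1) :=
    continuous_snd.continuousAt.prodMk (ContinuousAt.comp (f := Prod.fst) (g := w) h.aw.continuousAt continuous_fst.continuousAt)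
  exact this

lemma tq2 (h : LW q0 w V U) : Filter.Tendsto (fun x : (ℝ × ℝ) × ℝ => (x.2, w x.1)) (𝓝 (q0, q0.2)) (𝓝 (q0.2, w q0)) := by
  have : ContinuousAt (fun x : (ℝ × ℝ) × ℝ => (x.2, w x.1)) (q0, q0.2) :=
    continuous_snd.continuousAt.prodMk (ContinuousAt.comp (f := Prod.fst) (g := w) h.aw.continuousAt continuous_fst.continuousAt)
  exact this

/-- (q,y) ↦ V (y, w q) is analytic -/
lemma aVq (h : LW q0 w V U) : AnalyticAt ℝ (fun x : (ℝ × ℝ) × ℝ => V (x.2, w x.1)) (q0, q0.1) :=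
  AnalyticAt.fun_comp (g := V) (f := fun x : (ℝ × ℝ) × ℝ => (x.2, w x.1)) h.aV
    (analyticAt_snd.prod (AnalyticAt.fun_comp (g := w) (f := Prod.fst) h.aw analyticAt_fst))

lemma tVq (h : LW q0 w V U) : Filter.Tendsto (fun x : (ℝ × ℝ) × ℝ => (V (x.2, w x.1), w x.1)) (𝓝 (q0, q0.1)) (𝓝 (q0.2, w q0)) := by
  have : ContinuousAt (fun x : (ℝ × ℝ) × ℝ => (V (x.2, w x.1), w x.1)) (q0, q0.1) :=
    h.aVq.continuousAt.prodMk (ContinuousAt.comp (f := Prod.fst) (g := w) h.aw.continuousAt continuous_fst.continuousAt)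
  have h2 := this.tendsto
  simp only [h.V0] at h2
  exact h2

/-- (q,y) ↦ A (y, V (y, w q)) is analytic -/
lemma aAq (h : LW q0 w V U) {A : ℝ × ℝ → ℝ} (hA : AnalyticAt ℝ A q0) :
    AnalyticAt ℝ (fun x : (ℝ × ℝ) × ℝ => A (x.2, V (x.2, w x.1))) (q0, q0.1) := by
  refine AnalyticAt.fun_comp (g := A) (f := fun x : (ℝ × ℝ) × ℝ => (x.2, V (x.2, w x.1))) ?_ (analyticAt_snd.prod h.aVq)
  simp only [h.V0]; exact hA

lemma evK {X : Type*} {S : ℝ → Set X} {a b : X → ℝ} (hb : ∀ x, 0 ≤ b x)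
    (h : ∃ K : ℝ, 0 ≤ K ∧ ∀ᶠ s in 𝓝[>] (0 : ℝ), ∀ x ∈ S s, a x ≤ K * b x) :
    ∀ᶠ K in Filter.atTop, ∀ᶠ s in 𝓝[>] (0 : ℝ), ∀ x ∈ S s, a x ≤ K * b x := by
  obtain ⟨K0, _, h⟩ := h
  filter_upwards [Filter.eventually_ge_atTop K0] with K hK
  filter_upwards [h] with s hs x hx
  exact (hs x hx).trans (mul_le_mul_of_nonneg_right hK (hb x))

lemma eAL (h : LW q0 w V U) {A : ℝ × ℝ → ℝ} (hA : AnalyticAt ℝ A q0) :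
    ∀ᶠ K in Filter.atTop, ∀ᶠ s in 𝓝[>] (0 : ℝ), ∀ u ∈ Metric.closedBall q0.1 s, ∀ v ∈ Metric.closedBall q0.2 s,
      ∀ y ∈ Metric.closedBall q0.1 s, |A (y, V (y, w (u, v))) - A (u, v)| ≤ K * |y - u| := by
  obtain ⟨K0, _, h1⟩ := ev_lip (h.aAq hA)
  filter_upwards [Filter.eventually_ge_atTop K0] with K hK
  filter_upwards [h1, ev_closedBall h.Vw] with s hs h2 u hu v hv y hy
  have := hs ((u, v), y) (mem_cb2 (mem_cb2 hu hv) hy) ((u, v), u) (mem_cb2 (mem_cb2 hu hv) hu)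
  have e := h2 (u, v) (mem_cb2 hu hv)
  simp only at e this
  rw [e] at this
  simp only [Prod.mk_sub_mk, sub_self, Prod.norm_mk, norm_zero, Real.norm_eq_abs] at this
  refine this.trans ?_
  rw [max_eq_right (abs_nonneg _)]
  gcongr

lemma eA2 (h : LW q0 w V U) {A : ℝ × ℝ → ℝ} (hA : AnalyticAt ℝ A q0) :
    ∃ A' : ℝ × ℝ → ℝ, ∀ᶠ K in Filter.atTop, ∀ᶠ s in 𝓝[>] (0 : ℝ), ∀ u ∈ Metric.closedBall q0.1 s, ∀ v ∈ Metric.closedBall q0.2 s,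
      ∀ y ∈ Metric.closedBall q0.1 s, |A (y, V (y, w (u, v))) - A (u, v) - (y - u) * A' (u, v)| ≤ K * |y - u| ^ 2 := by
  obtain ⟨K0, _, h1⟩ := ev_taylor (h.aAq hA)
  refine ⟨fun q => fderiv ℝ (fun x : (ℝ × ℝ) × ℝ => A (x.2, V (x.2, w x.1))) (q, q.1) (0, 1), ?_⟩
  filter_upwards [Filter.eventually_ge_atTop K0] with K hK
  filter_upwards [h1, ev_closedBall h.Vw] with s hs h2 u hu v hv y hy
  have := hs ((u, v), y) (mem_cb2 (mem_cb2 hu hv) hy) ((u, v), u) (mem_cb2 (mem_cb2 hu hv) hu)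
    ((u, v), u) (mem_cb2 (mem_cb2 hu hv) hu) |y - u| 
  have e := h2 (u, v) (mem_cb2 hu hv)
  simp only at e this
  rw [e] at this
  have e3 : (((u, v), y) : (ℝ × ℝ) × ℝ) - ((u, v), u) = (y - u) • (((0, 0), 1) : (ℝ × ℝ) × ℝ) := by
    ext <;> simp
  rw [e3, map_smul] at this
  have e4 : ‖(y - u) • (((0, 0), 1) : (ℝ × ℝ) × ℝ)‖ = |y - u| := by
    rw [norm_smul]; simp
  rw [e4] at this
  simp only [sub_self, norm_zero, Real.norm_eq_abs, smul_eq_mul, le_refl, abs_nonneg, true_imp_iff] at this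
  refine this.trans ?_
  rw [mul_assoc, ← pow_two]
  gcongr

lemma eV2 (h : LW q0 w V U) :
    ∀ᶠ K in Filter.atTop, ∀ᶠ s in 𝓝[>] (0 : ℝ), ∀ u ∈ Metric.closedBall q0.1 s, ∀ v ∈ Metric.closedBall q0.2 s,
      ∀ y ∈ Metric.closedBall q0.1 s, |V (y, w (u, v)) - v - kap w V (u, v) * (y - u)| ≤ K * |y - u| ^ 2 := by
  obtain ⟨K0, _, h1⟩ := ev_taylor h.aVq
  filter_upwards [Filter.eventually_ge_atTop K0] with K hK
  filter_upwards [h1, ev_closedBall h.Vw, ev_closedBall h.derivs, ev_closedBall h.aVq.eventually_analyticAt]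
    with s hs h2 h3 h4 u hu v hv y hy
  have := hs ((u, v), y) (mem_cb2 (mem_cb2 hu hv) hy) ((u, v), u) (mem_cb2 (mem_cb2 hu hv) hu)
    ((u, v), u) (mem_cb2 (mem_cb2 hu hv) hu) |y - u| 
  have e := h2 (u, v) (mem_cb2 hu hv)
  have d := (h3 (u, v) (mem_cb2 hu hv)).1
  have d2 := (h4 ((u, v), u) (mem_cb2 (mem_cb2 hu hv) hu)).differentiableAt.hasFDerivAt
  have d3 := HasFDerivAt.comp_hasDerivAt (f := fun y : ℝ => (((u, v) : ℝ × ℝ), y)) u d2 ((hasDerivAt_const _ _).prodMk (hasDerivAt_id _))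
  have e5 := d3.unique d
  simp only at e this
  rw [e] at this
  have e3 : (((u, v), y) : (ℝ × ℝ) × ℝ) - ((u, v), u) = (y - u) • ((0, 1) : (ℝ × ℝ) × ℝ) := by
    ext <;> simp
  rw [e3, map_smul, e5] at this
  have e4 : ‖(y - u) • ((0, 1) : (ℝ × ℝ) × ℝ)‖ = |y - u| := by
    rw [norm_smul]; simp
  rw [e4] at this
  simp only [sub_self, norm_zero, Real.norm_eq_abs, smul_eq_mul, le_refl, abs_nonneg, true_imp_iff] at this
  rw [mul_comm (kap w V (u, v))]
  refine this.trans ?_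
  rw [mul_assoc, ← pow_two]
  gcongr

lemma eub {A : ℝ × ℝ → ℝ} (hA : ContinuousAt A q0) :
    ∀ᶠ K in Filter.atTop, ∀ᶠ s in 𝓝[>] (0 : ℝ), ∀ u ∈ Metric.closedBall q0.1 s, ∀ v ∈ Metric.closedBall q0.2 s,
      |A (u, v)| ≤ K := by
  obtain ⟨K0, _, h1⟩ := ev_bdd hA
  filter_upwards [Filter.eventually_ge_atTop K0] with K hK
  filter_upwards [h1] with s hs u hu v hv
  exact (hs _ (mem_cb2 hu hv)).trans hK

lemma elb {A : ℝ × ℝ → ℝ} (hA : ContinuousAt A q0) (h0 : A q0 ≠ 0) :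
    ∀ᶠ K in Filter.atTop, ∀ᶠ s in 𝓝[>] (0 : ℝ), ∀ u ∈ Metric.closedBall q0.1 s, ∀ v ∈ Metric.closedBall q0.2 s,
      1 ≤ K * |A (u, v)| := by
  obtain ⟨K0, _, h1⟩ := ev_lb hA h0
  filter_upwards [Filter.eventually_ge_atTop K0] with K hK
  filter_upwards [h1] with s hs u hu v hv
  exact (hs _ (mem_cb2 hu hv)).trans (mul_le_mul_of_nonneg_right hK (norm_nonneg _))

lemma eVlip (h : LW q0 w V U) :
    ∀ᶠ K in Filter.atTop, ∀ᶠ s in 𝓝[>] (0 : ℝ), ∀ u ∈ Metric.closedBall q0.1 s, ∀ v ∈ Metric.closedBall q0.2 s,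
      ∀ y ∈ Metric.closedBall q0.1 s, ∀ y' ∈ Metric.closedBall q0.1 s, |V (y, w (u, v)) - V (y', w (u, v))| ≤ K * |y - y'| := by
  obtain ⟨K0, _, h1⟩ := ev_lip h.aVq
  filter_upwards [Filter.eventually_ge_atTop K0] with K hK
  filter_upwards [h1] with s hs u hu v hv y hy y' hy'
  have := hs ((u, v), y) (mem_cb2 (mem_cb2 hu hv) hy) ((u, v), y') (mem_cb2 (mem_cb2 hu hv) hy')
  simp only [Prod.mk_sub_mk, sub_self, Prod.norm_mk, norm_zero, Real.norm_eq_abs] at this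
  refine this.trans ?_
  rw [max_eq_right (abs_nonneg _)]
  gcongr

lemma eVanti (h : LW q0 w V U) :
    ∀ᶠ K in Filter.atTop, ∀ᶠ s in 𝓝[>] (0 : ℝ), ∀ u ∈ Metric.closedBall q0.1 s, ∀ v ∈ Metric.closedBall q0.2 s,
      ∀ y ∈ Metric.closedBall q0.1 s, ∀ y' ∈ Metric.closedBall q0.1 s, |y - y'| ≤ K * |V (y, w (u, v)) - V (y', w (u, v))| := by
  obtain ⟨K0, _, t, ht, h1⟩ := ev_lipt h.aU
  filter_upwards [Filter.eventually_ge_atTop K0] with K hK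
  filter_upwards [ev_closedBall (h.tVq.eventually ht), ev_closedBall (h.tq.eventually h.UV)] with s hs h2 u hu v hv y hy y' hy'
  have m1 := mem_cb2 (mem_cb2 hu hv) hy
  have m2 := mem_cb2 (mem_cb2 hu hv) hy'
  have := h1 _ (hs _ m1) _ (hs _ m2)
  have e1 := h2 _ m1
  have e2 := h2 _ m2
  simp only at e1 e2 this
  rw [e1, e2] at this
  simp only [Prod.mk_sub_mk, sub_self, Prod.norm_mk, norm_zero, Real.norm_eq_abs] at this
  refine this.trans ?_
  rw [max_eq_left (abs_nonneg _)]
  gcongr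

lemma ewanti (h : LW q0 w V U) :
    ∀ᶠ K in Filter.atTop, ∀ᶠ s in 𝓝[>] (0 : ℝ), ∀ u ∈ Metric.closedBall q0.1 s, ∀ v ∈ Metric.closedBall q0.2 s,
      ∀ v' ∈ Metric.closedBall q0.2 s, |v - v'| ≤ K * |w (u, v) - w (u, v')| := by
  obtain ⟨K0, _, t, ht, h1⟩ := ev_lipt h.aV
  filter_upwards [Filter.eventually_ge_atTop K0] with K hK
  filter_upwards [ev_closedBall (h.tend1.eventually ht), ev_closedBall h.Vw] with s hs h2 u hu v hv v' hv'
  have m1 := mem_cb2 hu hv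
  have m2 := mem_cb2 hu hv'
  have := h1 _ (hs _ m1) _ (hs _ m2)
  have e1 := h2 _ m1
  have e2 := h2 _ m2
  simp only at e1 e2 this
  rw [e1, e2] at this
  simp only [Prod.mk_sub_mk, sub_self, Prod.norm_mk, norm_zero, Real.norm_eq_abs] at this
  refine this.trans ?_
  rw [max_eq_right (abs_nonneg _)]
  gcongr

lemma eGeoW (h : LW q0 w V U) : ∀ᶠ K in Filter.atTop, ∀ᶠ s in 𝓝[>] (0 : ℝ),
    GeoW (Metric.closedBall q0.1 s) (Metric.closedBall q0.2 s) w V K := by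
  have hr : ∀ᶠ q in 𝓝 q0, w q ∈ Metric.closedBall (w q0) (1 / 2) :=
    h.aw.continuousAt.tendsto.eventually (Metric.closedBall_mem_nhds _ (by norm_num))
  filter_upwards [h.ewanti] with K h1
  filter_upwards [h1, ev_closedBall hr, ev_closedBall (h.tq.eventually h.wV)] with s h1 h2 h3
  refine ⟨h1, ⟨w q0 - 1 / 2, fun u hu v hv => ?_⟩, fun u hu v hv y hy => ?_⟩
  · have := h2 _ (mem_cb2 hu hv)
    rw [Real.closedBall_eq_Icc] at this
    constructor <;> linarith [this.1, this.2]
  · exact h3 _ (mem_cb2 (mem_cb2 hu hv) hy)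

lemma eGeoA (h : LW q0 w V U) {A B : ℝ × ℝ → ℝ} (hA : AnalyticAt ℝ A q0) (hB : AnalyticAt ℝ B q0) (hB0 : B q0 ≠ 0) :
    ∀ᶠ K in Filter.atTop, ∀ᶠ s in 𝓝[>] (0 : ℝ),
    GeoA (Metric.closedBall q0.1 s) (Metric.closedBall q0.2 s) w V A B K := by
  filter_upwards [eub hA.continuousAt, eub hB.continuousAt, elb hB.continuousAt hB0, h.eAL hA, h.eAL hB] with K h1 h2 h3 h4 h5
  filter_upwards [h1, h2, h3, h4, h5] with s h1 h2 h3 h4 h5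
  exact ⟨h1, h2, h3, fun u hu v hv y hy _ => h4 u hu v hv y hy, fun u hu v hv y hy _ => h5 u hu v hv y hy⟩

lemma eGeoB (h : LW q0 w V U) {A B : ℝ × ℝ → ℝ} (hA : AnalyticAt ℝ A q0) (hB : AnalyticAt ℝ B q0) :
    ∀ᶠ K in Filter.atTop, ∀ᶠ s in 𝓝[>] (0 : ℝ),
    GeoB (Metric.closedBall q0.1 s) (Metric.closedBall q0.2 s) w V A B (kap w V) K := by
  obtain ⟨A', hA'⟩ := h.eA2 hA
  obtain ⟨B', hB'⟩ := h.eA2 hB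
  filter_upwards [eub h.akap.continuousAt, hA', hB', h.eV2] with K h1 h2 h3 h4
  filter_upwards [h1, h2, h3, h4] with s h1 h2 h3 h4
  exact ⟨⟨A', fun u hu v hv y hy _ => h2 u hu v hv y hy⟩, ⟨B', fun u hu v hv y hy _ => h3 u hu v hv y hy⟩,
    fun u hu v hv y hy _ => h4 u hu v hv y hy, h1⟩
end LW

/-- Cramer -/
lemma cramer_bound (k1 k2 r1 r2 s t X Y m j N M K3 : ℝ) (hk1 : |k1| ≤ K3) (hk2 : |k2| ≤ K3) (hr1 : |r1| ≤ K3) (hr2 : |r2| ≤ K3)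
    (hX : |X - (s * k1 + t * k2)| ≤ N * m * max |s| |t|) (hY : |Y - (s * r1 + t * r2)| ≤ N * m * max |s| |t|)
    (hj : j ≤ |k1 * r2 - k2 * r1|) (hM : M = max |X| |Y|) (hsmall : 4 * K3 * N * m ≤ j) (hj0 : 0 < j) :
    j * max |s| |t| ≤ 4 * K3 * M := by
  have h0 : 0 ≤ max |s| |t| := le_max_of_le_left (abs_nonneg _)
  have hK3 : 0 ≤ K3 := (abs_nonneg _).trans hk1
  have hXM : |X| ≤ M := hM ▸ le_max_left _ _
  have hYM : |Y| ≤ M := hM ▸ le_max_right _ _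
  have hP : |s * k1 + t * k2| ≤ M + N * m * max |s| |t| := by
    have : s * k1 + t * k2 = X - (X - (s * k1 + t * k2)) := by ring
    rw [this]; exact (abs_sub _ _).trans (by linarith)
  have hR : |s * r1 + t * r2| ≤ M + N * m * max |s| |t| := by
    have : s * r1 + t * r2 = Y - (Y - (s * r1 + t * r2)) := by ring
    rw [this]; exact (abs_sub _ _).trans (by linarith)
  have e1 : |k1 * r2 - k2 * r1| * |s| ≤ 2 * K3 * (M + N * m * max |s| |t|) := by
    rw [← abs_mul, show (k1 * r2 - k2 * r1) * s = r2 * (s * k1 + t * k2) - k2 * (s * r1 + t * r2) by ring]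
    refine (abs_sub _ _).trans ?_
    have := abs_mul_le' hr2 hP
    have := abs_mul_le' hk2 hR
    linarith
  have e2 : |k1 * r2 - k2 * r1| * |t| ≤ 2 * K3 * (M + N * m * max |s| |t|) := by
    rw [← abs_mul, show (k1 * r2 - k2 * r1) * t = k1 * (s * r1 + t * r2) - r1 * (s * k1 + t * k2) by ring]
    refine (abs_sub _ _).trans ?_
    have := abs_mul_le' hr1 hP
    have := abs_mul_le' hk1 hR
    linarith
  have e3 : |k1 * r2 - k2 * r1| * max |s| |t| ≤ 2 * K3 * (M + N * m * max |s| |t|) := by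
    rcases le_total |s| |t| with h | h
    · have e := max_eq_right h
      calc _ = |k1 * r2 - k2 * r1| * |t| := by rw [e]
        _ ≤ _ := e2
    · have e := max_eq_left h
      calc _ = |k1 * r2 - k2 * r1| * |s| := by rw [e]
        _ ≤ _ := e1
  have e4 : j * max |s| |t| ≤ |k1 * r2 - k2 * r1| * max |s| |t| := mul_le_mul_of_nonneg_right hj h0
  have e5 : 4 * K3 * N * m * max |s| |t| ≤ j * max |s| |t| := mul_le_mul_of_nonneg_right hsmall h0
  nlinarith

namespace LW
variable {q0 : ℝ × ℝ} {w V U : ℝ × ℝ → ℝ}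

lemma eh6a (h : LW q0 w V U) : ∀ᶠ K in Filter.atTop, ∀ᶠ s in 𝓝[>] (0 : ℝ), 
    ∀ α ∈ Metric.closedBall q0 s, ∀ β ∈ Metric.closedBall q0 s, ∀ y ∈ Metric.closedBall q0.1 s,
      |Theta w V U α β y - α.2| ≤ K * |y - α.1| := by
  obtain ⟨K0, _, h1⟩ := ev_lip h.aTheta
  filter_upwards [Filter.eventually_ge_atTop K0] with K hK
  filter_upwards [h1, ev_closedBall h.Theta0] with s hs h2 α hα β hβ y hy
  have hα1 : α.1 ∈ Metric.closedBall q0.1 s := by rw [← cb_prod] at hα; exact hα.1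
  have := hs (α, (β, y)) (mem_cb2 hα (mem_cb2 hβ hy)) (α, (β, α.1)) (mem_cb2 hα (mem_cb2 hβ hα1))
  have e := h2 (α, β) (mem_cb2 hα hβ)
  simp only at e this
  rw [e] at this
  simp only [Prod.mk_sub_mk, sub_self, Prod.norm_mk, norm_zero, Real.norm_eq_abs] at this
  refine this.trans ?_
  simp only [abs_nonneg, max_eq_right]
  gcongr

lemma eh6b (h : LW q0 w V U) : ∀ᶠ K in Filter.atTop, ∀ᶠ s in 𝓝[>] (0 : ℝ), 
    ∀ α ∈ Metric.closedBall q0 s, ∀ β ∈ Metric.closedBall q0 s, ∀ y ∈ Metric.closedBall q0.1 s, ∀ y' ∈ Metric.closedBall q0.1 s,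
      y ≠ α.1 → ∀ d : ℝ, |y - α.1| ≤ d → |y' - α.1| ≤ d →
    |Theta w V U α β y' - (α.2 + (y' - α.1) * ((Theta w V U α β y - α.2) / (y - α.1)))| ≤ K * d ^ 2 := by
  obtain ⟨K0, hK0, h1⟩ := ev_taylor h.aTheta
  filter_upwards [Filter.eventually_ge_atTop (2 * K0)] with K hK
  filter_upwards [h1, ev_closedBall h.Theta0] with s hs h2 α hα β hβ y hy y' hy' hne d hd hd'
  have hα1 : α.1 ∈ Metric.closedBall q0.1 s := by rw [← cb_prod] at hα; exact hα.1
  have mz := mem_cb2 hα (mem_cb2 hβ hα1)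
  obtain ⟨D, hD⟩ : ∃ D : ℝ, D = fderiv ℝ (fun x : X3 => Theta w V U x.1 x.2.1 x.2.2) (α, (β, α.1)) (0, (0, 1)) := ⟨_, rfl⟩
  have key : ∀ y ∈ Metric.closedBall q0.1 s, |Theta w V U α β y - α.2 - (y - α.1) * D| ≤ K0 * |y - α.1| * |y - α.1| := by
    intro y hy
    have := hs (α, (β, y)) (mem_cb2 hα (mem_cb2 hβ hy)) (α, (β, α.1)) mz (α, (β, α.1)) mz |y - α.1|
    have e := h2 (α, β) (mem_cb2 hα hβ)
    simp only at e this
    have e3 : ((α, (β, y)) : X3) - (α, (β, α.1)) = (y - α.1) • ((0, (0, 1)) : X3) := by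
      ext <;> simp
    have e4 : ‖(y - α.1) • ((0, (0, 1)) : X3)‖ = |y - α.1| := by
      rw [norm_smul]; simp
    rw [e, e3, map_smul, ← hD, e4] at this
    simp only [sub_self, norm_zero, Real.norm_eq_abs, smul_eq_mul, le_refl, abs_nonneg, true_imp_iff] at this
    exact this
  have k1 := key y hy
  have k2 := key y' hy'
  have hp : 0 < |y - α.1| := abs_pos.2 (sub_ne_zero.2 hne)
  have k3 : |(Theta w V U α β y - α.2) / (y - α.1) - D| ≤ K0 * d := by
    have : (Theta w V U α β y - α.2) / (y - α.1) - D = (Theta w V U α β y - α.2 - (y - α.1) * D) / (y - α.1) := by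
      field_simp [sub_ne_zero.2 hne]
    rw [this, abs_div, div_le_iff₀ hp]
    refine k1.trans ?_
    gcongr
  have hd0 : 0 ≤ d := (abs_nonneg _).trans hd
  have : Theta w V U α β y' - (α.2 + (y' - α.1) * ((Theta w V U α β y - α.2) / (y - α.1))) =
    (Theta w V U α β y' - α.2 - (y' - α.1) * D) - (y' - α.1) * ((Theta w V U α β y - α.2) / (y - α.1) - D) := by ring
  rw [this]
  refine (abs_sub _ _).trans ?_
  have k4 := abs_mul_le' hd' k3
  have k5 : K0 * |y' - α.1| * |y' - α.1| ≤ K0 * d * d := by gcongr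
  nlinarith [sq_nonneg d]

/-- derivative of Theta in y -/
def GG (w V U : ℝ × ℝ → ℝ) (x : X3) : ℝ := fderiv ℝ (fun x : X3 => Theta w V U x.1 x.2.1 x.2.2) x (0, (0, 1))

lemma aGG (h : LW q0 w V U) : AnalyticAt ℝ (GG w V U) (q0, (q0, q0.1)) :=
  (ContinuousLinearMap.analyticAt (ContinuousLinearMap.apply ℝ ℝ ((0, (0, 1)) : X3)) _).fun_comp h.aTheta.fderiv

def Lz : (ℝ × ℝ) × (ℝ × ℝ) →L[ℝ] X3 :=
  (ContinuousLinearMap.fst ℝ (ℝ × ℝ) (ℝ × ℝ)).prod ((ContinuousLinearMap.snd ℝ (ℝ × ℝ) (ℝ × ℝ)).prod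
    ((ContinuousLinearMap.fst ℝ ℝ ℝ).comp (ContinuousLinearMap.fst ℝ (ℝ × ℝ) (ℝ × ℝ))))

lemma Lz_apply (p : (ℝ × ℝ) × (ℝ × ℝ)) : Lz p = (p.1, (p.2, p.1.1)) := rfl

lemma dGG1 (h : LW q0 w V U) : ∀ᶠ x in 𝓝 ((q0, (q0, q0.1)) : X3), HasDerivAt (fun y => Theta w V U x.1 x.2.1 y) (GG w V U x) x.2.2 := by
  filter_upwards [h.aTheta.eventually_analyticAt] with x hx
  have d2 := hx.differentiableAt.hasFDerivAt
  exact HasFDerivAt.comp_hasDerivAt (f := fun y : ℝ => ((x.1, (x.2.1, y)) : X3)) x.2.2 d2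
    ((hasDerivAt_const _ _).prodMk ((hasDerivAt_const _ _).prodMk (hasDerivAt_id _)))

lemma dGG2 (h : LW q0 w V U) : ∀ᶠ p : (ℝ × ℝ) × (ℝ × ℝ) in 𝓝 (q0, q0), ∀ b : ℝ × ℝ,
    fderiv ℝ (GG w V U) (p.1, (p.2, p.1.1)) (0, (b, 0)) = Dmm (kap w V) p (0, b) := by
  have t : Filter.Tendsto Lz (𝓝 (q0, q0)) (𝓝 (q0, (q0, q0.1))) := Lz.continuous.tendsto (q0, q0)
  have e1 : ∀ᶠ p : (ℝ × ℝ) × (ℝ × ℝ) in 𝓝 (q0, q0), GG w V U (Lz p) = MM (kap w V) p.1 p.2 := by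
    filter_upwards [t.eventually h.dGG1, h.dTheta] with p h1 h2
    exact h1.unique h2
  filter_upwards [e1.eventually_nhds, t.eventually h.aGG.eventually_analyticAt] with p h1 h2 b
  have d1 := (h2.differentiableAt.hasFDerivAt).comp p Lz.hasFDerivAt
  have d2 : fderiv ℝ (fun p => GG w V U (Lz p)) p = Dmm (kap w V) p := Filter.EventuallyEq.fderiv_eq h1
  have d3 := d1.fderiv
  have : fderiv ℝ (fun p => GG w V U (Lz p)) p (0, b) = fderiv ℝ (GG w V U) (p.1, (p.2, p.1.1)) (0, (b, 0)) := by
    have e := congrArg (fun L => L (0, b)) d3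
    exact e
  rw [← d2, this]

lemma eh5 (h : LW q0 w V U) {r : ℝ × ℝ → ℝ} (hr : AnalyticAt ℝ r q0) (hr0 : r q0 ≠ 0) :
    ∀ᶠ K in Filter.atTop, ∀ᶠ s in 𝓝[>] (0 : ℝ), 
    ∀ α ∈ Metric.closedBall q0 s, ∀ β ∈ Metric.closedBall q0 s, ∀ β' ∈ Metric.closedBall q0 s, ∀ β₀ ∈ Metric.closedBall q0 s,
    ∀ y ∈ Metric.closedBall q0.1 s, y ≠ α.1 → ∀ j : ℝ, 0 < j → j ≤ 1 →
    K * |y - α.1| ≤ j → K * dist β β₀ ≤ j → K * dist β' β₀ ≤ j → j ≤ |Jdet (kap w V) r (α, β₀)| →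
    j * dist β β' ≤ K * max |(Theta w V U α β y - Theta w V U α β' y) / (y - α.1)| |MM r α β - MM r α β'| := by
  obtain ⟨K1, hK1, T1⟩ := ev_taylor h.aGG
  obtain ⟨K2, hK2, T2⟩ := ev_taylor (aMM hr hr0)
  obtain ⟨C1, hC1, B1⟩ := ev_bdd (aDmm h.akap h.kap0 (0, (1, 0))).continuousAt
  obtain ⟨C2, hC2, B2⟩ := ev_bdd (aDmm h.akap h.kap0 (0, (0, 1))).continuousAt
  obtain ⟨C3, hC3, B3⟩ := ev_bdd (aDmm hr hr0 (0, (1, 0))).continuousAt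
  obtain ⟨C4, hC4, B4⟩ := ev_bdd (aDmm hr hr0 (0, (0, 1))).continuousAt
  obtain ⟨K3, hK3⟩ : ∃ K3, K3 = C1 + C2 + C3 + C4 := ⟨_, rfl⟩
  have hK3p : 0 ≤ K3 := by rw [hK3]; positivity
  filter_upwards [Filter.eventually_gt_atTop (4 * K3), Filter.eventually_ge_atTop (4 * K3 * (K1 + K2))] with K hKa hKb
  filter_upwards [T1, T2, B1, B2, B3, B4, ev_closedBall h.dGG2, ev_closedBall h.dGG1, ev_closedBall h.Theta0] with
    s T1 T2 B1 B2 B3 B4 D2 D1 Th0 α hα β hβ β' hβ' β₀ hβ₀ y hy hne j hj hj1 hy1 hd1 hd2 hJ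
  have hKpos : 0 < K := lt_of_le_of_lt (by positivity) hKa
  have hα1 : α.1 ∈ Metric.closedBall q0.1 s := by rw [← cb_prod] at hα; exact hα.1
  have hm0 : 0 ≤ j / K := by positivity
  have g1 : |y - α.1| ≤ j / K := by rw [le_div_iff₀ hKpos]; linarith
  have g2 : ‖β - β₀‖ ≤ j / K := by rw [le_div_iff₀ hKpos, ← dist_eq_norm]; linarith
  have g3 : ‖β' - β₀‖ ≤ j / K := by rw [le_div_iff₀ hKpos, ← dist_eq_norm]; linarith
  have pz := mem_cb2 hα hβ₀
  have hb : dist β β' = max |(β - β').1| |(β - β').2| := by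
    rw [dist_eq_norm, Prod.norm_def]; rfl
  have hlin : ∀ L : (ℝ × ℝ) × (ℝ × ℝ) →L[ℝ] ℝ, ∀ b : ℝ × ℝ, L (0, b) = b.1 * L (0, (1, 0)) + b.2 * L (0, (0, 1)) := by
    intro L b
    have : ((0, b) : (ℝ × ℝ) × (ℝ × ℝ)) = b.1 • (0, (1, 0)) + b.2 • (0, (0, 1)) := by ext <;> simp
    rw [this, map_add, map_smul, map_smul]; rfl
  have X1 : |(Theta w V U α β y - Theta w V U α β' y) / (y - α.1) - Dmm (kap w V) (α, β₀) (0, β - β')|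
      ≤ K1 * (j / K) * dist β β' := by
    have hseg : ∀ ξ ∈ uIcc α.1 y, ξ ∈ Metric.closedBall q0.1 s := by
      intro ξ hξ
      rw [Real.closedBall_eq_Icc] at hα1 hy ⊢
      exact (ordConnected_Icc.uIcc_subset hα1 hy) hξ
    have hder : ∀ ξ ∈ uIcc α.1 y, HasDerivWithinAt (fun y => Theta w V U α β y - Theta w V U α β' y - y * Dmm (kap w V) (α, β₀) (0, β - β'))
        (GG w V U (α, (β, ξ)) - GG w V U (α, (β', ξ)) - Dmm (kap w V) (α, β₀) (0, β - β')) (uIcc α.1 y) ξ := by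
      intro ξ hξ
      have a := D1 (α, (β, ξ)) (mem_cb2 hα (mem_cb2 hβ (hseg ξ hξ)))
      have b := D1 (α, (β', ξ)) (mem_cb2 hα (mem_cb2 hβ' (hseg ξ hξ)))
      have c := (hasDerivAt_id ξ).mul_const (Dmm (kap w V) (α, β₀) (0, β - β'))
      rw [one_mul] at c
      exact ((a.sub b).sub c).hasDerivWithinAt
    have hbd : ∀ ξ ∈ uIcc α.1 y, ‖GG w V U (α, (β, ξ)) - GG w V U (α, (β', ξ)) - Dmm (kap w V) (α, β₀) (0, β - β')‖ ≤
        K1 * (j / K) * dist β β' := by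
      intro ξ hξ
      have hξy : |ξ - α.1| ≤ j / K := (abs_sub_left_of_mem_uIcc hξ).trans g1
      have := T1 (α, (β, ξ)) (mem_cb2 hα (mem_cb2 hβ (hseg ξ hξ))) (α, (β', ξ)) (mem_cb2 hα (mem_cb2 hβ' (hseg ξ hξ)))
        (α, (β₀, α.1)) (mem_cb2 hα (mem_cb2 hβ₀ hα1)) (j / K)
      have e := D2 (α, β₀) pz (β - β')
      simp only [Prod.mk_sub_mk, sub_self, Prod.norm_mk, norm_zero, Real.norm_eq_abs] at this e ⊢
      have h3 := this (max_le hm0 (max_le g2 hξy)) (max_le hm0 (max_le g3 hξy))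
      rw [e] at h3
      refine h3.trans_eq ?_
      rw [dist_eq_norm]
      congr 1
      simp
    have := (convex_uIcc α.1 y).norm_image_sub_le_of_norm_hasDerivWithin_le hder hbd left_mem_uIcc right_mem_uIcc
    have t1 := Th0 (α, β) (mem_cb2 hα hβ)
    have t2 := Th0 (α, β') (mem_cb2 hα hβ')
    simp only at t1 t2 this
    rw [t1, t2] at this
    have hp : 0 < |y - α.1| := abs_pos.2 (sub_ne_zero.2 hne)
    have e6 : (Theta w V U α β y - Theta w V U α β' y) / (y - α.1) - Dmm (kap w V) (α, β₀) (0, β - β') =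
      (Theta w V U α β y - Theta w V U α β' y - y * Dmm (kap w V) (α, β₀) (0, β - β') -
        (α.2 - α.2 - α.1 * Dmm (kap w V) (α, β₀) (0, β - β'))) / (y - α.1) := by
      field_simp [sub_ne_zero.2 hne]; ring
    rw [e6, abs_div, div_le_iff₀ hp]
    exact this
  have Y1 : |MM r α β - MM r α β' - Dmm r (α, β₀) (0, β - β')| ≤ K2 * (j / K) * dist β β' := by
    have := T2 (α, β) (mem_cb2 hα hβ) (α, β') (mem_cb2 hα hβ') (α, β₀) pz (j / K)
    simp only [Prod.mk_sub_mk, sub_self, Prod.norm_mk, norm_zero, Real.norm_eq_abs] at this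
    have h3 := this (max_le hm0 g2) (max_le hm0 g3)
    refine h3.trans_eq ?_
    rw [dist_eq_norm]
    congr 1
    simp
  rw [hlin] at X1 Y1
  rw [hb] at X1 Y1 ⊢
  have n0 : 0 ≤ (j / K) * max |(β - β').1| |(β - β').2| := mul_nonneg hm0 (le_max_of_le_left (abs_nonneg _))
  have := cramer_bound (Dmm (kap w V) (α, β₀) (0, (1, 0))) (Dmm (kap w V) (α, β₀) (0, (0, 1)))
    (Dmm r (α, β₀) (0, (1, 0))) (Dmm r (α, β₀) (0, (0, 1))) (β - β').1 (β - β').2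
    ((Theta w V U α β y - Theta w V U α β' y) / (y - α.1)) (MM r α β - MM r α β') (j / K) j (K1 + K2) _ K3
    ((B1 _ pz).trans (by linarith)) ((B2 _ pz).trans (by linarith)) ((B3 _ pz).trans (by linarith))
    ((B4 _ pz).trans (by linarith)) (X1.trans (by nlinarith)) (Y1.trans (by nlinarith)) hJ rfl ?_ hj
  · refine this.trans (mul_le_mul_of_nonneg_right hKa.le (le_max_of_le_left (abs_nonneg _)))
  · rw [mul_div_assoc', div_le_iff₀ hKpos]; nlinarith

lemma eh7 (h : LW q0 w V U) {r : ℝ × ℝ → ℝ} (hr : AnalyticAt ℝ r q0) (hr0 : r q0 ≠ 0)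
    (hnd : ¬ ∀ᶠ p in 𝓝 (q0, q0), Jdet (kap w V) r p = 0) : ∃ c : ℝ, 0 < c ∧ c ≤ 1 ∧
    ∀ᶠ K in Filter.atTop, ∀ᶠ s in 𝓝[>] (0 : ℝ), ∀ j : ℝ, 0 < j → j ≤ 1 →
      volume {p : (ℝ × ℝ) × (ℝ × ℝ) | p.1 ∈ Metric.closedBall q0 s ∧ p.2 ∈ Metric.closedBall q0 s ∧
        |Jdet (kap w V) r p| < j} ≤ ENNReal.ofReal (K * j ^ c) := by
  have han := (aJdet hr hr0 h.akap h.kap0).eventually_analyticAt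
  obtain ⟨ρ, hρ, h1⟩ := Metric.nhds_basis_ball.eventually_iff.1 han
  have hne : ∃ y ∈ Metric.ball (q0, q0) ρ, Jdet (kap w V) r y ≠ 0 := by
    by_contra hcon
    push Not at hcon
    exact hnd (Filter.eventually_of_mem (Metric.ball_mem_nhds _ hρ) hcon)
  obtain ⟨C, c, hC, hc, hc1, hb⟩ := sublevel_multi volume (Metric.ball (q0, q0) ρ) Metric.isOpen_ball
    (convex_ball _ _).isPreconnected (Jdet (kap w V) r) (fun x hx => h1 hx) hne (Metric.closedBall (q0, q0) (ρ / 2))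
    (isCompact_closedBall _ _) (Metric.closedBall_subset_ball (by linarith))
  refine ⟨c, hc, hc1, ?_⟩
  filter_upwards [Filter.eventually_ge_atTop C] with K hK
  filter_upwards [ev_le (half_pos hρ)] with s hs j hj hj1
  refine (measure_mono ?_).trans ((hb j hj hj1).trans (ENNReal.ofReal_le_ofReal (by gcongr)))
  rintro p ⟨p1, p2, p3⟩
  exact ⟨Metric.closedBall_subset_closedBall hs (mem_cb2 p1 p2), p3⟩

lemma eGeo (h : LW q0 w V U) {r : ℝ × ℝ → ℝ} (hr : AnalyticAt ℝ r q0) (hr0 : r q0 ≠ 0) (mr : Measurable r)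
    (hnd : ¬ ∀ᶠ p in 𝓝 (q0, q0), Jdet (kap w V) r p = 0) : ∃ c : ℝ, 
    ∀ᶠ K in Filter.atTop, ∀ᶠ s in 𝓝[>] (0 : ℝ),
      Geo (Metric.closedBall q0.1 s) (Metric.closedBall q0.2 s) w V U r (Jdet (kap w V) r) K c := by
  obtain ⟨c, hc, hc1, h7⟩ := h.eh7 hr hr0 hnd
  refine ⟨c, ?_⟩
  filter_upwards [Filter.eventually_ge_atTop 1, h7, h.eh5 hr hr0, h.eh6a, h.eh6b, h.eVlip, h.eVanti,
    eub hr.continuousAt, elb hr.continuousAt hr0] with K hK h7 h5 h6a h6b hVl hVa hub hlb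
  filter_upwards [ev_pos, ev_le (by norm_num : (0 : ℝ) < 1 / 2), h7, h5, h6a, h6b, hVl, hVa, hub, hlb,
    ev_closedBall (h.tq2.eventually h.VU), ev_closedBall (h.tq.eventually h.UV), ev_closedBall h.Vw]
    with s hs hs2 h7 h5 h6a h6b hVl hVa hub hlb VU UV Vw
  refine ⟨hK, hc, hc1, measurableSet_closedBall, measurableSet_closedBall, ⟨q0.1 - s, ?_⟩, ⟨q0.2 - s, ?_⟩, h.mw, h.mV, h.mU, mr,
    mJdet _ _, ?_, ?_, ?_, hVl, hVa, hub, hlb, ?_, ?_, ?_, ?_⟩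
  · rw [Real.closedBall_eq_Icc]; exact Icc_subset_Icc le_rfl (by linarith)
  · rw [Real.closedBall_eq_Icc]; exact Icc_subset_Icc le_rfl (by linarith)
  · intro u hu v hv z hz; exact VU ((u, v), z) (mem_cb2 (mem_cb2 hu hv) hz)
  · intro u hu v hv z hz; exact UV ((u, v), z) (mem_cb2 (mem_cb2 hu hv) hz)
  · intro u hu v hv; exact Vw (u, v) (mem_cb2 hu hv)
  · rw [cb_prod]; exact h5
  · rw [cb_prod]; exact h6a
  · rw [cb_prod]; exact h6b
  · rw [cb_prod]; exact h7
end LW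

/-- analytic germs have analytic primitives -/
lemma analytic_primitive {g : ℝ → ℝ} {u : ℝ} (hg : AnalyticAt ℝ g u) :
    ∃ F : ℝ → ℝ, AnalyticAt ℝ F u ∧ ∀ᶠ y in 𝓝 u, HasDerivAt F (g y) y := by
  obtain ⟨p, hp⟩ := hg
  obtain ⟨q, hq⟩ : ∃ q : FormalMultilinearSeries ℝ ℝ ℝ, q = FormalMultilinearSeries.ofScalars ℝ
    (fun n : ℕ => p.coeff (n - 1) / (n : ℝ)) := ⟨_, rfl⟩
  have hqc : ∀ n, q.coeff n = p.coeff (n - 1) / (n : ℝ) := by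
    intro n; rw [hq, FormalMultilinearSeries.coeff_ofScalars]
  have hrad : 0 < q.radius := by
    obtain ⟨r0, hr0, hr0'⟩ := ENNReal.lt_iff_exists_nnreal_btwn.1 hp.radius_pos
    obtain ⟨C, hC, hb⟩ := p.norm_mul_pow_le_of_lt_radius hr0'
    refine lt_of_lt_of_le hr0 (q.le_radius_of_bound (C * r0) fun n => ?_)
    rw [FormalMultilinearSeries.norm_apply_eq_norm_coef, hqc]
    rcases n with _ | n
    · simp; positivity
    · have := hb n
      rw [FormalMultilinearSeries.norm_apply_eq_norm_coef] at this
      simp only [Nat.add_sub_cancel, norm_div, pow_succ]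
      have h1 : ‖p.coeff n‖ / ‖((n + 1 : ℕ) : ℝ)‖ ≤ ‖p.coeff n‖ := by
        apply div_le_self (norm_nonneg _)
        rw [Real.norm_natCast]; exact_mod_cast Nat.succ_le_succ (Nat.zero_le n)
      calc _ ≤ ‖p.coeff n‖ * ((r0 : ℝ) ^ n * r0) := by gcongr
        _ = (‖p.coeff n‖ * (r0 : ℝ) ^ n) * r0 := by ring
        _ ≤ _ := by gcongr
  have hF := q.hasFPowerSeriesOnBall hrad
  have hF2 := hF.fderiv
  have e1 : ∀ᶠ z in 𝓝 (0 : ℝ), HasDerivAt q.sum (g (u + z)) z := by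
    have h1 := hF2.hasFPowerSeriesAt
    rw [hasFPowerSeriesAt_iff] at h1 hp
    have h3 : ∀ᶠ z in 𝓝 (0 : ℝ), AnalyticAt ℝ q.sum z := hF.analyticAt.eventually_analyticAt
    filter_upwards [h1, hp, h3] with z h1 h2 h3
    have h4 := (ContinuousLinearMap.apply ℝ ℝ (1 : ℝ)).hasSum h1
    have h5 : deriv q.sum z = g (u + z) := by
      have e : fderiv ℝ q.sum (0 + z) 1 = g (u + z) := by
        refine HasSum.unique h4 ?_
        refine h2.congr_fun ?_
        intro n
        simp only [ContinuousLinearMap.apply_apply, ContinuousLinearMap.smul_apply, smul_eq_mul]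
        rw [FormalMultilinearSeries.derivSeries_coeff_one, hqc]
        simp only [Nat.add_sub_cancel, nsmul_eq_mul]
        push_cast
        have : (n : ℝ) + 1 ≠ 0 := by positivity
        field_simp
      rw [zero_add] at e
      exact e
    rw [← h5]; exact h3.differentiableAt.hasDerivAt
  refine ⟨fun y => q.sum (y - u), ?_, ?_⟩
  · refine AnalyticAt.fun_comp (g := q.sum) (f := fun y => y - u) ?_ (analyticAt_id.sub analyticAt_const)
    rw [sub_self]; exact hF.analyticAt
  · have t : Filter.Tendsto (fun y : ℝ => y - u) (𝓝 u) (𝓝 0) := by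
      have := (by fun_prop : Continuous fun y : ℝ => y - u).tendsto u
      simpa using this
    filter_upwards [t.eventually e1] with y hy
    rw [show u + (y - u) = y by ring] at hy
    have := HasDerivAt.comp y hy ((hasDerivAt_id y).sub_const u)
    rw [mul_one] at this
    exact this

def lu (κ : ℝ × ℝ → ℝ) (q : ℝ × ℝ) : ℝ := fderiv ℝ κ q (1, 0) / κ q
def lv (κ : ℝ × ℝ → ℝ) (q : ℝ × ℝ) : ℝ := fderiv ℝ κ q (0, 1) / κ q

lemma hd1 {κ : ℝ × ℝ → ℝ} {u v : ℝ} (h : DifferentiableAt ℝ κ (u, v)) :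
    HasDerivAt (fun y => κ (y, v)) (fderiv ℝ κ (u, v) (1, 0)) u :=
  HasFDerivAt.comp_hasDerivAt (f := fun y : ℝ => (y, v)) u h.hasFDerivAt ((hasDerivAt_id _).prodMk (hasDerivAt_const _ _))

lemma hd2 {κ : ℝ × ℝ → ℝ} {u v : ℝ} (h : DifferentiableAt ℝ κ (u, v)) :
    HasDerivAt (fun y => κ (u, y)) (fderiv ℝ κ (u, v) (0, 1)) v :=
  HasFDerivAt.comp_hasDerivAt (f := fun y : ℝ => (u, y)) v h.hasFDerivAt ((hasDerivAt_const _ _).prodMk (hasDerivAt_id _))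

lemma Dmm_diff {κ : ℝ × ℝ → ℝ} {α β : ℝ × ℝ} (h1 : DifferentiableAt ℝ κ (α.1, β.2)) (h2 : DifferentiableAt ℝ κ (β.1, α.2))
    (h3 : DifferentiableAt ℝ κ β) (h0 : κ β ≠ 0) :
    DifferentiableAt ℝ (fun p : (ℝ × ℝ) × (ℝ × ℝ) => MM κ p.1 p.2) (α, β) := by
  have a1 : DifferentiableAt ℝ (fun p : (ℝ × ℝ) × (ℝ × ℝ) => κ (p.1.1, p.2.2)) (α, β) :=
    DifferentiableAt.comp (g := κ) (f := fun p : (ℝ × ℝ) × (ℝ × ℝ) => (p.1.1, p.2.2)) (α, β) h1 (by fun_prop)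
  have a2 : DifferentiableAt ℝ (fun p : (ℝ × ℝ) × (ℝ × ℝ) => κ (p.2.1, p.1.2)) (α, β) :=
    DifferentiableAt.comp (g := κ) (f := fun p : (ℝ × ℝ) × (ℝ × ℝ) => (p.2.1, p.1.2)) (α, β) h2 (by fun_prop)
  have a3 : DifferentiableAt ℝ (fun p : (ℝ × ℝ) × (ℝ × ℝ) => κ p.2) (α, β) :=
    DifferentiableAt.comp (g := κ) (f := fun p : (ℝ × ℝ) × (ℝ × ℝ) => p.2) (α, β) h3 (by fun_prop)
  have a4 : DifferentiableAt ℝ (fun p : (ℝ × ℝ) × (ℝ × ℝ) => κ (p.1.1, p.2.2) * κ (p.2.1, p.1.2)) (α, β) := a1.mul a2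
  have a5 : DifferentiableAt ℝ (fun p : (ℝ × ℝ) × (ℝ × ℝ) => (κ p.2)⁻¹) (α, β) := a3.inv h0
  have a6 : DifferentiableAt ℝ (fun p : (ℝ × ℝ) × (ℝ × ℝ) => κ (p.1.1, p.2.2) * κ (p.2.1, p.1.2) * (κ p.2)⁻¹) (α, β) := a4.mul a5
  simpa only [MM, div_eq_mul_inv] using a6

lemma Dmm1 {κ : ℝ × ℝ → ℝ} {α β : ℝ × ℝ} (h1 : DifferentiableAt ℝ κ (α.1, β.2)) (h2 : DifferentiableAt ℝ κ (β.1, α.2))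
    (h3 : DifferentiableAt ℝ κ β) (h0 : κ β ≠ 0) (h02 : κ (β.1, α.2) ≠ 0) :
    Dmm κ (α, β) (0, (1, 0)) = MM κ α β * (lu κ (β.1, α.2) - lu κ β) := by
  have d := (Dmm_diff h1 h2 h3 h0).hasFDerivAt
  have d1 := HasFDerivAt.comp_hasDerivAt (f := fun y : ℝ => (α, ((y, β.2) : ℝ × ℝ))) β.1 d
    ((hasDerivAt_const _ _).prodMk ((hasDerivAt_id _).prodMk (hasDerivAt_const _ _)))
  have d2 := (((hd1 h2).const_mul (κ (α.1, β.2))).div (hd1 (κ := κ) (u := β.1) (v := β.2) h3) h0)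
  have e := d1.unique d2
  refine e.trans ?_
  simp only [MM, lu]
  field_simp

lemma Dmm2 {κ : ℝ × ℝ → ℝ} {α β : ℝ × ℝ} (h1 : DifferentiableAt ℝ κ (α.1, β.2)) (h2 : DifferentiableAt ℝ κ (β.1, α.2))
    (h3 : DifferentiableAt ℝ κ β) (h0 : κ β ≠ 0) (h01 : κ (α.1, β.2) ≠ 0) :
    Dmm κ (α, β) (0, (0, 1)) = MM κ α β * (lv κ (α.1, β.2) - lv κ β) := by
  have d := (Dmm_diff h1 h2 h3 h0).hasFDerivAt
  have d1 := HasFDerivAt.comp_hasDerivAt (f := fun y : ℝ => (α, ((β.1, y) : ℝ × ℝ))) β.2 d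
    ((hasDerivAt_const _ _).prodMk ((hasDerivAt_const _ _).prodMk (hasDerivAt_id _)))
  have d2 := (((hd2 h1).mul_const (κ (β.1, α.2))).div (hd2 (κ := κ) (u := β.1) (v := β.2) h3) h0)
  have e := d1.unique d2
  refine e.trans ?_
  simp only [MM, lv]
  field_simp

lemma an_log {κ : ℝ × ℝ → ℝ} {q : ℝ × ℝ} (h : AnalyticAt ℝ κ q) (h0 : κ q ≠ 0) : AnalyticAt ℝ (fun q => Real.log (κ q)) q :=
  AnalyticAt.fun_comp (g := Real.log) (f := κ) ((Real.contDiffAt_log (n := ⊤)).2 h0).analyticAt h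

def Splits2 (M : ℝ × ℝ → ℝ) (q1 : ℝ × ℝ) (s : ℝ) : Prop :=
  ∃ α β : ℝ → ℝ, (∀ u ∈ Metric.ball q1.1 s, AnalyticAt ℝ α u) ∧ (∀ v ∈ Metric.ball q1.2 s, AnalyticAt ℝ β v) ∧
    ∀ u ∈ Metric.ball q1.1 s, ∀ v ∈ Metric.ball q1.2 s, M (u, v) = α u + β v

lemma mem_b2 {q1 : ℝ × ℝ} {s u v : ℝ} (hu : u ∈ Metric.ball q1.1 s) (hv : v ∈ Metric.ball q1.2 s) : (u, v) ∈ Metric.ball q1 s := by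
  have := ball_prod_same q1.1 q1.2 s
  rw [show q1 = (q1.1, q1.2) from rfl, ← this]; exact ⟨hu, hv⟩

lemma const_ball {f : ℝ → ℝ} {u s : ℝ} (hf : ∀ x ∈ Metric.ball u s, HasDerivAt f 0 x) :
    ∀ x ∈ Metric.ball u s, ∀ y ∈ Metric.ball u s, f x = f y := fun x hx y hy =>
  Metric.isOpen_ball.is_const_of_deriv_eq_zero (convex_ball _ _).isPreconnected
    (fun z hz => (hf z hz).differentiableAt.differentiableWithinAt) (fun z hz => (hf z hz).deriv) hx hy

lemma splits_of_rect {M : ℝ × ℝ → ℝ} {q1 : ℝ × ℝ} {s : ℝ} (hM : ∀ q ∈ Metric.ball q1 s, AnalyticAt ℝ M q)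
    {u2 v2 : ℝ} (hu2 : u2 ∈ Metric.ball q1.1 s) (hv2 : v2 ∈ Metric.ball q1.2 s)
    (h : ∀ u ∈ Metric.ball q1.1 s, ∀ v ∈ Metric.ball q1.2 s, M (u, v) - M (u2, v) = M (u, v2) - M (u2, v2)) :
    Splits2 M q1 s := by
  refine ⟨fun u => M (u, v2), fun v => M (u2, v) - M (u2, v2), fun u hu => ?_, fun v hv => ?_, fun u hu v hv => ?_⟩
  · exact AnalyticAt.fun_comp (g := M) (f := fun u => (u, v2)) (hM _ (mem_b2 hu hv2)) (an_of_cd (by fun_prop))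
  · exact (AnalyticAt.fun_comp (g := M) (f := fun u => (u2, u)) (hM _ (mem_b2 hu2 hv)) (an_of_cd (by fun_prop))).sub analyticAt_const
  · linarith [h u hu v hv]

lemma splits_v {M : ℝ × ℝ → ℝ} {q1 : ℝ × ℝ} {s : ℝ} (hM : ∀ q ∈ Metric.ball q1 s, AnalyticAt ℝ M q)
    {u2 v2 : ℝ} (hu2 : u2 ∈ Metric.ball q1.1 s) (hv2 : v2 ∈ Metric.ball q1.2 s)
    (h : ∀ u ∈ Metric.ball q1.1 s, ∀ v ∈ Metric.ball q1.2 s, fderiv ℝ M (u, v) (0, 1) = fderiv ℝ M (u2, v) (0, 1)) :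
    Splits2 M q1 s := by
  refine splits_of_rect hM hu2 hv2 fun u hu v hv => ?_
  refine const_ball (f := fun v => M (u, v) - M (u2, v)) (fun x hx => ?_) v hv v2 hv2
  have := (hd2 (hM _ (mem_b2 hu hx)).differentiableAt).sub (hd2 (hM _ (mem_b2 hu2 hx)).differentiableAt)
  rw [h u hu x hx, sub_self] at this
  exact this

lemma splits_u {M : ℝ × ℝ → ℝ} {q1 : ℝ × ℝ} {s : ℝ} (hM : ∀ q ∈ Metric.ball q1 s, AnalyticAt ℝ M q)
    {u2 v2 : ℝ} (hu2 : u2 ∈ Metric.ball q1.1 s) (hv2 : v2 ∈ Metric.ball q1.2 s)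
    (h : ∀ u ∈ Metric.ball q1.1 s, ∀ v ∈ Metric.ball q1.2 s, fderiv ℝ M (u, v) (1, 0) = fderiv ℝ M (u, v2) (1, 0)) :
    Splits2 M q1 s := by
  refine splits_of_rect hM hu2 hv2 fun u hu v hv => ?_
  have := const_ball (f := fun u => M (u, v) - M (u, v2)) (u := q1.1) (s := s) (fun x hx => ?_) u hu u2 hu2
  · linarith
  · have := (hd1 (hM _ (mem_b2 hx hv)).differentiableAt).sub (hd1 (hM _ (mem_b2 hx hv2)).differentiableAt)
    rw [h x hx v hv, sub_self] at this
    exact this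

lemma split_alt {κ r : ℝ × ℝ → ℝ} {q1 : ℝ × ℝ} {s : ℝ} (hs : 0 < s)
    (hκ : ∀ q ∈ Metric.ball q1 s, AnalyticAt ℝ κ q ∧ κ q ≠ 0) (hr : ∀ q ∈ Metric.ball q1 s, AnalyticAt ℝ r q ∧ r q ≠ 0)
    (hJ : ∀ α ∈ Metric.ball q1 s, ∀ β ∈ Metric.ball q1 s, Jdet κ r (α, β) = 0) :
    Splits2 (fun q => Real.log (κ q)) q1 s ∨ ∃ τ : ℝ, Splits2 (fun q => Real.log (r q) - τ * Real.log (κ q)) q1 s := by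
  have hL : ∀ q ∈ Metric.ball q1 s, AnalyticAt ℝ (fun q => Real.log (κ q)) q := fun q hq => an_log (hκ q hq).1 (hκ q hq).2
  have hN : ∀ q ∈ Metric.ball q1 s, AnalyticAt ℝ (fun q => Real.log (r q)) q := fun q hq => an_log (hr q hq).1 (hr q hq).2
  have fd : ∀ (κ : ℝ × ℝ → ℝ) q t, AnalyticAt ℝ κ q → κ q ≠ 0 → fderiv ℝ (fun q => Real.log (κ q)) q t = fderiv ℝ κ q t / κ q := by
    intro κ q t h h0
    rw [(h.differentiableAt.hasFDerivAt.log h0).fderiv]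
    simp [div_eq_inv_mul]
  have c1 : q1.1 ∈ Metric.ball q1.1 s := Metric.mem_ball_self hs
  have c2 : q1.2 ∈ Metric.ball q1.2 s := Metric.mem_ball_self hs
  -- the key identity
  have key : ∀ u1 ∈ Metric.ball q1.1 s, ∀ u2 ∈ Metric.ball q1.1 s, ∀ v1 ∈ Metric.ball q1.2 s, ∀ v2 ∈ Metric.ball q1.2 s,
      (lu κ (u2, v2) - lu κ (u2, v1)) * (lv r (u1, v1) - lv r (u2, v1)) =
      (lv κ (u1, v1) - lv κ (u2, v1)) * (lu r (u2, v2) - lu r (u2, v1)) := by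
    intro u1 hu1 u2 hu2 v1 hv1 v2 hv2
    have j := hJ (u1, v2) (mem_b2 hu1 hv2) (u2, v1) (mem_b2 hu2 hv1)
    have b1 := mem_b2 hu1 hv1
    have b2 := mem_b2 hu2 hv2
    have b3 := mem_b2 hu2 hv1
    have k1 := hκ _ b1
    have k2 := hκ _ b2
    have k3 := hκ _ b3
    have r1 := hr _ b1
    have r2 := hr _ b2
    have r3 := hr _ b3
    rw [Jdet, Dmm1 k1.1.differentiableAt k2.1.differentiableAt k3.1.differentiableAt k3.2 k2.2,
      Dmm2 k1.1.differentiableAt k2.1.differentiableAt k3.1.differentiableAt k3.2 k1.2,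
      Dmm1 r1.1.differentiableAt r2.1.differentiableAt r3.1.differentiableAt r3.2 r2.2,
      Dmm2 r1.1.differentiableAt r2.1.differentiableAt r3.1.differentiableAt r3.2 r1.2] at j
    have m1 : MM κ (u1, v2) (u2, v1) ≠ 0 := by
      simp only [MM]; exact div_ne_zero (mul_ne_zero k1.2 k2.2) k3.2
    have m2 : MM r (u1, v2) (u2, v1) ≠ 0 := by
      simp only [MM]; exact div_ne_zero (mul_ne_zero r1.2 r2.2) r3.2
    have j2 : (MM κ (u1, v2) (u2, v1) * MM r (u1, v2) (u2, v1)) * ((lu κ (u2, v2) - lu κ (u2, v1)) * (lv r (u1, v1) - lv r (u2, v1)) -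
      (lv κ (u1, v1) - lv κ (u2, v1)) * (lu r (u2, v2) - lu r (u2, v1))) = 0 := by
      rw [← j]; ring
    have := (mul_eq_zero.1 j2).resolve_left (mul_ne_zero m1 m2)
    linarith
  by_cases hc : ∀ u ∈ Metric.ball q1.1 s, ∀ v ∈ Metric.ball q1.2 s, lu κ (u, v) = lu κ (u, q1.2)
  · left
    refine splits_u hL c1 c2 fun u hu v hv => ?_
    rw [fd κ _ _ (hκ _ (mem_b2 hu hv)).1 (hκ _ (mem_b2 hu hv)).2, fd κ _ _ (hκ _ (mem_b2 hu c2)).1 (hκ _ (mem_b2 hu c2)).2]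
    exact hc u hu v hv
  · right
    push Not at hc
    obtain ⟨u2, hu2, v2, hv2, hne⟩ := hc
    have hne' : lu κ (u2, v2) - lu κ (u2, q1.2) ≠ 0 := sub_ne_zero.2 hne
    refine ⟨(lu r (u2, v2) - lu r (u2, q1.2)) / (lu κ (u2, v2) - lu κ (u2, q1.2)), ?_⟩
    set τ := (lu r (u2, v2) - lu r (u2, q1.2)) / (lu κ (u2, v2) - lu κ (u2, q1.2)) with hτ
    have hMan : ∀ q ∈ Metric.ball q1 s, AnalyticAt ℝ (fun q => Real.log (r q) - τ * Real.log (κ q)) q :=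
      fun q hq => (hN q hq).sub (analyticAt_const.mul (hL q hq))
    have fdM : ∀ q ∈ Metric.ball q1 s, fderiv ℝ (fun q => Real.log (r q) - τ * Real.log (κ q)) q (0, 1) = lv r q - τ * lv κ q := by
      intro q hq
      have := ((hN q hq).differentiableAt.hasFDerivAt.sub ((hL q hq).differentiableAt.hasFDerivAt.const_mul τ)).fderiv
      have e := congrArg (fun L => L (0, 1)) this
      refine Eq.trans e ?_
      simp only [ContinuousLinearMap.sub_apply, ContinuousLinearMap.smul_apply, smul_eq_mul]
      rw [fd κ _ _ (hκ _ hq).1 (hκ _ hq).2, fd r _ _ (hr _ hq).1 (hr _ hq).2]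
      rfl
    refine splits_v hMan hu2 c2 fun u hu v hv => ?_
    rw [fdM _ (mem_b2 hu hv), fdM _ (mem_b2 hu2 hv)]
    have k1 := key u hu u2 hu2 v hv v2 hv2
    have k2 := key u hu u2 hu2 v hv q1.2 c2
    have k3 : (lu κ (u2, v2) - lu κ (u2, q1.2)) * (lv r (u, v) - lv r (u2, v)) =
      (lv κ (u, v) - lv κ (u2, v)) * (lu r (u2, v2) - lu r (u2, q1.2)) := by linarith
    have k4 : lv r (u, v) - lv r (u2, v) = τ * (lv κ (u, v) - lv κ (u2, v)) := by
      rw [hτ, div_mul_eq_mul_div, eq_div_iff hne']; linarith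
    linarith

abbrev E2 := EuclideanSpace ℝ (Fin 2)

lemma LW.eventually {q0 : ℝ × ℝ} {w V U : ℝ × ℝ → ℝ} (h : LW q0 w V U) : ∀ᶠ q in 𝓝 q0, LW q w V U := by
  filter_upwards [h.aw.eventually_analyticAt, h.tend1.eventually h.aV.eventually_analyticAt,
    h.tend2.eventually h.aU.eventually_analyticAt, h.Vw.eventually_nhds, h.Uw.eventually_nhds,
    h.tend1.eventually h.wV.eventually_nhds, h.tend2.eventually h.wU.eventually_nhds] with q h1 h2 h3 h4 h5 h6 h7
  exact ⟨h1, h2, h3, h4, h5, h6, h7, h.mw, h.mV, h.mU⟩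

lemma an_exp {f : ℝ → ℝ} {u : ℝ} (h : AnalyticAt ℝ f u) : AnalyticAt ℝ (fun u => Real.exp (f u)) u := h.rexp'

lemma fin3_filter {i j k : Fin 3} (hij : i ≠ j) (hik : i ≠ k) (hjk : j ≠ k) :
    Finset.univ.filter (fun l : Fin 3 => l ≠ k) = {i, j} := by
  revert i j k; decide

lemma fin3_or {i j k l : Fin 3} (hij : i ≠ j) (hik : i ≠ k) (hjk : j ≠ k) (hl : l ≠ k) : l = i ∨ l = j := by
  revert i j k l; decide

lemma caseS2 {x₀ : E2} {rad : ℝ} {a φ : Fin 3 → E2 → ℝ} {W : E2 → E2} {i j k : Fin 3}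
    (hij : i ≠ j) (hik : i ≠ k) (hjk : j ≠ k)
    (hAux : ∀ U : Set E2, U ⊆ Metric.closedBall x₀ rad → IsOpen U → U.Nonempty → ∀ τ : ℝ,
      ∀ g : Fin 3 → ℝ → ℝ, (∀ i, i ≠ k → AnalyticOnNhd ℝ (g i) (φ i '' U)) →
      (∀ x ∈ U, ∑ i ∈ Finset.univ.filter (fun i => i ≠ k),
          a i x * |fderiv ℝ (φ i) x (W x)| ^ τ * g i (φ i x) = 0) →
      ∀ i, i ≠ k → ∀ y ∈ φ i '' U, g i y = 0)
    {x1 : E2} (hx1 : x1 ∈ Metric.ball x₀ rad)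
    (hφ : ∀ l, ∀ᶠ x in 𝓝 x1, AnalyticAt ℝ (φ l) x) (ha : ∀ l, AnalyticAt ℝ (a l) x1) (ha0 : ∀ l, a l x1 ≠ 0)
    (hW : ∀ᶠ x in 𝓝 x1, fderiv ℝ (φ k) x (W x) = 0)
    {w V R : ℝ × ℝ → ℝ} {n : ℕ}
    (hV : ∀ᶠ x in 𝓝 x1, V (φ i x, φ k x) = φ j x) (hw : ∀ᶠ x in 𝓝 x1, w (φ i x, φ j x) = φ k x)
    (haV : ∀ᶠ x in 𝓝 x1, AnalyticAt ℝ V (φ i x, φ k x))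
    (hR : ∀ᶠ x in 𝓝 x1, R (φ i x, φ j x) = a i x / a j x * kap w V (φ i x, φ j x) ^ n)
    (hk : ∀ᶠ x in 𝓝 x1, kap w V (φ i x, φ j x) ≠ 0)
    {s τ : ℝ} (hs : 0 < s)
    (hS : Splits2 (fun q => Real.log (R q) - τ * Real.log (kap w V q)) (φ i x1, φ j x1) s) : False := by
  obtain ⟨α, β, hα, hβ, hsp⟩ := hS
  obtain ⟨σ, hσ, hσ1⟩ : ∃ σ : ℝ, (∀ᶠ x in 𝓝 x1, a i x / a j x = σ * |a i x / a j x|) ∧ σ ≠ 0 := by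
    have hc : ContinuousAt (fun x => a i x / a j x) x1 := (ha i).continuousAt.div (ha j).continuousAt (ha0 j)
    rcases lt_or_gt_of_ne (div_ne_zero (ha0 i) (ha0 j)) with h | h
    · refine ⟨-1, ?_, by norm_num⟩
      filter_upwards [hc.eventually (gt_mem_nhds h)] with x hx
      rw [abs_of_neg hx]; ring
    · refine ⟨1, ?_, by norm_num⟩
      filter_upwards [hc.eventually (lt_mem_nhds h)] with x hx
      rw [abs_of_pos hx]; ring
  have ci : ∀ l, ContinuousAt (φ l) x1 := fun l => (hφ l).self_of_nhds.continuousAt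
  have n0 : ∀ l, ∀ᶠ x in 𝓝 x1, a l x ≠ 0 := fun l => (ha l).continuousAt.eventually_ne (ha0 l)
  have hb : ∀ᶠ x in 𝓝 x1, φ i x ∈ Metric.ball (φ i x1) s ∧ φ j x ∈ Metric.ball (φ j x1) s :=
    ((ci i).eventually (Metric.ball_mem_nhds _ hs)).and ((ci j).eventually (Metric.ball_mem_nhds _ hs))
  have main : ∀ᶠ x in 𝓝 x1, (x ∈ Metric.ball x₀ rad ∧ φ i x ∈ Metric.ball (φ i x1) s ∧ φ j x ∈ Metric.ball (φ j x1) s) ∧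
      a i x * |fderiv ℝ (φ i) x (W x)| ^ (τ - n) * Real.exp (- α (φ i x)) +
      a j x * |fderiv ℝ (φ j) x (W x)| ^ (τ - n) * (- σ * Real.exp (β (φ j x))) = 0 := by
    filter_upwards [Metric.isOpen_ball.mem_nhds hx1, hb, hσ, n0 i, n0 j, hR, hk, hV.eventually_nhds, hw, haV, hφ i, hφ j, hφ k, hW]
      with x hx hb hσ hi hj hR hk hV hw haV di dj dk hW
    refine ⟨⟨hx, hb⟩, ?_⟩
    have e1 : |fderiv ℝ (φ j) x (W x)| = |kap w V (φ i x, φ j x)| * |fderiv ℝ (φ i) x (W x)| := by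
      have d1 := HasFDerivAt.comp x haV.differentiableAt.hasFDerivAt
        (di.differentiableAt.hasFDerivAt.prodMk dk.differentiableAt.hasFDerivAt)
      have d2 : HasFDerivAt (φ j) _ x := d1.congr_of_eventuallyEq (by filter_upwards [hV] with y hy; exact hy.symm)
      rw [d2.fderiv, kap]
      simp only [hw, ContinuousLinearMap.comp_apply, ContinuousLinearMap.prod_apply, hW]
      rw [← abs_mul]
      congr 1
      have : ((fderiv ℝ (φ i) x (W x), 0) : ℝ × ℝ) = fderiv ℝ (φ i) x (W x) • ((1, 0) : ℝ × ℝ) := by simp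
      rw [this, map_smul, smul_eq_mul, mul_comm]
    rw [e1, Real.mul_rpow (abs_nonneg _) (abs_nonneg _)]
    have hs := hsp _ hb.1 _ hb.2
    simp only [hR] at hs
    rw [Real.log_mul (div_ne_zero hi hj) (pow_ne_zero _ hk), Real.log_pow] at hs
    have e2 : Real.log |a i x / a j x| = Real.log |kap w V (φ i x, φ j x)| * (τ - n) + α (φ i x) + β (φ j x) := by
      rw [Real.log_abs, Real.log_abs]; linarith
    have e3 : |a i x / a j x| = |kap w V (φ i x, φ j x)| ^ (τ - n) * Real.exp (α (φ i x)) * Real.exp (β (φ j x)) := by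
      rw [← Real.exp_log (abs_pos.2 (div_ne_zero hi hj)), e2, Real.exp_add, Real.exp_add, Real.rpow_def_of_pos (abs_pos.2 hk)]
    have e4 : a i x = a j x * (σ * (|kap w V (φ i x, φ j x)| ^ (τ - n) * Real.exp (α (φ i x)) * Real.exp (β (φ j x)))) := by
      rw [← e3, ← hσ]; field_simp
    have e5 : Real.exp (α (φ i x)) * Real.exp (- α (φ i x)) = 1 := by rw [← Real.exp_add]; simp
    rw [e4]
    linear_combination (a j x * σ * |kap w V (φ i x, φ j x)| ^ (τ - n) * Real.exp (β (φ j x)) * |fderiv ℝ (φ i) x (W x)| ^ (τ - n)) * e5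
  obtain ⟨U, hU, hUo, hxU⟩ := eventually_nhds_iff.1 main
  have := hAux U (fun x hx => Metric.ball_subset_closedBall (hU x hx).1.1) hUo ⟨x1, hxU⟩ (τ - n)
    (fun l => if l = i then fun y => Real.exp (- α y) else fun y => - σ * Real.exp (β y)) ?_ ?_ i hik (φ i x1) ⟨x1, hxU, rfl⟩
  · simp at this
  · intro l hl
    have hl' : l = i ∨ l = j := fin3_or hij hik hjk hl
    rcases hl' with rfl | rfl
    · rintro _ ⟨x, hx, rfl⟩
      simp only [if_true]
      exact an_exp (hα _ (hU x hx).1.2.1).neg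
    · rintro _ ⟨x, hx, rfl⟩
      simp only [if_neg hij.symm]
      exact analyticAt_const.mul (an_exp (hβ _ (hU x hx).1.2.2))
  · intro x hx
    rw [fin3_filter hij hik hjk, Finset.sum_pair hij]
    simp only [if_true, if_neg hij.symm]
    exact (hU x hx).2

lemma inv1 {ψ : ℝ → ℝ} {u d : ℝ} (h : AnalyticAt ℝ ψ u) (hd : HasDerivAt ψ d u) (h0 : d ≠ 0) :
    ∃ g, AnalyticAt ℝ g (ψ u) ∧ g (ψ u) = u ∧ ∀ᶠ y in 𝓝 u, g (ψ y) = y := by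
  obtain ⟨g, h1, h2, h3, _⟩ := analytic_inverse h ((ContinuousLinearEquiv.unitsEquivAut ℝ) (Units.mk0 d h0)) (by
    rw [hd.hasFDerivAt.fderiv]; ext; simp)
  exact ⟨g, h1, h2, h3⟩

lemma S1_q {q1 : ℝ × ℝ} {w V U : ℝ × ℝ → ℝ} (h : LW q1 w V U) {s : ℝ} (hs : 0 < s)
    (hS : Splits2 (fun q => Real.log (kap w V q)) q1 s) :
    ∃ ψ1 ψ2 ψ3 g1 g2 g3 : ℝ → ℝ, AnalyticAt ℝ ψ1 q1.1 ∧ AnalyticAt ℝ ψ2 q1.2 ∧ AnalyticAt ℝ ψ3 (w q1) ∧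
      AnalyticAt ℝ g1 (ψ1 q1.1) ∧ AnalyticAt ℝ g2 (ψ2 q1.2) ∧ g1 (ψ1 q1.1) = q1.1 ∧ g2 (ψ2 q1.2) = q1.2 ∧
      (∀ᶠ y in 𝓝 q1.1, g1 (ψ1 y) = y) ∧ (∀ᶠ y in 𝓝 q1.2, g2 (ψ2 y) = y) ∧ (∀ᶠ y in 𝓝 (w q1), g3 (ψ3 y) = y) ∧
      ∀ᶠ q in 𝓝 q1, ψ3 (w q) = ψ1 q.1 + ψ2 q.2 := by
  obtain ⟨α, β, hα, hβ, hsp⟩ := hS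
  have k0 := h.kap0
  obtain ⟨σ, hσσ, hσ⟩ : ∃ σ : ℝ, σ * σ = 1 ∧ ∀ᶠ q in 𝓝 q1, kap w V q = σ * |kap w V q| := by
    have hc : ContinuousAt (kap w V) q1 := h.akap.continuousAt
    rcases lt_or_gt_of_ne k0 with h | h
    · refine ⟨-1, by norm_num, ?_⟩
      filter_upwards [hc.eventually (gt_mem_nhds h)] with x hx
      rw [abs_of_neg hx]; ring
    · refine ⟨1, by norm_num, ?_⟩
      filter_upwards [hc.eventually (lt_mem_nhds h)] with x hx
      rw [abs_of_pos hx]; ring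
  have σ0 : σ ≠ 0 := by rintro rfl; norm_num at hσσ
  have aα := hα _ (Metric.mem_ball_self hs)
  have aβ := hβ _ (Metric.mem_ball_self hs)
  obtain ⟨ψ1, a1, d1⟩ := analytic_primitive (an_exp aα)
  obtain ⟨ψ2, a2, d2⟩ := analytic_primitive (analyticAt_const.mul (an_exp aβ.neg) : AnalyticAt ℝ (fun y => -σ * Real.exp (- β y)) q1.2)
  obtain ⟨g1, b1, c1, e1⟩ := inv1 a1 d1.self_of_nhds (Real.exp_ne_zero _)
  obtain ⟨g2, b2, c2, e2⟩ := inv1 a2 d2.self_of_nhds (mul_ne_zero (neg_ne_zero.2 σ0) (Real.exp_ne_zero _))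
  have tV : Filter.Tendsto (fun t : ℝ × ℝ => (t.1, V t)) (𝓝 (q1.1, w q1)) (𝓝 q1) := by
    have : ContinuousAt (fun t : ℝ × ℝ => (t.1, V t)) (q1.1, w q1) :=
      continuous_fst.continuousAt.prodMk h.aV.continuousAt
    have h2 := this.tendsto
    simp only [h.V0] at h2
    exact h2
  have t0 : Filter.Tendsto (fun ω : ℝ => (q1.1, ω)) (𝓝 (w q1)) (𝓝 (q1.1, w q1)) :=
    (continuous_const.prodMk continuous_id).tendsto _
  have tV2 : Filter.Tendsto (fun ω : ℝ => V (q1.1, ω)) (𝓝 (w q1)) (𝓝 q1.2) :=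
    ((continuous_snd.tendsto q1).comp tV).comp t0
  have hder : ∀ᶠ t : ℝ × ℝ in 𝓝 (q1.1, w q1), HasDerivAt (fun y => ψ1 y + ψ2 (V (y, t.2))) 0 t.1 := by
    have hb : ∀ᶠ q in 𝓝 q1, q.1 ∈ Metric.ball q1.1 s ∧ q.2 ∈ Metric.ball q1.2 s :=
      ((continuous_fst.tendsto q1).eventually (Metric.ball_mem_nhds _ hs)).and
        ((continuous_snd.tendsto q1).eventually (Metric.ball_mem_nhds _ hs))
    filter_upwards [tV.eventually h.derivs, tV.eventually hσ, tV.eventually hb,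
      tV.eventually ((continuous_fst.tendsto q1).eventually d1), tV.eventually ((continuous_snd.tendsto q1).eventually d2), h.wV]
      with t h1 h2 h3 h4 h5 h6
    obtain ⟨h1, h0, -⟩ := h1
    have e := hsp _ h3.1 _ h3.2
    simp only at e h1 h2 h4 h5
    rw [h6] at h1
    have hk : kap w V (t.1, V t) = σ * (Real.exp (α t.1) * Real.exp (β (V t))) := by
      rw [← Real.exp_add, ← e, ← Real.log_abs, Real.exp_log (abs_pos.2 h0)]; exact h2
    have h7 : HasDerivAt (fun y => ψ2 (V (y, t.2))) (-σ * Real.exp (- β (V t)) * kap w V (t.1, V t)) t.1 :=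
      HasDerivAt.comp (h₂ := ψ2) (h := fun y => V (y, t.2)) t.1 h5 h1
    have h8 : HasDerivAt (fun y => ψ1 y + ψ2 (V (y, t.2))) (Real.exp (α t.1) + -σ * Real.exp (- β (V t)) * kap w V (t.1, V t)) t.1 :=
      h4.add h7
    rw [hk] at h8
    have e5 : Real.exp (β (V t)) * Real.exp (- β (V t)) = 1 := by rw [← Real.exp_add]; simp
    have e6 : Real.exp (α t.1) + -σ * Real.exp (- β (V t)) * (σ * (Real.exp (α t.1) * Real.exp (β (V t)))) = 0 := by
      linear_combination (-Real.exp (α t.1)) * hσσ - ((σ * σ) * Real.exp (α t.1)) * e5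
    rw [e6] at h8
    exact h8
  obtain ⟨ρ, hρ, hB⟩ := Metric.eventually_nhds_iff_ball.1 hder
  refine ⟨ψ1, ψ2, fun ω => ψ1 q1.1 + ψ2 (V (q1.1, ω)), g1, g2, fun z => w (q1.1, g2 (z - ψ1 q1.1)), a1, a2, ?_, b1, b2, c1, c2, e1, e2, ?_, ?_⟩
  · refine analyticAt_const.add ?_
    have : AnalyticAt ℝ (fun ω => V (q1.1, ω)) (w q1) :=
      AnalyticAt.fun_comp (g := V) (f := fun ω => (q1.1, ω)) h.aV (an_of_cd (by fun_prop))
    refine AnalyticAt.fun_comp (g := ψ2) (f := fun ω => V (q1.1, ω)) ?_ this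
    rw [h.V0]; exact a2
  · filter_upwards [tV2.eventually e2, t0.eventually h.wV] with ω h1 h2
    simp only [add_sub_cancel_left, h1]
    exact h2
  · filter_upwards [h.tend1.eventually (Metric.ball_mem_nhds _ hρ), h.Vw] with q hq hV
    change (q.1, w q) ∈ Metric.ball (q1.1, w q1) ρ at hq
    have m : ∀ y ∈ Metric.ball q1.1 ρ, (y, w q) ∈ Metric.ball (q1.1, w q1) ρ := by
      intro y hy
      rw [← ball_prod_same] at hq ⊢
      exact ⟨hy, hq.2⟩
    rw [← ball_prod_same] at hq
    have := const_ball (f := fun y => ψ1 y + ψ2 (V (y, w q))) (fun y hy => hB _ (m y hy)) q.1 hq.1 q1.1 (Metric.mem_ball_self hρ)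
    simp only [hV] at this
    exact this.symm

lemma open_of_inv {Φ Θ : E2 → E2} {x1 : E2} (h : AnalyticAt ℝ Φ x1) (hΘ : AnalyticAt ℝ Θ (Φ x1))
    (hi : ∀ᶠ x in 𝓝 x1, Θ (Φ x) = x) :
    ∃ N ∈ 𝓝 x1, InjOn Φ N ∧ ∀ V ⊆ N, IsOpen V → IsOpen (Φ '' V) := by
  have hsd : HasStrictFDerivAt Φ (fderiv ℝ Φ x1) x1 := h.hasStrictFDerivAt
  have hinj : Function.Injective (fderiv ℝ Φ x1) := by
    have h1 := hΘ.differentiableAt.hasFDerivAt.comp x1 h.differentiableAt.hasFDerivAt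
    have h2 : HasFDerivAt (fun x => x) _ x1 := h1.congr_of_eventuallyEq (by filter_upwards [hi] with y hy; exact hy.symm)
    have h3 := h2.unique (hasFDerivAt_id x1)
    intro a b hab
    have := congrArg (fun L : E2 →L[ℝ] E2 => L a) h3
    have h4 := congrArg (fun L : E2 →L[ℝ] E2 => L b) h3
    simp only [ContinuousLinearMap.comp_apply, hab] at this h4
    rw [this] at h4
    simpa using h4
  let e : E2 ≃L[ℝ] E2 := (LinearEquiv.ofInjectiveEndo (fderiv ℝ Φ x1 : E2 →ₗ[ℝ] E2) hinj).toContinuousLinearEquiv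
  have he : fderiv ℝ Φ x1 = (e : E2 →L[ℝ] E2) := by ext x; rfl
  rw [he] at hsd
  refine ⟨(hsd.toOpenPartialHomeomorph Φ).source, (hsd.toOpenPartialHomeomorph Φ).open_source.mem_nhds hsd.mem_toOpenPartialHomeomorph_source,
    ?_, fun V hV hVo => ?_⟩
  · have := (hsd.toOpenPartialHomeomorph Φ).injOn
    rwa [hsd.toOpenPartialHomeomorph_coe] at this
  · have := (hsd.toOpenPartialHomeomorph Φ).isOpen_image_of_subset_source hVo hV
    rwa [hsd.toOpenPartialHomeomorph_coe] at this

def prE (l : Fin 2) : E2 →L[ℝ] ℝ := EuclideanSpace.proj l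
lemma prE_apply (l : Fin 2) (x : E2) : prE l x = x l := rfl

lemma caseS1 {x₀ : E2} {rad : ℝ} {φ : Fin 3 → E2 → ℝ} {i j k : Fin 3}
    (hij : i ≠ j) (hik : i ≠ k) (hjk : j ≠ k)
    (hcurv : ¬ ∃ V : Set E2,
      V ⊆ Metric.closedBall x₀ rad ∧ IsOpen V ∧ V.Nonempty ∧ IsConnected V ∧
      ∃ (Φ : E2 → E2) (ψ : Fin 3 → ℝ → ℝ) (L : Fin 3 → (E2 →L[ℝ] ℝ)) (c : Fin 3 → ℝ),
        AnalyticOnNhd ℝ Φ V ∧ Set.InjOn Φ V ∧ IsOpen (Φ '' V) ∧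
        (∀ j, AnalyticOnNhd ℝ (ψ j) (φ j '' V) ∧ Set.InjOn (ψ j) (φ j '' V)) ∧
        ∀ j, ∀ x ∈ V, ψ j (φ j x) = L j (Φ x) + c j)
    {x1 : E2} (hx1 : x1 ∈ Metric.ball x₀ rad)
    (hφ : ∀ l, AnalyticAt ℝ (φ l) x1)
    {w V U : ℝ × ℝ → ℝ} (h : LW (φ i x1, φ j x1) w V U) (hw : ∀ᶠ x in 𝓝 x1, w (φ i x, φ j x) = φ k x)
    {Ψ : ℝ × ℝ → E2} (aΨ : AnalyticAt ℝ Ψ (φ i x1, φ j x1)) (hΨ : ∀ᶠ x in 𝓝 x1, Ψ (φ i x, φ j x) = x)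
    {s : ℝ} (hs : 0 < s)
    (hS : Splits2 (fun q => Real.log (kap w V q)) (φ i x1, φ j x1) s) : False := by
  obtain ⟨ψ1, ψ2, ψ3, g1, g2, g3, a1, a2, a3, b1, b2, c1, c2, e1, e2, e3, hψ⟩ := S1_q h hs hS
  have w0 : w (φ i x1, φ j x1) = φ k x1 := hw.self_of_nhds
  simp only [w0] at a1 a2 a3 b1 b2 c1 c2 e1 e2 e3
  set Φ : E2 → E2 := fun x => WithLp.toLp 2 ![ψ1 (φ i x), ψ2 (φ j x)] with hΦ
  have aΦ : AnalyticAt ℝ Φ x1 := by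
    have p1 : AnalyticAt ℝ (fun x => ψ1 (φ i x)) x1 := AnalyticAt.fun_comp (g := ψ1) (f := φ i) a1 (hφ i)
    have p2 : AnalyticAt ℝ (fun x => ψ2 (φ j x)) x1 := AnalyticAt.fun_comp (g := ψ2) (f := φ j) a2 (hφ j)
    have p3 : AnalyticAt ℝ (fun x => ![ψ1 (φ i x), ψ2 (φ j x)]) x1 := by
      rw [analyticAt_pi_iff]
      intro l
      fin_cases l
      · exact p1
      · exact p2
    exact AnalyticAt.fun_comp (g := WithLp.toLp 2) (f := fun x => ![ψ1 (φ i x), ψ2 (φ j x)])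
      ((PiLp.continuousLinearEquiv 2 ℝ (fun _ : Fin 2 => ℝ)).symm.toContinuousLinearMap.analyticAt _) p3
  set Θ : E2 → E2 := fun y => Ψ (g1 (y 0), g2 (y 1)) with hΘ
  have aΘ : AnalyticAt ℝ Θ (Φ x1) := by
    have p : ∀ l : Fin 2, AnalyticAt ℝ (fun y : E2 => y l) (Φ x1) := fun l =>
      (prE l).analyticAt _
    have p1 : AnalyticAt ℝ (fun y : E2 => g1 (y 0)) (Φ x1) := AnalyticAt.fun_comp (g := g1) (f := fun y : E2 => y 0) b1 (p 0)
    have p2 : AnalyticAt ℝ (fun y : E2 => g2 (y 1)) (Φ x1) := AnalyticAt.fun_comp (g := g2) (f := fun y : E2 => y 1) b2 (p 1)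
    refine AnalyticAt.fun_comp (g := Ψ) (f := fun y : E2 => (g1 (y 0), g2 (y 1))) ?_ (p1.prod p2)
    have : ((g1 (Φ x1 0), g2 (Φ x1 1)) : ℝ × ℝ) = (φ i x1, φ j x1) := by
      simp only [hΦ]
      exact Prod.ext c1 c2
    rw [this]; exact aΨ
  have hi : ∀ᶠ x in 𝓝 x1, Θ (Φ x) = x := by
    filter_upwards [(hφ i).continuousAt.eventually e1, (hφ j).continuousAt.eventually e2, hΨ] with x h1 h2 h3
    change Ψ (g1 (ψ1 (φ i x)), g2 (ψ2 (φ j x))) = x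
    rw [h1, h2, h3]
  obtain ⟨N, hN, hinj, hopen⟩ := open_of_inv aΦ aΘ hi
  have tF : Filter.Tendsto (fun x => (φ i x, φ j x)) (𝓝 x1) (𝓝 (φ i x1, φ j x1)) :=
    (hφ i).continuousAt.prodMk_nhds (hφ j).continuousAt
  have hall : ∀ᶠ x in 𝓝 x1, x ∈ N ∧ x ∈ Metric.ball x₀ rad ∧ AnalyticAt ℝ Φ x ∧
      (AnalyticAt ℝ ψ1 (φ i x) ∧ AnalyticAt ℝ ψ2 (φ j x) ∧ AnalyticAt ℝ ψ3 (φ k x)) ∧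
      (g1 (ψ1 (φ i x)) = φ i x ∧ g2 (ψ2 (φ j x)) = φ j x ∧ g3 (ψ3 (φ k x)) = φ k x) ∧
      ψ3 (φ k x) = ψ1 (φ i x) + ψ2 (φ j x) := by
    filter_upwards [hN, Metric.isOpen_ball.mem_nhds hx1, aΦ.eventually_analyticAt, (hφ i).continuousAt.eventually a1.eventually_analyticAt,
      (hφ j).continuousAt.eventually a2.eventually_analyticAt, (hφ k).continuousAt.eventually a3.eventually_analyticAt,
      (hφ i).continuousAt.eventually e1, (hφ j).continuousAt.eventually e2, (hφ k).continuousAt.eventually e3,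
      tF.eventually hψ, hw] with x h1 h2 h3 h4 h5 h6 h7 h8 h9 h10 h11
    refine ⟨h1, h2, h3, ⟨h4, h5, h6⟩, ⟨h7, h8, h9⟩, ?_⟩
    rw [← h11]; exact h10
  obtain ⟨t, ht, hB⟩ := Metric.eventually_nhds_iff_ball.1 hall
  have hcase : ∀ l : Fin 3, l = i ∨ l = j ∨ l = k := by
    intro l
    by_cases hl : l = k
    · exact Or.inr (Or.inr hl)
    · rcases fin3_or hij hik hjk hl with h | h
      · exact Or.inl h
      · exact Or.inr (Or.inl h)
  have linj : ∀ (ψ g : ℝ → ℝ) (f : E2 → ℝ), (∀ x ∈ Metric.ball x1 t, g (ψ (f x)) = f x) → InjOn ψ (f '' Metric.ball x1 t) := by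
    rintro ψ g f H _ ⟨x, hx, rfl⟩ _ ⟨y, hy, rfl⟩ hxy
    rw [← H x hx, ← H y hy, hxy]
  refine hcurv ⟨Metric.ball x1 t, fun x hx => Metric.ball_subset_closedBall (hB x hx).2.1, Metric.isOpen_ball,
    ⟨x1, Metric.mem_ball_self ht⟩, (convex_ball _ _).isConnected ⟨x1, Metric.mem_ball_self ht⟩, Φ,
    fun l => if l = i then ψ1 else if l = j then ψ2 else ψ3,
    fun l => if l = i then prE 0
      else if l = j then prE 1
      else prE 0 + prE 1,
    fun _ => 0, fun x hx => (hB x hx).2.2.1, hinj.mono fun x hx => (hB x hx).1,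
    hopen _ (fun x hx => (hB x hx).1) Metric.isOpen_ball, fun l => ?_, fun l x hx => ?_⟩
  · rcases hcase l with rfl | rfl | rfl
    · simp only [if_true]
      refine ⟨?_, linj _ g1 _ fun x hx => (hB x hx).2.2.2.2.1.1⟩
      rintro _ ⟨x, hx, rfl⟩
      exact (hB x hx).2.2.2.1.1
    · simp only [if_neg hij.symm, if_true]
      refine ⟨?_, linj _ g2 _ fun x hx => (hB x hx).2.2.2.2.1.2.1⟩
      rintro _ ⟨x, hx, rfl⟩
      exact (hB x hx).2.2.2.1.2.1
    · simp only [if_neg hik.symm, if_neg hjk.symm]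
      refine ⟨?_, linj _ g3 _ fun x hx => (hB x hx).2.2.2.2.1.2.2⟩
      rintro _ ⟨x, hx, rfl⟩
      exact (hB x hx).2.2.2.1.2.2
  · have e := (hB x hx).2.2.2.2.2
    rcases hcase l with rfl | rfl | rfl
    · simp [hΦ, prE_apply]
    · simp [hΦ, if_neg hij.symm, prE_apply]
    · simp only [if_neg hik.symm, if_neg hjk.symm]
      rw [e]; simp [hΦ, prE_apply]

/-- nondegeneracy of the Jacobian determinant -/
lemma nondeg {x₀ : E2} {rad : ℝ} (hrad : 0 < rad) {Bt : Set E2} (hBto : IsOpen Bt) (hBBt : Metric.closedBall x₀ rad ⊆ Bt)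
    {a φ : Fin 3 → E2 → ℝ} (ha : ∀ j, AnalyticOnNhd ℝ (a j) Bt) (hφ : ∀ j, AnalyticOnNhd ℝ (φ j) Bt)
    (haNz : ∀ j, ∀ x ∈ Bt, a j x ≠ 0) {W : Fin 3 → E2 → E2} {i j k : Fin 3}
    (hij : i ≠ j) (hik : i ≠ k) (hjk : j ≠ k)
    (hcurv : ¬ ∃ V : Set E2,
      V ⊆ Metric.closedBall x₀ rad ∧ IsOpen V ∧ V.Nonempty ∧ IsConnected V ∧
      ∃ (Φ : E2 → E2) (ψ : Fin 3 → ℝ → ℝ) (L : Fin 3 → (E2 →L[ℝ] ℝ)) (c : Fin 3 → ℝ),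
        AnalyticOnNhd ℝ Φ V ∧ Set.InjOn Φ V ∧ IsOpen (Φ '' V) ∧
        (∀ j, AnalyticOnNhd ℝ (ψ j) (φ j '' V) ∧ Set.InjOn (ψ j) (φ j '' V)) ∧
        ∀ j, ∀ x ∈ V, ψ j (φ j x) = L j (Φ x) + c j)
    (hWφ : ∀ j, ∀ x ∈ Bt, fderiv ℝ (φ j) x (W j x) = 0)
    (hAux : ∀ k : Fin 3, ∀ U : Set E2,
      U ⊆ Metric.closedBall x₀ rad → IsOpen U → U.Nonempty → ∀ τ : ℝ,
      ∀ g : Fin 3 → ℝ → ℝ, (∀ i, i ≠ k → AnalyticOnNhd ℝ (g i) (φ i '' U)) →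
      (∀ x ∈ U, ∑ i ∈ Finset.univ.filter (fun i => i ≠ k),
          a i x * |fderiv ℝ (φ i) x (W k x)| ^ τ * g i (φ i x) = 0) →
      ∀ i, i ≠ k → ∀ y ∈ φ i '' U, g i y = 0)
    {p : E2} (hp : p ∈ Metric.closedBall x₀ rad)
    {w V U : ℝ × ℝ → ℝ} (h : LW (φ i p, φ j p) w V U) (hw : ∀ᶠ x in 𝓝 p, w (φ i x, φ j x) = φ k x)
    {Ψ : ℝ × ℝ → E2} (aΨ : AnalyticAt ℝ Ψ (φ i p, φ j p)) (hΨ : ∀ᶠ x in 𝓝 p, Ψ (φ i x, φ j x) = x)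
    {R : ℝ × ℝ → ℝ} (aR : AnalyticAt ℝ R (φ i p, φ j p)) (R0 : R (φ i p, φ j p) ≠ 0) {n : ℕ}
    (hR : ∀ᶠ x in 𝓝 p, R (φ i x, φ j x) = a i x / a j x * kap w V (φ i x, φ j x) ^ n) :
    ¬ ∀ᶠ t in 𝓝 ((φ i p, φ j p), (φ i p, φ j p)), Jdet (kap w V) R t = 0 := by
  intro hJ
  have hpB := hBBt hp
  have tF : ∀ x ∈ Bt, Filter.Tendsto (fun x => (φ i x, φ j x)) (𝓝 x) (𝓝 (φ i x, φ j x)) := fun x hx =>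
    (hφ i x hx).continuousAt.prodMk_nhds (hφ j x hx).continuousAt
  have hJ' : ∀ᶠ q in 𝓝 (φ i p, φ j p), ∀ᶠ t in 𝓝 (q, q), Jdet (kap w V) R t = 0 := by
    have : Filter.Tendsto (fun q : ℝ × ℝ => (q, q)) (𝓝 (φ i p, φ j p)) (𝓝 ((φ i p, φ j p), (φ i p, φ j p))) :=
      (continuous_id.prodMk continuous_id).tendsto _
    exact this.eventually hJ.eventually_nhds
  have hall : ∀ᶠ x in 𝓝 p, x ∈ Bt ∧ LW (φ i x, φ j x) w V U ∧ (∀ᶠ x in 𝓝 x, w (φ i x, φ j x) = φ k x) ∧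
      AnalyticAt ℝ Ψ (φ i x, φ j x) ∧ (∀ᶠ x in 𝓝 x, Ψ (φ i x, φ j x) = x) ∧
      (AnalyticAt ℝ R (φ i x, φ j x) ∧ R (φ i x, φ j x) ≠ 0) ∧
      (∀ᶠ x in 𝓝 x, R (φ i x, φ j x) = a i x / a j x * kap w V (φ i x, φ j x) ^ n) ∧
      ∀ᶠ t in 𝓝 ((φ i x, φ j x), (φ i x, φ j x)), Jdet (kap w V) R t = 0 := by
    filter_upwards [hBto.mem_nhds hpB, (tF p hpB).eventually h.eventually, hw.eventually_nhds,
      (tF p hpB).eventually aΨ.eventually_analyticAt, hΨ.eventually_nhds, (tF p hpB).eventually aR.eventually_analyticAt,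
      (tF p hpB).eventually (aR.continuousAt.eventually_ne R0), hR.eventually_nhds, (tF p hpB).eventually hJ']
      with x h1 h2 h3 h4 h5 h6 h7 h8 h9
    exact ⟨h1, h2, h3, h4, h5, ⟨h6, h7⟩, h8, h9⟩
  obtain ⟨x1, ⟨hB1, h1, hw1, aΨ1, hΨ1, aR1, hR1, hJ1⟩, hx1⟩ : ∃ x1, _ ∧ x1 ∈ Metric.ball x₀ rad := by
    have hc : p ∈ closure (Metric.ball x₀ rad) := by rwa [closure_ball _ hrad.ne']
    exact (mem_closure_iff_frequently.1 hc).and_eventually hall |>.exists.imp fun x hx => ⟨hx.2, hx.1⟩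
  have hq : ∀ᶠ q in 𝓝 (φ i x1, φ j x1), (AnalyticAt ℝ (kap w V) q ∧ kap w V q ≠ 0) ∧ (AnalyticAt ℝ R q ∧ R q ≠ 0) := by
    filter_upwards [h1.akap.eventually_analyticAt, h1.akap.continuousAt.eventually_ne h1.kap0,
      aR1.1.eventually_analyticAt, aR1.1.continuousAt.eventually_ne aR1.2] with q a b c d
    exact ⟨⟨a, b⟩, c, d⟩
  obtain ⟨s1, hs1, hq1⟩ := Metric.eventually_nhds_iff_ball.1 hq
  obtain ⟨s2, hs2, hq2⟩ := Metric.eventually_nhds_iff_ball.1 hJ1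
  have hs : 0 < min s1 s2 := lt_min hs1 hs2
  have hb1 := fun q (hq : q ∈ Metric.ball (φ i x1, φ j x1) (min s1 s2)) => Metric.ball_subset_ball (min_le_left _ _) hq
  have hb2 := fun q (hq : q ∈ Metric.ball (φ i x1, φ j x1) (min s1 s2)) => Metric.ball_subset_ball (min_le_right _ _) hq
  rcases split_alt (κ := kap w V) (r := R) hs (fun q hq => (hq1 q (hb1 q hq)).1) (fun q hq => (hq1 q (hb1 q hq)).2)
    (fun α hα β hβ => hq2 _ (by rw [← ball_prod_same]; exact ⟨hb2 α hα, hb2 β hβ⟩)) with hS | ⟨τ, hS⟩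
  · exact caseS1 hij hik hjk hcurv hx1 (fun l => hφ l x1 hB1) h1 hw1 aΨ1 hΨ1 hs hS
  · have tw : Filter.Tendsto (fun x => (φ i x, φ k x)) (𝓝 x1) (𝓝 (φ i x1, w (φ i x1, φ j x1))) := by
      rw [hw1.self_of_nhds]
      exact (hφ i x1 hB1).continuousAt.prodMk_nhds (hφ k x1 hB1).continuousAt
    refine caseS2 (W := W k) hij hik hjk (hAux k) hx1 (fun l => (hφ l x1 hB1).eventually_analyticAt) (fun l => ha l x1 hB1)
      (fun l => haNz l x1 hB1) ?_ ?_ hw1 (tw.eventually h1.aV.eventually_analyticAt) hR1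
      ((tF x1 hB1).eventually (h1.akap.continuousAt.eventually_ne h1.kap0)) hs hS
    · filter_upwards [hBto.mem_nhds hB1] with x hx
      exact hWφ k x hx
    · filter_upwards [(tF x1 hB1).eventually h1.Vw, hw1] with x h2 h3
      rw [← h3]; exact h2

lemma E2_ext_lin {L1 L2 : E2 →L[ℝ] ℝ} (h0 : L1 (EuclideanSpace.single 0 1) = L2 (EuclideanSpace.single 0 1))
    (h1 : L1 (EuclideanSpace.single 1 1) = L2 (EuclideanSpace.single 1 1)) : L1 = L2 := by
  ext x
  have hx : x = x 0 • EuclideanSpace.single 0 (1 : ℝ) + x 1 • EuclideanSpace.single 1 (1 : ℝ) := by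
    ext l; fin_cases l <;> simp
  rw [hx, map_add, map_add, map_smul, map_smul, map_smul, map_smul, h0, h1]

lemma pair_inj {L1 L2 : E2 →L[ℝ] ℝ} (h : LinearIndependent ℝ ![L1, L2]) :
    Function.Injective (L1.prod L2) := by
  rw [LinearIndependent.pair_iff] at h
  set a := L1 (EuclideanSpace.single 0 1) with ha
  set b := L1 (EuclideanSpace.single 1 1) with hb
  set c := L2 (EuclideanSpace.single 0 1) with hc
  set d := L2 (EuclideanSpace.single 1 1) with hd
  have hdet : a * d - b * c ≠ 0 := by
    intro h0
    have h1 := h d (-b) (E2_ext_lin (by simp [← ha, ← hc]; linarith) (by simp [← hb, ← hd]; ring))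
    have h2 := h c (-a) (E2_ext_lin (by simp [← ha, ← hc]; ring) (by simp [← hb, ← hd]; linarith))
    have h3 : b = 0 := by linarith [h1.2]
    have h4 : a = 0 := by linarith [h2.2]
    have := h 1 0 (E2_ext_lin (by simp [← ha, h4]) (by simp [← hb, h3]))
    exact one_ne_zero this.1
  rw [injective_iff_map_eq_zero]
  intro x hx
  have hx' : x = x 0 • EuclideanSpace.single 0 (1 : ℝ) + x 1 • EuclideanSpace.single 1 (1 : ℝ) := by
    ext l; fin_cases l <;> simp
  have e1 : L1 x = 0 := congrArg Prod.fst hx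
  have e2 : L2 x = 0 := congrArg Prod.snd hx
  rw [hx', map_add, map_smul, map_smul, ← ha, ← hb, smul_eq_mul, smul_eq_mul] at e1
  rw [hx', map_add, map_smul, map_smul, ← hc, ← hd, smul_eq_mul, smul_eq_mul] at e2
  have z0 : x 0 = 0 := by
    have : (a * d - b * c) * x 0 = 0 := by linear_combination d * e1 - b * e2
    exact (mul_eq_zero.1 this).resolve_left hdet
  have z1 : x 1 = 0 := by
    have : (a * d - b * c) * x 1 = 0 := by linear_combination a * e2 - c * e1
    exact (mul_eq_zero.1 this).resolve_left hdet
  rw [hx', z0, z1]; simp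

lemma chart {f g : E2 → ℝ} {p : E2} (hf : AnalyticAt ℝ f p) (hg : AnalyticAt ℝ g p)
    (h : LinearIndependent ℝ ![fderiv ℝ f p, fderiv ℝ g p]) :
    ∃ Ψ : ℝ × ℝ → E2, AnalyticAt ℝ Ψ (f p, g p) ∧ Ψ (f p, g p) = p ∧ (∀ᶠ x in 𝓝 p, Ψ (f x, g x) = x) ∧
      ∀ᶠ q in 𝓝 (f p, g p), f (Ψ q) = q.1 ∧ g (Ψ q) = q.2 := by
  have hF : AnalyticAt ℝ (fun x => (f x, g x)) p := hf.prod hg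
  have hd : fderiv ℝ (fun x => (f x, g x)) p = (fderiv ℝ f p).prod (fderiv ℝ g p) :=
    (hf.differentiableAt.hasFDerivAt.prodMk hg.differentiableAt.hasFDerivAt).fderiv
  have hfr : Module.finrank ℝ E2 = Module.finrank ℝ (ℝ × ℝ) := by simp
  let e : E2 ≃L[ℝ] ℝ × ℝ := (LinearEquiv.ofInjectiveOfFinrankEq ((fderiv ℝ f p).prod (fderiv ℝ g p) : E2 →ₗ[ℝ] ℝ × ℝ) (pair_inj h) hfr).toContinuousLinearEquiv
  obtain ⟨Ψ, h1, h2, h3, h4⟩ := analytic_inverse hF e (by rw [hd]; ext x <;> rfl)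
  refine ⟨Ψ, h1, h2, h3, ?_⟩
  filter_upwards [h4] with q hq
  exact ⟨congrArg Prod.fst hq, congrArg Prod.snd hq⟩

lemma meas_version2 {f : ℝ × ℝ → E2} {x0 : ℝ × ℝ} (hf : AnalyticAt ℝ f x0) :
    ∃ g : ℝ × ℝ → E2, Measurable g ∧ g =ᶠ[𝓝 x0] f := by
  classical
  obtain ⟨ρ, hρ, h1⟩ := Metric.nhds_basis_closedBall.eventually_iff.1 hf.eventually_analyticAt
  refine ⟨(Metric.closedBall x0 ρ).piecewise f (fun _ => 0), ?_, ?_⟩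
  · have hc : ContinuousOn f (Metric.closedBall x0 ρ) := fun x hx => (h1 hx).continuousAt.continuousWithinAt
    exact ContinuousOn.measurable_piecewise hc continuousOn_const Metric.isClosed_closedBall.measurableSet
  · filter_upwards [Metric.closedBall_mem_nhds x0 hρ] with x hx
    simp [Set.piecewise, hx]

/-- local data at a point -/
structure Chart (p : E2) (φi φj φk ai aj ak : E2 → ℝ) (Ψ : ℝ × ℝ → E2) (w V U A B : ℝ × ℝ → ℝ) : Prop where
  lw : LW (φi p, φj p) w V U
  mΨ : Measurable Ψ
  aΨ : AnalyticAt ℝ Ψ (φi p, φj p)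
  Ψ0 : Ψ (φi p, φj p) = p
  ΨF : ∀ᶠ x in 𝓝 p, Ψ (φi x, φj x) = x
  FΨ : ∀ᶠ q in 𝓝 (φi p, φj p), φi (Ψ q) = q.1 ∧ φj (Ψ q) = q.2
  hw : ∀ᶠ q in 𝓝 (φi p, φj p), w q = φk (Ψ q)
  mA : Measurable A
  mB : Measurable B
  aA : AnalyticAt ℝ A (φi p, φj p)
  aB : AnalyticAt ℝ B (φi p, φj p)
  hA : ∀ᶠ q in 𝓝 (φi p, φj p), A q = ai (Ψ q) / ak (Ψ q)
  hB : ∀ᶠ q in 𝓝 (φi p, φj p), B q = aj (Ψ q) / ak (Ψ q)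

lemma exists_chart {p : E2} {φi φj φk ai aj ak : E2 → ℝ} (hi : AnalyticAt ℝ φi p) (hj : AnalyticAt ℝ φj p) (hk : AnalyticAt ℝ φk p)
    (bi : AnalyticAt ℝ ai p) (bj : AnalyticAt ℝ aj p) (bk : AnalyticAt ℝ ak p) (bk0 : ak p ≠ 0)
    (hij : LinearIndependent ℝ ![fderiv ℝ φi p, fderiv ℝ φj p]) (hik : LinearIndependent ℝ ![fderiv ℝ φi p, fderiv ℝ φk p])
    (hjk : LinearIndependent ℝ ![fderiv ℝ φj p, fderiv ℝ φk p]) :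
    ∃ Ψ w V U A B, Chart p φi φj φk ai aj ak Ψ w V U A B := by
  obtain ⟨Ψ', aΨ', h0', hΨF', hFΨ'⟩ := chart hi hj hij
  obtain ⟨Ψ1, aΨ1, h01, hΨF1, hFΨ1⟩ := chart hi hk hik
  obtain ⟨Ψ2, aΨ2, h02, hΨF2, hFΨ2⟩ := chart hj hk hjk
  obtain ⟨Ψ, mΨ, eΨ⟩ := meas_version2 aΨ'
  have tF : ∀ (f g : E2 → ℝ), AnalyticAt ℝ f p → AnalyticAt ℝ g p → Filter.Tendsto (fun x => (f x, g x)) (𝓝 p) (𝓝 (f p, g p)) :=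
    fun f g hf hg => hf.continuousAt.prodMk_nhds hg.continuousAt
  have aΨ : AnalyticAt ℝ Ψ (φi p, φj p) := aΨ'.congr eΨ.symm
  have h0 : Ψ (φi p, φj p) = p := eΨ.self_of_nhds.trans h0'
  have hΨF : ∀ᶠ x in 𝓝 p, Ψ (φi x, φj x) = x := by
    filter_upwards [hΨF', (tF _ _ hi hj).eventually eΨ] with x h1 h2
    exact h2.trans h1
  have hFΨ : ∀ᶠ q in 𝓝 (φi p, φj p), φi (Ψ q) = q.1 ∧ φj (Ψ q) = q.2 := by
    filter_upwards [hFΨ', eΨ] with q h1 h2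
    rw [h2]; exact h1
  have tΨ : Filter.Tendsto Ψ (𝓝 (φi p, φj p)) (𝓝 p) := by
    have := aΨ.continuousAt.tendsto; rwa [h0] at this
  have tΨ1 : Filter.Tendsto Ψ1 (𝓝 (φi p, φk p)) (𝓝 p) := by
    have := aΨ1.continuousAt.tendsto; rwa [h01] at this
  have tΨ2 : Filter.Tendsto Ψ2 (𝓝 (φj p, φk p)) (𝓝 p) := by
    have := aΨ2.continuousAt.tendsto; rwa [h02] at this
  have cmp : ∀ {f : E2 → ℝ}, AnalyticAt ℝ f p → AnalyticAt ℝ (fun q => f (Ψ q)) (φi p, φj p) := by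
    intro f hf
    exact AnalyticAt.fun_comp (g := f) (f := Ψ) (by rw [h0]; exact hf) aΨ
  have cmp1 : ∀ {f : E2 → ℝ}, AnalyticAt ℝ f p → AnalyticAt ℝ (fun q => f (Ψ1 q)) (φi p, φk p) := by
    intro f hf
    exact AnalyticAt.fun_comp (g := f) (f := Ψ1) (by rw [h01]; exact hf) aΨ1
  have cmp2 : ∀ {f : E2 → ℝ}, AnalyticAt ℝ f p → AnalyticAt ℝ (fun q => f (Ψ2 q)) (φj p, φk p) := by
    intro f hf
    exact AnalyticAt.fun_comp (g := f) (f := Ψ2) (by rw [h02]; exact hf) aΨ2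
  obtain ⟨w, mw, ew⟩ := meas_version (cmp hk)
  obtain ⟨V, mV, eV⟩ := meas_version (cmp1 hj)
  obtain ⟨U, mU, eU⟩ := meas_version (cmp2 hi)
  have dA : AnalyticAt ℝ (fun q => ai (Ψ q) / ak (Ψ q)) (φi p, φj p) := (cmp bi).div (cmp bk) (by rw [h0]; exact bk0)
  have dB : AnalyticAt ℝ (fun q => aj (Ψ q) / ak (Ψ q)) (φi p, φj p) := (cmp bj).div (cmp bk) (by rw [h0]; exact bk0)
  obtain ⟨A, mA, eA⟩ := meas_version dA
  obtain ⟨B, mB, eB⟩ := meas_version dB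
  have w0 : w (φi p, φj p) = φk p := by
    have := ew.self_of_nhds
    simp only [h0] at this
    exact this
  -- on the x side
  have xw : ∀ᶠ x in 𝓝 p, w (φi x, φj x) = φk x := by
    filter_upwards [(tF _ _ hi hj).eventually ew, hΨF] with x h1 h2
    rw [h1, h2]
  have xV : ∀ᶠ x in 𝓝 p, V (φi x, φk x) = φj x := by
    filter_upwards [(tF _ _ hi hk).eventually eV, hΨF1] with x h1 h2
    rw [h1, h2]
  have xU : ∀ᶠ x in 𝓝 p, U (φj x, φk x) = φi x := by
    filter_upwards [(tF _ _ hj hk).eventually eU, hΨF2] with x h1 h2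
    rw [h1, h2]
  refine ⟨Ψ, w, V, U, A, B, ⟨(cmp hk).congr ew.symm, ?_, ?_, ?_, ?_, ?_, ?_, mw, mV, mU⟩, mΨ, aΨ, h0, hΨF, hFΨ, ew, mA, mB,
    dA.congr eA.symm, dB.congr eB.symm, eA, eB⟩
  · rw [w0]; exact (cmp1 hj).congr eV.symm
  · rw [w0]; exact (cmp2 hi).congr eU.symm
  · filter_upwards [tΨ.eventually xw, tΨ.eventually xV, hFΨ] with q h1 h2 h3
    rw [h3.1, h3.2] at h1
    rw [h3.1, h3.2, ← h1] at h2
    exact h2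
  · filter_upwards [tΨ.eventually xw, tΨ.eventually xU, hFΨ] with q h1 h2 h3
    rw [h3.1, h3.2] at h1
    rw [h3.1, h3.2, ← h1] at h2
    exact h2
  · rw [w0]
    filter_upwards [tΨ1.eventually xw, tΨ1.eventually xV, hFΨ1] with t h1 h2 h3
    rw [h3.1, h3.2] at h2
    rw [h3.1, h3.2, ← h2] at h1
    exact h1
  · rw [w0]
    filter_upwards [tΨ2.eventually xw, tΨ2.eventually xU, hFΨ2] with t h1 h2 h3
    rw [h3.1, h3.2] at h2
    rw [h3.1, h3.2, ← h2] at h1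
    exact h1

/-- polynomial loss function -/
def Ls (N : ℕ) (μ : ℝ) : ℝ := (μ / N) ^ N

lemma Ls_pos {N : ℕ} (hN : 1 ≤ N) {μ : ℝ} (hμ : 0 < μ) : 0 < Ls N μ := by
  have : (0 : ℝ) < N := by exact_mod_cast hN
  unfold Ls; positivity

lemma Ls_le {N : ℕ} (hN : 1 ≤ N) {μ : ℝ} (hμ : 0 < μ) (h1 : μ ≤ 1) : Ls N μ ≤ μ := by
  have hN' : (1 : ℝ) ≤ N := by exact_mod_cast hN
  have h0 : μ / N ≤ μ := div_le_self hμ.le hN'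
  have h2 : 0 ≤ μ / N := by positivity
  unfold Ls
  calc (μ / N) ^ N ≤ (μ / N) ^ 1 := pow_le_pow_of_le_one h2 (h0.trans h1) hN
    _ ≤ μ := by rw [pow_one]; exact h0

lemma Ls_anti {N M : ℕ} (hN : 1 ≤ N) (hNM : N ≤ M) {μ : ℝ} (hμ : 0 < μ) (h1 : μ ≤ 1) : Ls M μ ≤ Ls N μ := by
  have hN' : (1 : ℝ) ≤ N := by exact_mod_cast hN
  have hM' : (N : ℝ) ≤ M := by exact_mod_cast hNM
  have h2 : 0 ≤ μ / M := by positivity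
  have h3 : μ / M ≤ μ / N := by gcongr
  have h4 : μ / N ≤ 1 := (div_le_self hμ.le hN').trans h1
  unfold Ls
  calc (μ / M) ^ M ≤ (μ / M) ^ N := pow_le_pow_of_le_one h2 (h3.trans h4) hNM
    _ ≤ _ := pow_le_pow_left₀ h2 h3 N

lemma Ls_mono {N : ℕ} {μ ν : ℝ} (hμ : 0 < μ) (h1 : μ ≤ ν) : Ls N μ ≤ Ls N ν := by
  unfold Ls; gcongr

lemma Ls_poly {c : ℝ} (hc : 0 < c) (k : ℕ) : ∀ᶠ N : ℕ in Filter.atTop, ∀ μ : ℝ, 0 < μ → μ ≤ 1 → Ls N μ ≤ c * μ ^ k := by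
  obtain ⟨n, hn⟩ := exists_nat_gt (1 / c)
  filter_upwards [Filter.eventually_ge_atTop n, Filter.eventually_ge_atTop k, Filter.eventually_ge_atTop 1] with N h1 h2 h3 μ hμ hμ1
  have hN : (1 : ℝ) ≤ N := by exact_mod_cast h3
  have hn' : (n : ℝ) ≤ N := by exact_mod_cast h1
  unfold Ls
  rw [div_pow, div_le_iff₀ (by positivity)]
  have e1 : μ ^ N ≤ μ ^ k := pow_le_pow_of_le_one hμ.le hμ1 h2
  have e2 : (N : ℝ) ≤ (N : ℝ) ^ N := by
    calc (N : ℝ) = (N : ℝ) ^ 1 := (pow_one _).symm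
      _ ≤ _ := pow_le_pow_right₀ hN h3
  have e3 : 1 ≤ c * (N : ℝ) ^ N := by
    have : 1 < c * n := by rwa [div_lt_iff₀' hc] at hn
    nlinarith
  have : 0 ≤ μ ^ k := by positivity
  nlinarith

lemma Ls_comp (P : ℕ) (hP : 1 ≤ P) : ∀ᶠ N : ℕ in Filter.atTop, ∀ μ : ℝ, 0 < μ → μ ≤ 1 → Ls N μ ≤ Ls P (Ls P μ) := by
  have hP' : (0 : ℝ) < P := by exact_mod_cast hP
  filter_upwards [Ls_poly (c := ((1 / (P : ℝ)) ^ P / P) ^ P) (by positivity) (P * P)] with N h μ h1 h2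
  refine (h μ h1 h2).trans (le_of_eq ?_)
  unfold Ls
  rw [pow_mul, ← mul_pow]
  congr 1
  rw [div_pow, div_pow, one_pow]; field_simp

lemma Ls_sq (P : ℕ) (hP : 1 ≤ P) : ∀ᶠ N : ℕ in Filter.atTop, ∀ μ : ℝ, 0 < μ → μ ≤ 1 → Ls N μ ≤ (Ls P μ) ^ 2 / 2 := by
  have hP' : (0 : ℝ) < P := by exact_mod_cast hP
  filter_upwards [Ls_poly (c := ((1 / (P : ℝ)) ^ P) ^ 2 / 2) (by positivity) (P * 2)] with N h μ h1 h2
  refine (h μ h1 h2).trans (le_of_eq ?_)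
  unfold Ls
  rw [pow_mul, div_pow, div_pow, one_pow]; simp only [div_pow]; field_simp

section
variable {Z : Type} (Hyp : Z → E2 → Prop) (Cond : Z → ℝ → Prop) (Concl : Z → ℝ → Set E2 → Prop)

def Loc (N : ℕ) (B : Set E2) : Prop :=
  ∀ z μ, 0 < μ → μ ≤ 1 → Cond z (Ls N μ) → ∀ S, MeasurableSet S → S ⊆ B → ENNReal.ofReal μ ≤ volume S →
    (∀ x ∈ S, Hyp z x) →
    ∃ S', MeasurableSet S' ∧ S' ⊆ S ∧ ENNReal.ofReal (Ls N μ) ≤ volume S' ∧ Concl z (Ls N μ) S'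

variable {Hyp Cond Concl}

lemma loc_glob (hC : ∀ z ℓ ℓ', 0 < ℓ → ℓ ≤ ℓ' → Cond z ℓ → Cond z ℓ')
    (hD : ∀ z ℓ ℓ' S, 0 < ℓ → ℓ ≤ ℓ' → Cond z ℓ → Concl z ℓ' S → Concl z ℓ S) (x₀ : E2) (r : ℝ)
    (h : ∀ p ∈ Metric.closedBall x₀ r, ∃ s > 0, ∀ᶠ N in Filter.atTop, Loc Hyp Cond Concl N (Metric.closedBall p s)) :
    ∀ᶠ N in Filter.atTop, Loc Hyp Cond Concl N (Metric.closedBall x₀ r) := by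
  choose! s hs hl using h
  obtain ⟨t, ht, hcov⟩ := (isCompact_closedBall x₀ r).elim_nhds_subcover (fun p => Metric.closedBall p (s p))
    (fun p hp => Metric.closedBall_mem_nhds p (hs p hp))
  have h1 : ∀ᶠ N in Filter.atTop, ∀ p ∈ t, Loc Hyp Cond Concl N (Metric.closedBall p (s p)) :=
    (Filter.eventually_all_finset t).2 fun p hp => hl p (ht p hp)
  obtain ⟨M, hM, hM1⟩ := (h1.and (Filter.eventually_ge_atTop 1)).exists
  have hM' : (0 : ℝ) < M := by exact_mod_cast hM1
  filter_upwards [Ls_poly (c := (1 / ((t.card + 1 : ℝ) * M)) ^ M) (by positivity) M, Filter.eventually_ge_atTop 1] with N hN hN1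
  intro z μ hμ hμ1 hc S mS hS hvol hyp
  set n : ℝ := t.card + 1 with hn
  have hn1 : 1 ≤ n := by simp [hn]
  have hν0 : 0 < μ / n := by positivity
  have hν1 : μ / n ≤ 1 := (div_le_self hμ.le hn1).trans hμ1
  have hle : Ls N μ ≤ Ls M (μ / n) := by
    refine (hN μ hμ hμ1).trans (le_of_eq ?_)
    unfold Ls
    rw [← mul_pow]; congr 1; field_simp
  have hpos := Ls_pos hN1 hμ
  have : ∃ p ∈ t, ENNReal.ofReal (μ / n) ≤ volume (S ∩ Metric.closedBall p (s p)) := by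
    by_contra! hcon
    have h2 : volume S ≤ ∑ p ∈ t, volume (S ∩ Metric.closedBall p (s p)) := by
      refine le_trans (measure_mono ?_) (measure_biUnion_finset_le t _)
      intro x hx
      have := hcov (hS hx)
      simp only [mem_iUnion] at this ⊢
      obtain ⟨p, hp, hx'⟩ := this
      exact ⟨p, hp, hx, hx'⟩
    have h3 : ∑ p ∈ t, volume (S ∩ Metric.closedBall p (s p)) ≤ ∑ p ∈ t, ENNReal.ofReal (μ / n) :=
      Finset.sum_le_sum fun p hp => (hcon p hp).le
    rw [Finset.sum_const, ← ENNReal.ofReal_nsmul] at h3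
    have h4 := hvol.trans (h2.trans h3)
    have h5 : (t.card • (μ / n) : ℝ) < μ := by
      rw [nsmul_eq_mul, ← mul_div_assoc, div_lt_iff₀ (by positivity), hn]; nlinarith
    exact absurd h4 (not_le.2 ((ENNReal.ofReal_lt_ofReal_iff hμ).2 h5))
  obtain ⟨p, hp, hv⟩ := this
  obtain ⟨S', a1, a2, a3, a4⟩ := hM p hp z (μ / n) hν0 hν1 (hC z _ _ hpos hle hc) (S ∩ Metric.closedBall p (s p))
    (mS.inter Metric.isClosed_closedBall.measurableSet) inter_subset_right hv (fun x hx => hyp x hx.1)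
  exact ⟨S', a1, a2.trans inter_subset_left, (ENNReal.ofReal_le_ofReal hle).trans a3, hD z _ _ _ hpos hle hc a4⟩

end

lemma sum3 {i j k : Fin 3} (hij : i ≠ j) (hik : i ≠ k) (hjk : j ≠ k) (g : Fin 3 → ℝ) : ∑ l, g l = g i + g j + g k := by
  rw [Fin.sum_univ_three]
  fin_cases i <;> fin_cases j <;> fin_cases k <;> first | exact absurd rfl hij | exact absurd rfl hik | exact absurd rfl hjk | (simp; try ring)

/-- coordinates -/
def eE : E2 ≃ᵐ ℝ × ℝ := (MeasurableEquiv.toLp 2 (Fin 2 → ℝ)).symm.trans MeasurableEquiv.finTwoArrow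

lemma eE_apply (x : E2) : eE x = (x 0, x 1) := rfl

lemma eE_mp : MeasurePreserving eE volume volume :=
  (volume_preserving_finTwoArrow ℝ).comp (EuclideanSpace.volume_preserving_symm_measurableEquiv_toLp (Fin 2))

lemma eE_dist1 (x y : E2) : dist (eE x) (eE y) ≤ dist x y := by
  rw [eE_apply, eE_apply, Prod.dist_eq, EuclideanSpace.dist_eq, Fin.sum_univ_two]
  refine max_le ?_ ?_
  · exact Real.le_sqrt_of_sq_le (by nlinarith [sq_nonneg (dist (x 1) (y 1))])
  · exact Real.le_sqrt_of_sq_le (by nlinarith [sq_nonneg (dist (x 0) (y 0))])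

lemma eE_dist2 (x y : E2) : dist x y ≤ 2 * dist (eE x) (eE y) := by
  rw [eE_apply, eE_apply, Prod.dist_eq, EuclideanSpace.dist_eq, Fin.sum_univ_two]
  have h1 : dist (x 0) (y 0) ≤ max (dist (x 0) (y 0)) (dist (x 1) (y 1)) := le_max_left _ _
  have h2 : dist (x 1) (y 1) ≤ max (dist (x 0) (y 0)) (dist (x 1) (y 1)) := le_max_right _ _
  have h3 : 0 ≤ dist (x 0) (y 0) := dist_nonneg
  have h4 : 0 ≤ dist (x 1) (y 1) := dist_nonneg
  refine Real.sqrt_le_iff.2 ⟨by linarith, ?_⟩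
  dsimp only at *
  nlinarith

lemma antilip_E2 (F : E2 → ℝ × ℝ) (s : Set E2) (A : Set (ℝ × ℝ)) (c : ℝ) (hc : 0 < c)
    (h : ∀ x ∈ s, ∀ y ∈ s, c * dist x y ≤ dist (F x) (F y)) :
    volume (s ∩ F ⁻¹' A) ≤ ENNReal.ofReal (c⁻¹ ^ 2) * volume A := by
  have := antilip_two (fun q => F (eE.symm q)) (eE.symm ⁻¹' s) A c hc (by
    intro u hu v hv
    refine le_trans ?_ (h _ hu _ hv)
    have := eE_dist1 (eE.symm u) (eE.symm v)
    rw [MeasurableEquiv.apply_symm_apply, MeasurableEquiv.apply_symm_apply] at this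
    gcongr)
  have e := (eE_mp.symm eE).measure_preimage_equiv (s ∩ F ⁻¹' A)
  rw [← e]
  exact this

lemma antilip_E2' (Ψ : ℝ × ℝ → E2) (s : Set (ℝ × ℝ)) (A : Set E2) (c : ℝ) (hc : 0 < c)
    (h : ∀ x ∈ s, ∀ y ∈ s, c * dist x y ≤ dist (Ψ x) (Ψ y)) :
    volume (s ∩ Ψ ⁻¹' A) ≤ ENNReal.ofReal ((c / 2)⁻¹ ^ 2) * volume A := by
  have := antilip_two (fun q => eE (Ψ q)) s (eE.symm ⁻¹' A) (c / 2) (by positivity) (by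
    intro u hu v hv
    have h1 := h _ hu _ hv
    have h2 := eE_dist2 (Ψ u) (Ψ v)
    linarith)
  have e := (eE_mp.symm eE).measure_preimage_equiv A
  rw [← e]
  refine le_trans (measure_mono ?_) this
  intro q hq
  exact ⟨hq.1, by simpa using hq.2⟩

/-- transfer data between a ball around p and a square in the chart -/
structure Transf (φi φj φk ai aj ak : E2 → ℝ) (Ψ : ℝ × ℝ → E2) (w A B : ℝ × ℝ → ℝ) (Bp : Set E2) (Q : Set (ℝ × ℝ)) (K : ℝ) : Prop where
  mQ : MeasurableSet Q
  mΨ : Measurable Ψ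
  mp : ∀ x ∈ Bp, (φi x, φj x) ∈ Q
  ΨF : ∀ x ∈ Bp, Ψ (φi x, φj x) = x
  FΨ : ∀ q ∈ Q, φi (Ψ q) = q.1 ∧ φj (Ψ q) = q.2
  hw : ∀ q ∈ Q, w q = φk (Ψ q)
  hA : ∀ q ∈ Q, A q = ai (Ψ q) / ak (Ψ q)
  hB : ∀ q ∈ Q, B q = aj (Ψ q) / ak (Ψ q)
  ak1 : ∀ q ∈ Q, 1 ≤ K * |ak (Ψ q)|
  v1 : ∀ S ⊆ Bp, volume S ≤ ENNReal.ofReal K * volume {q ∈ Q | Ψ q ∈ S}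
  v2 : ∀ S : Set E2, ∀ S'' ⊆ {q ∈ Q | Ψ q ∈ S}, volume S'' ≤ ENNReal.ofReal K * volume {x ∈ S | (φi x, φj x) ∈ S''}
  ms : ∀ S, MeasurableSet S → S ⊆ Bp → ∀ S'', MeasurableSet S'' → MeasurableSet {x ∈ S | (φi x, φj x) ∈ S''}

lemma Chart.transf {p : E2} {φi φj φk ai aj ak : E2 → ℝ} {Ψ : ℝ × ℝ → E2} {w V U A B : ℝ × ℝ → ℝ}
    (h : Chart p φi φj φk ai aj ak Ψ w V U A B) (hi : AnalyticAt ℝ φi p) (hj : AnalyticAt ℝ φj p)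
    (bk : ContinuousAt ak p) (bk0 : ak p ≠ 0) :
    ∃ K : ℝ, 1 ≤ K ∧ ∀ᶠ s in 𝓝[>] (0 : ℝ), ∃ s' > 0,
      Transf φi φj φk ai aj ak Ψ w A B (Metric.closedBall p s') (Metric.closedBall (φi p, φj p) s) K := by
  have tF : ContinuousAt (fun x => (φi x, φj x)) p := hi.continuousAt.prodMk hj.continuousAt
  have aF : AnalyticAt ℝ (fun x => (φi x, φj x)) p := hi.prod hj
  have tΨ : Filter.Tendsto Ψ (𝓝 (φi p, φj p)) (𝓝 p) := by
    have := h.aΨ.continuousAt.tendsto; rwa [h.Ψ0] at this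
  obtain ⟨K1, hK1, t1, ht1, l1⟩ := ev_lipt aF
  obtain ⟨K2, hK2, t2, ht2, l2⟩ := ev_lipt h.aΨ
  obtain ⟨K3, hK3, l3⟩ := ev_lb (f := fun q => ak (Ψ q)) (x0 := (φi p, φj p))
    (ContinuousAt.comp' (by rw [h.Ψ0]; exact bk) h.aΨ.continuousAt) (by simp only [h.Ψ0]; exact bk0)
  set C1 : ℝ := K1 + 1
  set C2 : ℝ := K2 + 1
  have hC1 : 1 ≤ C1 := by simp only [C1]; linarith
  have hC2 : 1 ≤ C2 := by simp only [C2]; linarith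
  set K : ℝ := K3 + (C2⁻¹⁻¹) ^ 2 + ((C1⁻¹ / 2)⁻¹) ^ 2 with hK
  have p1 : 0 ≤ (C2⁻¹⁻¹) ^ 2 := by positivity
  have p2 : 0 ≤ ((C1⁻¹ / 2)⁻¹) ^ 2 := by positivity
  have p3 : 1 ≤ (C2⁻¹⁻¹) ^ 2 := by rw [inv_inv]; nlinarith
  refine ⟨K, by linarith, ?_⟩
  filter_upwards [l3, ev_closedBall ht2, ev_closedBall (tΨ.eventually ht1), ev_closedBall h.FΨ, ev_closedBall h.hw,
    ev_closedBall h.hA, ev_closedBall h.hB, ev_pos] with s a1 a2 a3 a4 a5 a6 a7 a8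
  have evx : ∀ᶠ x in 𝓝 p, (φi x, φj x) ∈ Metric.closedBall (φi p, φj p) s ∧ Ψ (φi x, φj x) = x ∧ AnalyticAt ℝ (fun x => (φi x, φj x)) x :=
    (tF.eventually (Metric.closedBall_mem_nhds _ a8)).and (h.ΨF.and aF.eventually_analyticAt)
  obtain ⟨s', hs', b1⟩ := Metric.nhds_basis_closedBall.eventually_iff.1 evx
  refine ⟨s', hs', ⟨Metric.isClosed_closedBall.measurableSet, h.mΨ, fun x hx => (b1 hx).1, fun x hx => (b1 hx).2.1, a4, a5, a6, a7, ?_, ?_, ?_, ?_⟩⟩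
  · intro q hq
    have := a1 q hq
    rw [Real.norm_eq_abs] at this
    refine this.trans (mul_le_mul_of_nonneg_right (by linarith) (abs_nonneg _))
  · intro S hS
    have := antilip_E2 (fun x => (φi x, φj x)) S {q ∈ Metric.closedBall (φi p, φj p) s | Ψ q ∈ S} C2⁻¹ (by positivity) (by
      intro x hx y hy
      have e := l2 _ (a2 _ (b1 (hS hx)).1) _ (a2 _ (b1 (hS hy)).1)
      rw [(b1 (hS hx)).2.1, (b1 (hS hy)).2.1, ← dist_eq_norm, ← dist_eq_norm] at e
      rw [inv_mul_le_iff₀ (by positivity)]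
      refine e.trans (mul_le_mul_of_nonneg_right (by simp only [C2]; linarith) dist_nonneg))
    refine le_trans (measure_mono ?_) (this.trans ?_)
    · intro x hx
      exact ⟨hx, (b1 (hS hx)).1, by rw [(b1 (hS hx)).2.1]; exact hx⟩
    · gcongr; linarith
  · intro S S'' hS
    have := antilip_E2' Ψ S'' {x ∈ S | (φi x, φj x) ∈ S''} C1⁻¹ (by positivity) (by
      intro x hx y hy
      have e := l1 _ (a3 _ (hS hx).1) _ (a3 _ (hS hy).1)
      simp only [(a4 _ (hS hx).1).1, (a4 _ (hS hx).1).2, (a4 _ (hS hy).1).1, (a4 _ (hS hy).1).2] at e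
      rw [← dist_eq_norm, ← dist_eq_norm] at e
      rw [inv_mul_le_iff₀ (by positivity)]
      refine e.trans (mul_le_mul_of_nonneg_right (by simp only [C1]; linarith) dist_nonneg))
    refine le_trans (measure_mono ?_) (this.trans ?_)
    · intro q hq
      refine ⟨hq, (hS hq).2, ?_⟩
      rw [(a4 _ (hS hq).1).1, (a4 _ (hS hq).1).2]; exact hq
    · gcongr; linarith
  · classical
    intro S mS hS S'' mS''
    have hc : ContinuousOn (fun x => (φi x, φj x)) (Metric.closedBall p s') := fun x hx => (b1 hx).2.2.continuousAt.continuousWithinAt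
    have mm := ContinuousOn.measurable_piecewise hc (continuousOn_const (c := (0 : ℝ × ℝ))) Metric.isClosed_closedBall.measurableSet
    convert mS.inter (mm mS'') using 1
    ext x
    constructor
    · rintro ⟨hx, hx'⟩
      refine ⟨hx, ?_⟩
      simp only [mem_preimage, Set.piecewise, hS hx, if_true]; exact hx'
    · rintro ⟨hx, hx'⟩
      refine ⟨hx, ?_⟩
      simp only [mem_preimage, Set.piecewise, hS hx, if_true] at hx'; exact hx'

/-- the standing hypotheses -/
structure Web (x₀ : E2) (rad : ℝ) (Bt : Set E2) (a φ : Fin 3 → E2 → ℝ) (W : Fin 3 → E2 → E2) : Prop where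
  hr : 0 < rad
  hBto : IsOpen Bt
  hBBt : Metric.closedBall x₀ rad ⊆ Bt
  ha : ∀ j, AnalyticOnNhd ℝ (a j) Bt
  hφ : ∀ j, AnalyticOnNhd ℝ (φ j) Bt
  haNz : ∀ j, ∀ x ∈ Bt, a j x ≠ 0
  hInd : ∀ i j : Fin 3, i ≠ j → ∀ x ∈ Bt, LinearIndependent ℝ ![fderiv ℝ (φ i) x, fderiv ℝ (φ j) x]
  hcurv : ¬ ∃ V : Set E2,
      V ⊆ Metric.closedBall x₀ rad ∧ IsOpen V ∧ V.Nonempty ∧ IsConnected V ∧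
      ∃ (Φ : E2 → E2) (ψ : Fin 3 → ℝ → ℝ) (L : Fin 3 → (E2 →L[ℝ] ℝ)) (c : Fin 3 → ℝ),
        AnalyticOnNhd ℝ Φ V ∧ Set.InjOn Φ V ∧ IsOpen (Φ '' V) ∧
        (∀ j, AnalyticOnNhd ℝ (ψ j) (φ j '' V) ∧ Set.InjOn (ψ j) (φ j '' V)) ∧
        ∀ j, ∀ x ∈ V, ψ j (φ j x) = L j (Φ x) + c j
  hWφ : ∀ j, ∀ x ∈ Bt, fderiv ℝ (φ j) x (W j x) = 0
  hAux : ∀ k : Fin 3, ∀ U : Set E2,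
      U ⊆ Metric.closedBall x₀ rad → IsOpen U → U.Nonempty → ∀ τ : ℝ,
      ∀ g : Fin 3 → ℝ → ℝ, (∀ i, i ≠ k → AnalyticOnNhd ℝ (g i) (φ i '' U)) →
      (∀ x ∈ U, ∑ i ∈ Finset.univ.filter (fun i => i ≠ k),
          a i x * |fderiv ℝ (φ i) x (W k x)| ^ τ * g i (φ i x) = 0) →
      ∀ i, i ≠ k → ∀ y ∈ φ i '' U, g i y = 0

lemma Web.loc_data {x₀ : E2} {rad : ℝ} {Bt : Set E2} {a φ : Fin 3 → E2 → ℝ} {W : Fin 3 → E2 → E2} (H : Web x₀ rad Bt a φ W)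
    {i j k : Fin 3} (hij : i ≠ j) (hik : i ≠ k) (hjk : j ≠ k) {p : E2} (hp : p ∈ Metric.closedBall x₀ rad) :
    ∃ (Ψ : ℝ × ℝ → E2) (w V U A B : ℝ × ℝ → ℝ) (c c' K K1 s' : ℝ) (I J : Set ℝ), 1 ≤ K1 ∧ 0 < s' ∧
      Transf (φ i) (φ j) (φ k) (a i) (a j) (a k) Ψ w A B (Metric.closedBall p s') (I ×ˢ J) K1 ∧
      Geo I J w V U (fun q => A q / B q) (Jdet (kap w V) (fun q => A q / B q)) K c ∧
      Geo I J w V U (fun q => A q * kap w V q / B q) (Jdet (kap w V) (fun q => A q * kap w V q / B q)) K c' ∧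
      GeoW I J w V K ∧ GeoA I J w V A B K ∧ GeoB I J w V A B (kap w V) K := by
  have hpB := H.hBBt hp
  obtain ⟨Ψ, w, V, U, A, B, h⟩ := exists_chart (H.hφ i p hpB) (H.hφ j p hpB) (H.hφ k p hpB) (H.ha i p hpB) (H.ha j p hpB) (H.ha k p hpB)
    (H.haNz k p hpB) (H.hInd i j hij p hpB) (H.hInd i k hik p hpB) (H.hInd j k hjk p hpB)
  obtain ⟨K1, hK1, hT⟩ := h.transf (H.hφ i p hpB) (H.hφ j p hpB) (H.ha k p hpB).continuousAt (H.haNz k p hpB)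
  have tF : Filter.Tendsto (fun x => (φ i x, φ j x)) (𝓝 p) (𝓝 (φ i p, φ j p)) :=
    (H.hφ i p hpB).continuousAt.prodMk_nhds (H.hφ j p hpB).continuousAt
  have hBt : ∀ᶠ x in 𝓝 p, x ∈ Bt := H.hBto.mem_nhds hpB
  have A0 : A (φ i p, φ j p) ≠ 0 := by
    rw [h.hA.self_of_nhds, h.Ψ0]; exact div_ne_zero (H.haNz i p hpB) (H.haNz k p hpB)
  have B0 : B (φ i p, φ j p) ≠ 0 := by
    rw [h.hB.self_of_nhds, h.Ψ0]; exact div_ne_zero (H.haNz j p hpB) (H.haNz k p hpB)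
  have xw : ∀ᶠ x in 𝓝 p, w (φ i x, φ j x) = φ k x := by
    filter_upwards [tF.eventually h.hw, h.ΨF] with x h1 h2
    rw [h1, h2]
  have xAB : ∀ᶠ x in 𝓝 p, A (φ i x, φ j x) / B (φ i x, φ j x) = a i x / a j x := by
    filter_upwards [tF.eventually h.hA, tF.eventually h.hB, h.ΨF, hBt] with x h1 h2 h3 h4
    rw [h1, h2, h3]
    have := H.haNz k x h4
    have := H.haNz j x h4
    field_simp
  have k0 := h.lw.kap0
  have aR0 : AnalyticAt ℝ (fun q => A q / B q) (φ i p, φ j p) := h.aA.div h.aB B0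
  have aR1 : AnalyticAt ℝ (fun q => A q * kap w V q / B q) (φ i p, φ j p) := (h.aA.mul h.lw.akap).div h.aB B0
  have R00 : A (φ i p, φ j p) / B (φ i p, φ j p) ≠ 0 := div_ne_zero A0 B0
  have R10 : A (φ i p, φ j p) * kap w V (φ i p, φ j p) / B (φ i p, φ j p) ≠ 0 := div_ne_zero (mul_ne_zero A0 k0) B0
  have n0 := nondeg H.hr H.hBto H.hBBt H.ha H.hφ H.haNz hij hik hjk H.hcurv H.hWφ H.hAux hp h.lw xw h.aΨ h.ΨF aR0 R00 (n := 0) (by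
    filter_upwards [xAB] with x hx
    simp only [hx, pow_zero, mul_one])
  have n1 := nondeg H.hr H.hBto H.hBBt H.ha H.hφ H.haNz hij hik hjk H.hcurv H.hWφ H.hAux hp h.lw xw h.aΨ h.ΨF aR1 R10 (n := 1) (by
    filter_upwards [xAB] with x hx
    simp only [← hx, pow_one]; ring)
  have mk := h.lw.mkap
  obtain ⟨c, e0⟩ := h.lw.eGeo aR0 R00 (h.mA.div h.mB) n0
  obtain ⟨c', e1⟩ := h.lw.eGeo aR1 R10 ((h.mA.mul mk).div h.mB) n1
  obtain ⟨K, g0, g1, g2, g3, g4⟩ := (e0.and (e1.and (h.lw.eGeoW.and ((h.lw.eGeoA h.aA h.aB B0).and (h.lw.eGeoB h.aA h.aB))))).exists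
  obtain ⟨s, f0, f1, f2, f3, f4, s', hs', f5⟩ := (g0.and (g1.and (g2.and (g3.and (g4.and hT))))).exists
  refine ⟨Ψ, w, V, U, A, B, c, c', K, K1, s', _, _, hK1, hs', ?_, f0, f1, f2, f3, f4⟩
  rw [cb_prod]; exact f5

lemma eta_lem {K c μ : ℝ} (hK : 1 ≤ K) (hc : 0 < c) (hμ : 0 < μ) (hμ1 : μ ≤ 1) {m : ℕ} (hm : 24 / c ≤ m) :
    3036 * K ^ 12 * ((μ ^ 3 / (288 * 3036 * K ^ 14)) ^ m) ^ (c / 24) ≤ μ ^ 3 / (288 * K ^ 2) ∧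
      0 < (μ ^ 3 / (288 * 3036 * K ^ 14)) ^ m ∧ (μ ^ 3 / (288 * 3036 * K ^ 14)) ^ m ≤ 1 := by
  set x := μ ^ 3 / (288 * 3036 * K ^ 14) with hx
  have hx0 : 0 < x := by positivity
  have hx1 : x ≤ 1 := by
    rw [hx, div_le_one (by positivity)]
    have h1 : μ ^ 3 ≤ 1 := pow_le_one₀ hμ.le hμ1
    have h2 : 1 ≤ K ^ 14 := one_le_pow₀ hK
    linarith
  refine ⟨?_, by positivity, pow_le_one₀ hx0.le hx1⟩
  have h1 : (x ^ m) ^ (c / 24) ≤ x := by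
    rw [← Real.rpow_natCast, ← Real.rpow_mul hx0.le]
    have : 1 ≤ (m : ℝ) * (c / 24) := by
      rw [div_le_iff₀ hc] at hm; linarith
    calc x ^ ((m : ℝ) * (c / 24)) ≤ x ^ (1 : ℝ) := Real.rpow_le_rpow_of_exponent_ge hx0 hx1 this
      _ = x := Real.rpow_one x
  calc 3036 * K ^ 12 * (x ^ m) ^ (c / 24) ≤ 3036 * K ^ 12 * x := by gcongr
    _ = _ := by rw [hx]; field_simp

structure DA where
  ε : ℝ
  δ : ℝ
  f : Fin 3 → ℝ → ℝ

structure DB where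
  ε : ℝ
  δ : ℝ
  Λ : ℝ
  f : Fin 3 → ℝ → ℝ
  fb : ℤ → ℝ
  gb : ℤ → ℝ

def Hyp0 (a φ : Fin 3 → E2 → ℝ) (ε : ℝ) (f : Fin 3 → ℝ → ℝ) (x : E2) : Prop :=
  |∑ l, a l x * f l (φ l x)| ≤ ε ∧ ∀ l, |f l (φ l x)| ≤ 1

def HypA (a φ : Fin 3 → E2 → ℝ) (z : DA) (x : E2) : Prop := Hyp0 a φ z.ε z.f x
def CondA (z : DA) (ℓ : ℝ) : Prop := (∀ l, Measurable (z.f l)) ∧ 0 < z.ε ∧ 0 < z.δ ∧ z.δ ≤ ℓ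
def ConclA (φ : Fin 3 → E2 → ℝ) (i : Fin 3) (z : DA) (ℓ : ℝ) (S : Set E2) : Prop :=
  ∃ fb : ℤ → ℝ, ∀ x ∈ S, |z.f i (φ i x) - fb ⌊φ i x / z.δ⌋| ≤ (z.ε + z.δ) / ℓ

def HypB (a φ : Fin 3 → E2 → ℝ) (i j : Fin 3) (z : DB) (x : E2) : Prop := Hyp0 a φ z.ε z.f x ∧
  |z.f i (φ i x) - z.fb ⌊φ i x / z.δ⌋| ≤ z.Λ * z.δ ∧ |z.f j (φ j x) - z.gb ⌊φ j x / z.δ ^ 2⌋| ≤ z.Λ * z.ε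
def CondB (z : DB) (ℓ : ℝ) : Prop :=
  (∀ l, Measurable (z.f l)) ∧ 0 < z.ε ∧ 0 < z.δ ∧ z.δ ≤ ℓ ∧ z.ε ≤ ℓ * z.δ ∧ z.δ ^ 2 ≤ z.ε ∧ 1 ≤ z.Λ
def ConclB (φ : Fin 3 → E2 → ℝ) (i : Fin 3) (z : DB) (ℓ : ℝ) (S : Set E2) : Prop :=
  ∃ m b : ℤ → ℝ, (∀ n, |m n| ≤ z.Λ / ℓ) ∧
    ∀ x ∈ S, |z.f i (φ i x) - (m ⌊φ i x / z.δ⌋ * φ i x + b ⌊φ i x / z.δ⌋)| ≤ z.Λ * z.ε / ℓ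

lemma ofReal_div_le' {x K : ℝ} (hK : 0 < K) {v : ℝ≥0∞} (h : ENNReal.ofReal x ≤ ENNReal.ofReal K * v) :
    ENNReal.ofReal (x / K) ≤ v := by
  rw [ENNReal.ofReal_div_of_pos hK]
  exact ENNReal.div_le_of_le_mul' h

lemma Transf.eq {a φ : Fin 3 → E2 → ℝ} {i j k : Fin 3} (hij : i ≠ j) (hik : i ≠ k) (hjk : j ≠ k)
    {Ψ : ℝ × ℝ → E2} {w A B : ℝ × ℝ → ℝ} {Bp : Set E2} {Q : Set (ℝ × ℝ)} {K : ℝ}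
    (T : Transf (φ i) (φ j) (φ k) (a i) (a j) (a k) Ψ w A B Bp Q K) (hK : 1 ≤ K) {ε : ℝ} {f : Fin 3 → ℝ → ℝ} {q : ℝ × ℝ} (hq : q ∈ Q)
    (h : |∑ l, a l (Ψ q) * f l (φ l (Ψ q))| ≤ ε) :
    |A q * f i q.1 + B q * f j q.2 + f k (w q)| ≤ K * ε := by
  have h1 := T.ak1 q hq
  have h0 : a k (Ψ q) ≠ 0 := by intro h0; rw [h0, abs_zero, mul_zero] at h1; linarith
  rw [sum3 hij hik hjk, (T.FΨ q hq).1, (T.FΨ q hq).2, ← T.hw q hq] at h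
  have e : A q * f i q.1 + B q * f j q.2 + f k (w q) =
      (a i (Ψ q) * f i q.1 + a j (Ψ q) * f j q.2 + a k (Ψ q) * f k (w q)) / a k (Ψ q) := by
    rw [T.hA q hq, T.hB q hq]; field_simp
  rw [e, abs_div, div_le_iff₀ (abs_pos.2 h0)]
  have := abs_nonneg (a i (Ψ q) * f i q.1 + a j (Ψ q) * f j q.2 + a k (Ψ q) * f k (w q))
  nlinarith

lemma Transf.mSp {φi φj φk ai aj ak : E2 → ℝ} {Ψ : ℝ × ℝ → E2} {w A B : ℝ × ℝ → ℝ} {Bp : Set E2} {Q : Set (ℝ × ℝ)} {K : ℝ}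
    (T : Transf φi φj φk ai aj ak Ψ w A B Bp Q K) {S : Set E2} (mS : MeasurableSet S) : MeasurableSet {q ∈ Q | Ψ q ∈ S} :=
  T.mQ.inter (T.mΨ mS)

section
variable {x₀ : E2} {rad : ℝ} {Bt : Set E2} {a φ : Fin 3 → E2 → ℝ} {W : Fin 3 → E2 → E2}

lemma Web.localA (H : Web x₀ rad Bt a φ W)
    {i j k : Fin 3} (hij : i ≠ j) (hik : i ≠ k) (hjk : j ≠ k) (p : E2) (hp : p ∈ Metric.closedBall x₀ rad) :
    ∃ s > 0, ∀ᶠ N in Filter.atTop, Loc (HypA a φ) CondA (ConclA φ i) N (Metric.closedBall p s) := by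
  obtain ⟨Ψ, w, V, U, A, B, c, c', K, K1, s', I, J, hK1, hs', T, G, -, GW, GA, -⟩ := H.loc_data hij hik hjk hp
  have hK := G.hK
  obtain ⟨m, hm⟩ := exists_nat_ge (24 / c)
  refine ⟨s', hs', ?_⟩
  set β : ℝ := 1 / (K1 ^ 3 * (288 * 3036 * K ^ 14)) with hβ
  have hβ0 : 0 < β := by positivity
  filter_upwards [Ls_poly (c := β ^ m / K) (by positivity) (3 * m), Ls_poly (c := 1 / (K1 ^ 4 * (288 * K ^ 2))) (by positivity) 3,
    Ls_poly (c := β ^ m / (2 * K ^ 2 * K1)) (by positivity) (3 * m), Filter.eventually_ge_atTop 1] with N n1 n2 n3 hN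
  rintro ⟨ε, δ, f⟩ μ hμ hμ1 ⟨mf, hε, hδ, hδℓ⟩ S mS hS hvol hyp
  dsimp only at *
  have hℓ := Ls_pos hN hμ
  have hℓ1 : Ls N μ ≤ 1 := (Ls_le hN hμ hμ1).trans hμ1
  specialize n1 μ hμ hμ1
  specialize n2 μ hμ hμ1
  specialize n3 μ hμ hμ1
  have hK1' : 0 < K1 := by linarith
  set μ1 := μ / K1 with hμ1d
  have h10 : 0 < μ1 := by positivity
  have h11 : μ1 ≤ 1 := (div_le_self hμ.le hK1).trans hμ1
  obtain ⟨q1, q2, q3⟩ := eta_lem hK G.hc h10 h11 hm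
  have eη : (μ1 ^ 3 / (288 * 3036 * K ^ 14)) ^ m = β ^ m * μ ^ (3 * m) := by
    rw [pow_mul, ← mul_pow]; congr 1; rw [hμ1d, hβ]; field_simp
  set η := (μ1 ^ 3 / (288 * 3036 * K ^ 14)) ^ m with hη
  have g1 : K * δ ≤ η := by
    have : K * δ ≤ K * (β ^ m / K * μ ^ (3 * m)) := by gcongr; exact hδℓ.trans n1
    refine this.trans (le_of_eq ?_); rw [eη]; field_simp
  obtain ⟨fb, S'', mS'', sS'', vS'', cS''⟩ := lemA G GW GA {q ∈ I ×ˢ J | Ψ q ∈ S} (T.mSp mS) (fun q hq => hq.1) δ μ1 η (K1 * ε) hδ (hδℓ.trans hℓ1) h10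
    (ofReal_div_le' hK1' (hvol.trans (T.v1 S hS))) q2 q3 g1 q1 (by positivity) (f i) (f j) (f k) (mf i) (mf j)
    (fun q hq => T.eq hij hik hjk hK1 hq.1 (hyp _ hq.2).1)
    (fun q hq => by have := (hyp _ hq.2).2 i; rwa [(T.FΨ q hq.1).1] at this)
    (fun q hq => by have := (hyp _ hq.2).2 j; rwa [(T.FΨ q hq.1).2] at this)
  refine ⟨{x ∈ S | (φ i x, φ j x) ∈ S''}, T.ms S mS hS S'' mS'', fun x hx => hx.1, ?_, fb, ?_⟩
  · refine le_trans (ENNReal.ofReal_le_ofReal (n2.trans (le_of_eq ?_))) (ofReal_div_le' hK1' (vS''.trans (T.v2 S S'' sS'')))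
    rw [hμ1d]; field_simp
  · rintro x ⟨hx, hx'⟩
    refine (cS'' _ hx').trans ?_
    dsimp only
    rw [div_le_div_iff₀ q2 hℓ]
    have e3 : 2 * K ^ 2 * K1 * Ls N μ ≤ η := by
      have : 2 * K ^ 2 * K1 * Ls N μ ≤ 2 * K ^ 2 * K1 * (β ^ m / (2 * K ^ 2 * K1) * μ ^ (3 * m)) := by gcongr
      refine this.trans (le_of_eq ?_); rw [eη]; field_simp
    calc 2 * K ^ 2 * (K1 * ε + δ) * Ls N μ ≤ 2 * K ^ 2 * (K1 * ε + K1 * δ) * Ls N μ := by gcongr; exact le_mul_of_one_le_left hδ.le hK1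
      _ = (ε + δ) * (2 * K ^ 2 * K1 * Ls N μ) := by ring
      _ ≤ (ε + δ) * η := by gcongr

lemma Web.localB (H : Web x₀ rad Bt a φ W)
    {i j k : Fin 3} (hij : i ≠ j) (hik : i ≠ k) (hjk : j ≠ k) (p : E2) (hp : p ∈ Metric.closedBall x₀ rad) :
    ∃ s > 0, ∀ᶠ N in Filter.atTop, Loc (HypB a φ i j) CondB (ConclB φ i) N (Metric.closedBall p s) := by
  obtain ⟨Ψ, w, V, U, A, B, c', c, K, K1, s', I, J, hK1, hs', T, -, G, GW, GA, GB⟩ := H.loc_data hij hik hjk hp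
  have hK := G.hK
  obtain ⟨m, hm⟩ := exists_nat_ge (24 / c)
  refine ⟨s', hs', ?_⟩
  set β : ℝ := 1 / (K1 ^ 3 * (288 * 3036 * K ^ 14)) with hβ
  have hβ0 : 0 < β := by positivity
  filter_upwards [Ls_poly (c := β ^ m / K) (by positivity) (3 * m), Ls_poly (c := 1 / (K1 ^ 4 * (288 * K ^ 2))) (by positivity) 3,
    Ls_poly (c := β ^ m / (1056 * K ^ 6 * K1 ^ 2)) (by positivity) (3 * m + 1), Ls_poly (c := 1 / (48 * K * K1)) (by positivity) 1,
    Ls_poly (c := 1 / K1) (by positivity) 0, Filter.eventually_ge_atTop 1] with N n1 n2 n3 n4 n5 hN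
  rintro ⟨ε, δ, Λ, f, fb, gb⟩ μ hμ hμ1 ⟨mf, hε, hδ, hδℓ, hεℓ, hδε, hΛ⟩ S mS hS hvol hyp
  dsimp only at *
  have hℓ := Ls_pos hN hμ
  have hℓ1 : Ls N μ ≤ 1 := (Ls_le hN hμ hμ1).trans hμ1
  specialize n1 μ hμ hμ1
  specialize n2 μ hμ hμ1
  specialize n3 μ hμ hμ1
  specialize n4 μ hμ hμ1
  specialize n5 μ hμ hμ1
  have hK1' : 0 < K1 := by linarith
  set μ1 := μ / K1 with hμ1d
  have h10 : 0 < μ1 := by positivity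
  have h11 : μ1 ≤ 1 := (div_le_self hμ.le hK1).trans hμ1
  obtain ⟨q1, q2, q3⟩ := eta_lem hK G.hc h10 h11 hm
  have eη : (μ1 ^ 3 / (288 * 3036 * K ^ 14)) ^ m = β ^ m * μ ^ (3 * m) := by
    rw [pow_mul, ← mul_pow]; congr 1; rw [hμ1d, hβ]; field_simp
  set η := (μ1 ^ 3 / (288 * 3036 * K ^ 14)) ^ m with hη
  have g1 : K * δ ≤ η := by
    have : K * δ ≤ K * (β ^ m / K * μ ^ (3 * m)) := by gcongr; exact hδℓ.trans n1
    refine this.trans (le_of_eq ?_); rw [eη]; field_simp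
  have g2 : K1 * ε ≤ δ := by
    have h1 : K1 * Ls N μ ≤ 1 := by
      rw [pow_zero, mul_one, le_div_iff₀ hK1'] at n5; linarith
    calc K1 * ε ≤ K1 * (Ls N μ * δ) := by gcongr
      _ = (K1 * Ls N μ) * δ := by ring
      _ ≤ 1 * δ := by gcongr
      _ = δ := one_mul δ
  have g3 : ε ≤ K1 * ε := le_mul_of_one_le_left hε.le hK1
  obtain ⟨m', b, S'', mS'', sS'', vS'', mb, cS''⟩ := lemB G GW GA GB {q ∈ I ×ˢ J | Ψ q ∈ S} (T.mSp mS) (fun q hq => hq.1) δ μ1 η (K1 * ε) Λ hδ (hδℓ.trans hℓ1) h10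
    (ofReal_div_le' hK1' (hvol.trans (T.v1 S hS))) q2 q3 g1 q1 (by positivity) g2 (hδε.trans g3) hΛ (f i) (f j) (f k) (mf i) (mf j)
    (fun q hq => T.eq hij hik hjk hK1 hq.1 (hyp _ hq.2).1.1)
    (fun q hq => by have := (hyp _ hq.2).1.2 i; rwa [(T.FΨ q hq.1).1] at this)
    (fun q hq => by have := (hyp _ hq.2).1.2 j; rwa [(T.FΨ q hq.1).2] at this)
    fb gb
    (fun q hq => by have := (hyp _ hq.2).2.1; dsimp only at this; rwa [(T.FΨ q hq.1).1] at this)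
    (fun q hq => by
      have := (hyp _ hq.2).2.2
      dsimp only at this
      rw [(T.FΨ q hq.1).2] at this
      exact this.trans (by gcongr))
  refine ⟨{x ∈ S | (φ i x, φ j x) ∈ S''}, T.ms S mS hS S'' mS'', fun x hx => hx.1, ?_, m', b, ?_, ?_⟩
  · refine le_trans (ENNReal.ofReal_le_ofReal (n2.trans (le_of_eq ?_))) (ofReal_div_le' hK1' (vS''.trans (T.v2 S S'' sS'')))
    rw [hμ1d]; field_simp
  · intro n
    refine (mb n).trans ?_
    dsimp only
    rw [div_le_div_iff₀ h10 hℓ]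
    have : 48 * K * Ls N μ ≤ μ1 := by
      have : 48 * K * Ls N μ ≤ 48 * K * (1 / (48 * K * K1) * μ ^ 1) := by gcongr
      refine this.trans (le_of_eq ?_); rw [hμ1d]; field_simp
    calc 48 * K * Λ * Ls N μ = Λ * (48 * K * Ls N μ) := by ring
      _ ≤ Λ * μ1 := by gcongr
  · rintro x ⟨hx, hx'⟩
    refine (cS'' _ hx').trans ?_
    dsimp only
    rw [div_le_div_iff₀ (by positivity) hℓ]
    have e3 : 1056 * K ^ 6 * K1 * Ls N μ ≤ η * μ1 := by
      have : 1056 * K ^ 6 * K1 * Ls N μ ≤ 1056 * K ^ 6 * K1 * (β ^ m / (1056 * K ^ 6 * K1 ^ 2) * μ ^ (3 * m + 1)) := by gcongr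
      refine this.trans (le_of_eq ?_); rw [eη, hμ1d]; field_simp; rw [pow_succ]
    calc 1056 * K ^ 6 * Λ * (K1 * ε) * Ls N μ = Λ * ε * (1056 * K ^ 6 * K1 * Ls N μ) := by ring
      _ ≤ Λ * ε * (η * μ1) := by gcongr

lemma Web.globA (H : Web x₀ rad Bt a φ W) {i j k : Fin 3} (hij : i ≠ j) (hik : i ≠ k) (hjk : j ≠ k) :
    ∀ᶠ N in Filter.atTop, Loc (HypA a φ) CondA (ConclA φ i) N (Metric.closedBall x₀ rad) := by
  refine loc_glob ?_ ?_ x₀ rad (H.localA hij hik hjk)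
  · rintro z ℓ ℓ' h0 h ⟨a1, a2, a3, a4⟩
    exact ⟨a1, a2, a3, a4.trans h⟩
  · rintro z ℓ ℓ' S h0 h ⟨a1, a2, a3, a4⟩ ⟨fb, hfb⟩
    refine ⟨fb, fun x hx => (hfb x hx).trans ?_⟩
    gcongr

lemma Web.globB (H : Web x₀ rad Bt a φ W) {i j k : Fin 3} (hij : i ≠ j) (hik : i ≠ k) (hjk : j ≠ k) :
    ∀ᶠ N in Filter.atTop, Loc (HypB a φ i j) CondB (ConclB φ i) N (Metric.closedBall x₀ rad) := by
  refine loc_glob ?_ ?_ x₀ rad (H.localB hij hik hjk)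
  · rintro z ℓ ℓ' h0 h ⟨a1, a2, a3, a4, a5, a6, a7⟩
    exact ⟨a1, a2, a3, a4.trans h, a5.trans (by gcongr), a6, a7⟩
  · rintro z ℓ ℓ' S h0 h ⟨a1, a2, a3, a4, a5, a6, a7⟩ ⟨m, b, hm, hb⟩
    have : 0 < z.Λ := by linarith
    exact ⟨m, b, fun n => (hm n).trans (by gcongr), fun x hx => (hb x hx).trans (by gcongr)⟩

end

lemma Ls_le1 {N : ℕ} (hN : 1 ≤ N) {μ : ℝ} (hμ : 0 < μ) (h1 : μ ≤ 1) : Ls N μ ≤ 1 := (Ls_le hN hμ h1).trans h1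

lemma Ls_comp3 (P : ℕ) (hP : 1 ≤ P) : ∃ Q : ℕ, 1 ≤ Q ∧ ∀ μ : ℝ, 0 < μ → μ ≤ 1 → Ls Q μ ≤ Ls P (Ls P (Ls P μ)) := by
  obtain ⟨Q1, h1, h2⟩ := ((Ls_comp P hP).and (Filter.eventually_ge_atTop P)).exists
  have hQ1 : 1 ≤ Q1 := hP.trans h2
  obtain ⟨Q, h3, h4⟩ := ((Ls_comp Q1 hQ1).and (Filter.eventually_ge_atTop 1)).exists
  refine ⟨Q, h4, fun μ hμ hμ1 => ?_⟩
  have p1 := Ls_pos hQ1 hμ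
  refine (h3 μ hμ hμ1).trans ((h1 _ p1 (Ls_le1 hQ1 hμ hμ1)).trans ?_)
  exact Ls_mono (Ls_pos hP p1) (Ls_mono p1 (Ls_anti hP h2 hμ hμ1))

def CondAB (z : DA) (ℓ : ℝ) : Prop :=
  (∀ l, Measurable (z.f l)) ∧ 0 < z.ε ∧ 0 < z.δ ∧ z.δ ≤ ℓ ∧ z.ε ≤ ℓ * z.δ ∧ z.δ ^ 2 ≤ z.ε

def ConclAB (φ : Fin 3 → E2 → ℝ) (i : Fin 3) (z : DA) (ℓ : ℝ) (S : Set E2) : Prop :=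
  ∃ m b : ℤ → ℝ, (∀ n, |m n| ≤ 1 / ℓ) ∧
    ∀ x ∈ S, |z.f i (φ i x) - (m ⌊φ i x / z.δ⌋ * φ i x + b ⌊φ i x / z.δ⌋)| ≤ z.ε / ℓ

lemma CondAB.mono {z : DA} {ℓ ℓ' : ℝ} (h : CondAB z ℓ) (hl : ℓ ≤ ℓ') : CondAB z ℓ' := by
  obtain ⟨a1, a2, a3, a4, a5, a6⟩ := h
  exact ⟨a1, a2, a3, a4.trans hl, a5.trans (by gcongr), a6⟩

lemma ConclAB.mono {φ : Fin 3 → E2 → ℝ} {i : Fin 3} {z : DA} {ℓ ℓ' : ℝ} {S S' : Set E2} (h : ConclAB φ i z ℓ' S) (hε : 0 < z.ε)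
    (h0 : 0 < ℓ) (hl : ℓ ≤ ℓ') (hS : S' ⊆ S) : ConclAB φ i z ℓ S' := by
  obtain ⟨m, b, h1, h2⟩ := h
  exact ⟨m, b, fun n => (h1 n).trans (by gcongr), fun x hx => (h2 x (hS hx)).trans (by gcongr)⟩

section
variable {x₀ : E2} {rad : ℝ} {Bt : Set E2} {a φ : Fin 3 → E2 → ℝ} {W : Fin 3 → E2 → E2}

lemma Web.globAB (H : Web x₀ rad Bt a φ W) {i j k : Fin 3} (hij : i ≠ j) (hik : i ≠ k) (hjk : j ≠ k) :
    ∀ᶠ N in Filter.atTop, Loc (HypA a φ) CondAB (ConclAB φ i) N (Metric.closedBall x₀ rad) := by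
  obtain ⟨P, A1, A2, B1, hP⟩ := ((H.globA hij hik hjk).and ((H.globA hij.symm hjk hik).and ((H.globB hij hik hjk).and (Filter.eventually_ge_atTop 1)))).exists
  obtain ⟨Q, hQ, hQ3⟩ := Ls_comp3 P hP
  filter_upwards [Ls_sq Q hQ, Filter.eventually_ge_atTop 1] with N n1 hN
  rintro ⟨ε, δ, f⟩ μ hμ hμ1 hcond S mS hS hvol hyp
  set ℓ := Ls N μ with hℓ
  set ℓ1 := Ls P μ with hℓ1
  set ℓ2 := Ls P ℓ1 with hℓ2
  set ℓ3 := Ls P ℓ2 with hℓ3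
  have p0 : 0 < ℓ := Ls_pos hN hμ
  have p1 : 0 < ℓ1 := Ls_pos hP hμ
  have u1 : ℓ1 ≤ 1 := Ls_le1 hP hμ hμ1
  have p2 : 0 < ℓ2 := Ls_pos hP p1
  have u2 : ℓ2 ≤ 1 := Ls_le1 hP p1 u1
  have p3 : 0 < ℓ3 := Ls_pos hP p2
  have u3 : ℓ3 ≤ 1 := Ls_le1 hP p2 u2
  have l21 : ℓ2 ≤ ℓ1 := Ls_le hP p1 u1
  have l32 : ℓ3 ≤ ℓ2 := Ls_le hP p2 u2
  have lq : ℓ ≤ ℓ3 ^ 2 / 2 := by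
    refine (n1 μ hμ hμ1).trans ?_
    have := hQ3 μ hμ hμ1
    have := Ls_pos hQ hμ
    gcongr
  have l3 : ℓ ≤ ℓ3 := by nlinarith
  have l23 : ℓ ≤ ℓ2 * ℓ3 / 2 := by nlinarith
  obtain ⟨mf, hε, hδ, c1, c2, c3⟩ := hcond
  dsimp only at mf hε hδ c1 c2 c3
  have hδ1 : δ ≤ 1 := by linarith
  have hεδ : ε ≤ δ := by nlinarith
  have hδδ : δ ^ 2 ≤ δ := by nlinarith
  obtain ⟨S1, mS1, sS1, vS1, fb, hfb⟩ := A1 ⟨ε, δ, f⟩ μ hμ hμ1 ⟨mf, hε, hδ, by dsimp only; linarith⟩ S mS hS hvol hyp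
  obtain ⟨S2, mS2, sS2, vS2, gb, hgb⟩ := A2 ⟨ε, δ ^ 2, f⟩ ℓ1 p1 u1 ⟨mf, hε, by dsimp only; positivity, by dsimp only; linarith⟩ S1 mS1 (sS1.trans hS) vS1
    (fun x hx => hyp x (sS1 hx))
  dsimp only at hfb hgb
  obtain ⟨S3, mS3, sS3, vS3, m, b, hm, hb⟩ := B1 ⟨ε, δ, 2 / ℓ2, f, fb, gb⟩ ℓ2 p2 u2 ⟨mf, hε, hδ, by dsimp only; linarith, by
      dsimp only
      refine c2.trans ?_
      gcongr, c3, by dsimp only; rw [le_div_iff₀ p2]; linarith⟩ S2 mS2 (sS2.trans (sS1.trans hS)) vS2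
    (fun x hx => ⟨hyp x (sS1 (sS2 hx)), by
      refine (hfb x (sS2 hx)).trans ?_
      dsimp only
      rw [← hℓ1, div_mul_eq_mul_div, div_le_div_iff₀ p1 p2]
      nlinarith, by
      refine (hgb x hx).trans ?_
      dsimp only
      rw [← hℓ2, div_mul_eq_mul_div]
      gcongr
      linarith⟩)
  refine ⟨S3, mS3, sS3.trans (sS2.trans sS1), (ENNReal.ofReal_le_ofReal l3).trans vS3, m, b, ?_, ?_⟩
  · intro n
    refine (hm n).trans ?_
    dsimp only
    rw [← hℓ3, div_div, div_le_div_iff₀ (by positivity) p0]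
    linarith
  · intro x hx
    refine (hb x hx).trans ?_
    dsimp only
    rw [← hℓ3, div_mul_eq_mul_div, div_div, div_le_div_iff₀ (by positivity) p0]
    nlinarith

lemma Web.globAll (H : Web x₀ rad Bt a φ W) :
    ∃ N : ℕ, 1 ≤ N ∧ Loc (HypA a φ) CondAB (fun z ℓ S => ∀ i, ConclAB φ i z ℓ S) N (Metric.closedBall x₀ rad) := by
  obtain ⟨P, B0, B1, B2, hP⟩ := ((H.globAB (i := 0) (j := 1) (k := 2) (by decide) (by decide) (by decide)).and
    ((H.globAB (i := 1) (j := 0) (k := 2) (by decide) (by decide) (by decide)).and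
    ((H.globAB (i := 2) (j := 0) (k := 1) (by decide) (by decide) (by decide)).and (Filter.eventually_ge_atTop 1)))).exists
  obtain ⟨Q, hQ, hQ3⟩ := Ls_comp3 P hP
  refine ⟨Q, hQ, ?_⟩
  rintro z μ hμ hμ1 hcond S mS hS hvol hyp
  have hε : 0 < z.ε := hcond.2.1
  set ℓ := Ls Q μ with hℓ
  set ℓ1 := Ls P μ with hℓ1
  set ℓ2 := Ls P ℓ1 with hℓ2
  set ℓ3 := Ls P ℓ2 with hℓ3
  have p0 : 0 < ℓ := Ls_pos hQ hμ
  have p1 : 0 < ℓ1 := Ls_pos hP hμ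
  have u1 : ℓ1 ≤ 1 := Ls_le1 hP hμ hμ1
  have p2 : 0 < ℓ2 := Ls_pos hP p1
  have u2 : ℓ2 ≤ 1 := Ls_le1 hP p1 u1
  have l21 : ℓ2 ≤ ℓ1 := Ls_le hP p1 u1
  have l32 : ℓ3 ≤ ℓ2 := Ls_le hP p2 u2
  have l3 : ℓ ≤ ℓ3 := hQ3 μ hμ hμ1
  obtain ⟨S1, mS1, sS1, vS1, e1⟩ := B0 z μ hμ hμ1 (hcond.mono (by linarith)) S mS hS hvol hyp
  obtain ⟨S2, mS2, sS2, vS2, e2⟩ := B1 z ℓ1 p1 u1 (hcond.mono (by linarith)) S1 mS1 (sS1.trans hS) vS1 (fun x hx => hyp x (sS1 hx))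
  obtain ⟨S3, mS3, sS3, vS3, e3⟩ := B2 z ℓ2 p2 u2 (hcond.mono (by linarith)) S2 mS2 (sS2.trans (sS1.trans hS)) vS2
    (fun x hx => hyp x (sS1 (sS2 hx)))
  refine ⟨S3, mS3, sS3.trans (sS2.trans sS1), (ENNReal.ofReal_le_ofReal l3).trans vS3, ?_⟩
  intro i
  fin_cases i
  · exact e1.mono hε p0 (by linarith) (sS3.trans sS2)
  · exact e2.mono hε p0 (by linarith) sS3
  · exact e3.mono hε p0 (by linarith) subset_rfl

/-- preimages of null sets are null -/
lemma Web.null (H : Web x₀ rad Bt a φ W) (i : Fin 3) {E : Set ℝ} (hE : volume E = 0) :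
    volume {x ∈ Metric.closedBall x₀ rad | φ i x ∈ E} = 0 := by
  obtain ⟨j, k, hij, hik, hjk⟩ : ∃ j k : Fin 3, i ≠ j ∧ i ≠ k ∧ j ≠ k := by
    fin_cases i
    · exact ⟨1, 2, by decide, by decide, by decide⟩
    · exact ⟨0, 2, by decide, by decide, by decide⟩
    · exact ⟨0, 1, by decide, by decide, by decide⟩
  refine measure_null_of_locally_null _ fun p hp => ?_
  obtain ⟨Ψ, w, V, U, A, B, c, c', K, K1, s', I, J, hK1, hs', T, -⟩ := H.loc_data hij hik hjk hp.1
  refine ⟨{x ∈ Metric.closedBall x₀ rad | φ i x ∈ E} ∩ Metric.closedBall p s',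
    Filter.inter_mem self_mem_nhdsWithin (mem_nhdsWithin_of_mem_nhds (Metric.closedBall_mem_nhds _ hs')), ?_⟩
  refine le_antisymm ((T.v1 _ inter_subset_right).trans ?_) bot_le
  have : volume {q ∈ I ×ˢ J | Ψ q ∈ {x ∈ Metric.closedBall x₀ rad | φ i x ∈ E} ∩ Metric.closedBall p s'} = 0 := by
    have h0 : volume (E ×ˢ (univ : Set ℝ)) = 0 := by
      rw [Measure.volume_eq_prod, Measure.prod_prod, hE, zero_mul]
    refine measure_mono_null ?_ h0
    rintro q ⟨hq, hq', -⟩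
    refine ⟨?_, mem_univ _⟩
    have := hq'.2
    rwa [(T.FΨ q hq).1] at this
  rw [this, mul_zero]

end

lemma final_arith {N : ℕ} (hN : 1 ≤ N) {γ ρ : ℝ} (hγ : γ ∈ Set.Ioo (1 / 2 : ℝ) 1) (hρ : 0 < ρ) {M : ℝ} (hM : 1 ≤ M) :
    ∃ c C : ℝ, 0 < c ∧ 0 < C ∧ ∀ ε v : ℝ, 0 < ε → 0 ≤ v → v ≤ M → C * ε ^ c < v →
      0 < min v 1 ∧ 1 / Ls N (min v 1) ≤ C * ε ^ (-ρ) ∧ ε / Ls N (min v 1) ≤ C * ε ^ (1 - ρ) ∧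
      c * v ^ C ≤ Ls N (min v 1) ∧ ε ^ γ ≤ Ls N (min v 1) ∧ ε ≤ Ls N (min v 1) * ε ^ γ ∧ (ε ^ γ) ^ 2 ≤ ε := by
  obtain ⟨hγ1, hγ2⟩ := hγ
  have hN' : (1 : ℝ) ≤ N := by exact_mod_cast hN
  have hN0 : (0 : ℝ) < N := by linarith
  set D : ℝ := (N : ℝ) ^ N with hD
  have hD1 : 1 ≤ D := one_le_pow₀ hN'
  have hD0 : 0 < D := by linarith
  set σ : ℝ := (1 - γ) / 2 with hσ
  have hσ0 : 0 < σ := by simp only [hσ]; linarith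
  set θ : ℝ := min ρ σ with hθ
  have hθ0 : 0 < θ := lt_min hρ hσ0
  set c1 : ℝ := θ / N with hc1
  have hc10 : 0 < c1 := by positivity
  set ε1 : ℝ := (1 / D) ^ (1 / σ) with hε1
  have hε10 : 0 < ε1 := by positivity
  have hDi : 1 / D ≤ 1 := by rw [div_le_one hD0]; exact hD1
  have hε11 : ε1 ≤ 1 := Real.rpow_le_one (by positivity) hDi (by positivity)
  set C : ℝ := D + N + M / ε1 ^ c1 with hC
  have hq : 0 < M / ε1 ^ c1 := by positivity
  have hCD : D ≤ C := by linarith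
  have hCN : (N : ℝ) ≤ C := by linarith
  have hCM : M / ε1 ^ c1 ≤ C := by linarith
  have hC0 : 0 < C := by linarith
  have hC1 : 1 ≤ C := by linarith
  set c : ℝ := min c1 (1 / (M ^ C * D)) with hc
  have hc0 : 0 < c := lt_min hc10 (by positivity)
  have hcc1 : c ≤ c1 := min_le_left _ _
  have hcM : c * (M ^ C * D) ≤ 1 := by
    have := min_le_right c1 (1 / (M ^ C * D))
    rw [← hc, le_div_iff₀ (by positivity)] at this
    exact this
  refine ⟨c, C, hc0, hC0, ?_⟩
  intro ε v hε hv0 hvM hbig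
  have hεlt : ε < ε1 := by
    by_contra! hcon
    have h1 : ε1 ^ c1 ≤ ε ^ c := (Real.rpow_le_rpow_of_exponent_ge hε10 hε11 hcc1).trans (Real.rpow_le_rpow hε10.le hcon hc0.le)
    have h2 : M ≤ C * ε ^ c := by
      rw [div_le_iff₀ (by positivity)] at hCM
      exact hCM.trans (by gcongr)
    linarith
  have hε1' : ε ≤ 1 := by linarith
  have hεD : D * ε ^ σ ≤ 1 := by
    have h1 : ε ^ σ ≤ ε1 ^ σ := Real.rpow_le_rpow hε.le hεlt.le hσ0.le
    have h2 : ε1 ^ σ = 1 / D := by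
      rw [hε1, ← Real.rpow_mul (by positivity), one_div_mul_cancel hσ0.ne', Real.rpow_one]
    rw [h2, le_div_iff₀ hD0] at h1
    linarith
  set μ := min v 1 with hμ
  have hεc : ε ^ c1 ≤ v := by
    have h1 : ε ^ c1 ≤ ε ^ c := Real.rpow_le_rpow_of_exponent_ge hε hε1' hcc1
    have h2 : 0 < ε ^ c := by positivity
    nlinarith
  have hμε : ε ^ c1 ≤ μ := le_min hεc (Real.rpow_le_one hε.le hε1' hc10.le)
  have hεp : 0 < ε ^ c1 := by positivity
  have hμ0 : 0 < μ := by linarith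
  have hLD : Ls N μ = μ ^ N / D := by rw [Ls, div_pow]
  have hL0 : 0 < Ls N μ := Ls_pos hN hμ0
  have hLθ : ε ^ θ ≤ D * Ls N μ := by
    rw [hLD, mul_div_cancel₀ _ hD0.ne']
    calc ε ^ θ = (ε ^ c1) ^ N := by
          rw [← Real.rpow_natCast, ← Real.rpow_mul hε.le, hc1, div_mul_cancel₀ _ hN0.ne']
      _ ≤ μ ^ N := by gcongr
  have hLρ : ε ^ ρ ≤ D * Ls N μ := (Real.rpow_le_rpow_of_exponent_ge hε hε1' (min_le_left _ _)).trans hLθ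
  have hLσ : ε ^ σ ≤ D * Ls N μ := (Real.rpow_le_rpow_of_exponent_ge hε hε1' (min_le_right _ _)).trans hLθ
  have hρi : 1 / Ls N μ ≤ C * ε ^ (-ρ) := by
    have : 0 < ε ^ ρ := by positivity
    rw [Real.rpow_neg hε.le, ← div_eq_mul_inv, div_le_div_iff₀ hL0 this]
    have : D * Ls N μ ≤ C * Ls N μ := by gcongr
    linarith
  have hs2 : ε ^ σ * ε ^ σ ≤ Ls N μ := by
    have : 0 < ε ^ σ := by positivity
    have h1 : D * (ε ^ σ * ε ^ σ) ≤ D * Ls N μ := by nlinarith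
    exact le_of_mul_le_mul_left h1 hD0
  rw [← Real.rpow_add hε] at hs2
  have eσ : σ + σ = 1 - γ := by simp only [hσ]; ring
  rw [eσ] at hs2
  refine ⟨hμ0, hρi, ?_, ?_, ?_, ?_, ?_⟩
  · have : ε ^ (1 - ρ) = ε * ε ^ (-ρ) := by
      rw [sub_eq_add_neg, Real.rpow_add hε, Real.rpow_one]
    rw [this]
    calc ε / Ls N μ = ε * (1 / Ls N μ) := by ring
      _ ≤ ε * (C * ε ^ (-ρ)) := by gcongr
      _ = _ := by ring
  · rw [hLD, le_div_iff₀ hD0]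
    have hMC : 1 ≤ M ^ C := Real.one_le_rpow hM hC0.le
    rcases le_total v 1 with h | h
    · have e : μ = v := min_eq_left h
      rw [e] at hμ0 ⊢
      have h1 : v ^ C ≤ v ^ N := by
        rw [← Real.rpow_natCast]; exact Real.rpow_le_rpow_of_exponent_ge hμ0 h hCN
      have h2 : c * D ≤ 1 := by
        refine le_trans ?_ hcM
        have : D ≤ M ^ C * D := le_mul_of_one_le_left hD0.le hMC
        gcongr
      have h3 : 0 ≤ v ^ C := Real.rpow_nonneg hv0 C
      calc c * v ^ C * D = (c * D) * v ^ C := by ring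
        _ ≤ 1 * v ^ C := mul_le_mul_of_nonneg_right h2 h3
        _ = v ^ C := one_mul _
        _ ≤ v ^ N := h1
    · have e : μ = 1 := min_eq_right h
      rw [e, one_pow]
      have h1 : v ^ C ≤ M ^ C := Real.rpow_le_rpow hv0 hvM hC0.le
      calc c * v ^ C * D ≤ c * M ^ C * D := by gcongr
        _ = c * (M ^ C * D) := by ring
        _ ≤ 1 := hcM
  · exact (Real.rpow_le_rpow_of_exponent_ge hε hε1' (by linarith)).trans hs2
  · calc ε = ε ^ (1 - γ) * ε ^ γ := by rw [← Real.rpow_add hε]; simp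
      _ ≤ _ := by gcongr
  · rw [← Real.rpow_natCast, ← Real.rpow_mul hε.le]
    calc ε ^ (γ * (2 : ℕ)) ≤ ε ^ (1 : ℝ) := Real.rpow_le_rpow_of_exponent_ge hε hε1' (by push_cast; linarith)
      _ = ε := Real.rpow_one ε

/-- Proposition 8.1 (Mesoscale): under nondegeneracy, nonvanishing web curvature and the
auxiliary hypothesis, for any measurable `𝒮 ⊆ S(f,ε)`, either `|𝒮| ≲ ε^c`, or each `fⱼ`
agrees to within `C ε^{1-ρ}`, on a subset of `𝒮` of measure `≳ |𝒮|^C`, with a function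
affine on intervals of length `ε^γ` and with slopes `O(ε^{-ρ})`. -/
theorem mesoscale_proposition
    (x₀ : EuclideanSpace ℝ (Fin 2)) (r : ℝ) (hr : 0 < r)
    (Bt : Set (EuclideanSpace ℝ (Fin 2))) (hBtOpen : IsOpen Bt) (hBtConn : IsConnected Bt)
    (hBBt : Metric.closedBall x₀ r ⊆ Bt)
    (a φ : Fin 3 → EuclideanSpace ℝ (Fin 2) → ℝ)
    (ha : ∀ j, AnalyticOnNhd ℝ (a j) Bt)
    (hφ : ∀ j, AnalyticOnNhd ℝ (φ j) Bt)
    -- nondegeneracy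
    (haNz : ∀ j, ∀ x ∈ Bt, a j x ≠ 0)
    (hInd : ∀ i j : Fin 3, i ≠ j → ∀ x ∈ Bt,
      LinearIndependent ℝ ![fderiv ℝ (φ i) x, fderiv ℝ (φ j) x])
    -- the curvature of the web defined by Φ does not vanish identically
    (hcurv : ¬ ∃ V : Set (EuclideanSpace ℝ (Fin 2)),
      V ⊆ Metric.closedBall x₀ r ∧ IsOpen V ∧ V.Nonempty ∧ IsConnected V ∧
      ∃ (Φ : EuclideanSpace ℝ (Fin 2) → EuclideanSpace ℝ (Fin 2)) (ψ : Fin 3 → ℝ → ℝ)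
        (L : Fin 3 → (EuclideanSpace ℝ (Fin 2) →L[ℝ] ℝ)) (c : Fin 3 → ℝ),
        AnalyticOnNhd ℝ Φ V ∧ Set.InjOn Φ V ∧ IsOpen (Φ '' V) ∧
        (∀ j, AnalyticOnNhd ℝ (ψ j) (φ j '' V) ∧ Set.InjOn (ψ j) (φ j '' V)) ∧
        ∀ j, ∀ x ∈ V, ψ j (φ j x) = L j (Φ x) + c j)
    -- the vector fields Wⱼ
    (W : Fin 3 → EuclideanSpace ℝ (Fin 2) → EuclideanSpace ℝ (Fin 2))
    (hWanalytic : ∀ j, AnalyticOnNhd ℝ (W j) Bt)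
    (hWnz : ∀ j, ∃ x ∈ Bt, W j x ≠ 0)
    (hWφ : ∀ j, ∀ x ∈ Bt, fderiv ℝ (φ j) x (W j x) = 0)
    -- auxiliary hypothesis
    (hAux : ∀ k : Fin 3, ∀ U : Set (EuclideanSpace ℝ (Fin 2)),
      U ⊆ Metric.closedBall x₀ r → IsOpen U → U.Nonempty → ∀ τ : ℝ,
      ∀ g : Fin 3 → ℝ → ℝ, (∀ i, i ≠ k → AnalyticOnNhd ℝ (g i) (φ i '' U)) →
      (∀ x ∈ U, ∑ i ∈ Finset.univ.filter (fun i => i ≠ k),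
          a i x * |fderiv ℝ (φ i) x (W k x)| ^ τ * g i (φ i x) = 0) →
      ∀ i, i ≠ k → ∀ y ∈ φ i '' U, g i y = 0)
    -- the fixed mesoscale exponent
    (γ : ℝ) (hγ : γ ∈ Set.Ioo (1 / 2 : ℝ) 1) :
    ∀ ρ : ℝ, 0 < ρ → ∃ c C : ℝ, 0 < c ∧ 0 < C ∧
      ∀ ε : ℝ, 0 < ε → ∀ f : Fin 3 → ℝ → ℝ,
        (∀ j, Measurable (f j)) → (∀ j, ∀ᵐ y ∂(volume : Measure ℝ), |f j y| ≤ 1) →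
        ∀ 𝒮 : Set (EuclideanSpace ℝ (Fin 2)), MeasurableSet 𝒮 →
        𝒮 ⊆ {x ∈ Metric.closedBall x₀ r | |∑ j, a j x * f j (φ j x)| < ε} →
        volume 𝒮 ≤ ENNReal.ofReal (C * ε ^ c) ∨
        ∃ (fstar : Fin 3 → ℝ → ℝ) (S : Set (EuclideanSpace ℝ (Fin 2))),
          (∀ j, AffineOnIntervals (fstar j) (ε ^ γ) (C * ε ^ (-ρ))) ∧
          MeasurableSet S ∧ S ⊆ 𝒮 ∧
          ENNReal.ofReal c * volume 𝒮 ^ C ≤ volume S ∧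
          ∀ x ∈ S, ∀ j, |fstar j (φ j x) - f j (φ j x)| ≤ C * ε ^ (1 - ρ) := by
  have H : Web x₀ r Bt a φ W := ⟨hr, hBtOpen, hBBt, ha, hφ, haNz, hInd, hcurv, hWφ, hAux⟩
  intro ρ hρ
  obtain ⟨N, hN, hLoc⟩ := H.globAll
  set M : ℝ := max 1 (volume (Metric.closedBall x₀ r)).toReal with hM
  have hfin : volume (Metric.closedBall x₀ r) ≠ ⊤ := measure_closedBall_lt_top.ne
  obtain ⟨c, C, hc, hC, key⟩ := final_arith hN hγ hρ (le_max_left 1 _ : 1 ≤ M)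
  refine ⟨c, C, hc, hC, ?_⟩
  intro ε hε f mf hf 𝒮 m𝒮 h𝒮
  have hsub : 𝒮 ⊆ Metric.closedBall x₀ r := fun x hx => (h𝒮 hx).1
  have hvle : volume 𝒮 ≤ volume (Metric.closedBall x₀ r) := measure_mono hsub
  have hvfin : volume 𝒮 ≠ ⊤ := ne_top_of_le_ne_top hfin hvle
  by_cases hbig : volume 𝒮 ≤ ENNReal.ofReal (C * ε ^ c)
  · exact Or.inl hbig
  right
  set v := (volume 𝒮).toReal with hv
  have hveq : volume 𝒮 = ENNReal.ofReal v := (ENNReal.ofReal_toReal hvfin).symm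
  have hvM : v ≤ M := (ENNReal.toReal_mono hfin hvle).trans (le_max_right _ _)
  have hv0 : 0 ≤ v := ENNReal.toReal_nonneg
  have hlt : C * ε ^ c < v := by
    by_contra! hcon
    exact hbig (hveq ▸ ENNReal.ofReal_le_ofReal hcon)
  obtain ⟨k0, k1, k2, k3, k4, k5, k6⟩ := key ε v hε hv0 hvM hlt
  set bad : Set (EuclideanSpace ℝ (Fin 2)) := ⋃ l, {x ∈ Metric.closedBall x₀ r | φ l x ∈ {y | ¬ |f l y| ≤ 1}} with hbad
  have hbad0 : volume bad = 0 := measure_iUnion_null fun l => H.null l (ae_iff.1 (hf l))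
  set S0 := 𝒮 \ toMeasurable volume bad with hS0
  have mS0 : MeasurableSet S0 := m𝒮.diff (measurableSet_toMeasurable _ _)
  have vS0 : volume S0 = volume 𝒮 := measure_sdiff_null (by rw [measure_toMeasurable]; exact hbad0)
  have sS0 : S0 ⊆ 𝒮 := sdiff_subset
  obtain ⟨S, mS, sS, vS, hS⟩ := hLoc ⟨ε, ε ^ γ, f⟩ (min v 1) k0 (min_le_right _ _)
    ⟨mf, hε, Real.rpow_pos_of_pos hε γ, k4, k5, k6⟩ S0 mS0 (sS0.trans hsub)
    (by rw [vS0, hveq]; exact ENNReal.ofReal_le_ofReal (min_le_left _ _))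
    (fun x hx => ⟨(h𝒮 (sS0 hx)).2.le, fun l => by
      by_contra hcon
      exact hx.2 (subset_toMeasurable _ _ (mem_iUnion.2 ⟨l, hsub (sS0 hx), hcon⟩))⟩)
  have hδ : 0 < ε ^ γ := Real.rpow_pos_of_pos hε γ
  choose m b hm hb using hS
  dsimp only at hm hb
  refine ⟨fun j y => m j ⌊y / ε ^ γ⌋ * y + b j ⌊y / ε ^ γ⌋, S, ?_, mS, sS.trans sS0, ?_, ?_⟩
  · intro j
    refine ⟨0, fun n => ⟨m j n, b j n, (hm j n).trans k1, fun y hy => ?_⟩⟩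
    have hfl : ⌊y / ε ^ γ⌋ = n := by
      rw [Int.floor_eq_iff, le_div_iff₀ hδ, div_lt_iff₀ hδ]
      exact ⟨by linarith [hy.1], by linarith [hy.2]⟩
    simp only [hfl]
  · refine le_trans ?_ vS
    rw [hveq, ENNReal.ofReal_rpow_of_nonneg hv0 hC.le, ← ENNReal.ofReal_mul hc.le]
    exact ENNReal.ofReal_le_ofReal k3
  · intro x hx j
    rw [abs_sub_comm]
    exact (hb j x hx).trans k2
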